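/- Let G be a finite cyclic group of odd order and let 𝒮 be a normal S-ring partition over G, that is, the group of right translations G_right = {x ↦ xg : g ∈ G} is a normal subgroup of Aut(𝒮), where Aut(𝒮) is the group of all permutations f of G such that for all x,y ∈ G and all X ∈ 𝒮: yx⁻¹ ∈ X if and only if f(y)f(x)⁻¹ ∈ X. Let X ∈ 𝒮 be a highest basic set, i.e., X contains a generator of G. Then 𝒮 is the smallest S-ring over G containing X: for every S-ring partition 𝒯 of G such that X is a union of classes of 𝒯, every class of 𝒮 is a union of classes of 𝒯. -/

import Mathlib

/-- An S-ring partition over a group `G`: a partition of `G` containing `{1}`,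
closed under taking inverses, and with well-defined structure constants. -/
def IsSRing {G : Type*} [Group G] (S : Set (Set G)) : Prop :=
  Setoid.IsPartition S ∧
  {(1 : G)} ∈ S ∧
  (∀ X ∈ S, (fun x : G => x⁻¹) '' X ∈ S) ∧
  (∀ X ∈ S, ∀ Y ∈ S, ∀ Z ∈ S, ∀ z ∈ Z, ∀ z' ∈ Z,
    {p : G × G | p.1 ∈ X ∧ p.2 ∈ Y ∧ p.1 * p.2 = z}.ncard =
    {p : G × G | p.1 ∈ X ∧ p.2 ∈ Y ∧ p.1 * p.2 = z'}.ncard)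

/-- An `S`-set: a union of classes of the partition `S`. -/
def IsSSet {G : Type*} (S : Set (Set G)) (X : Set G) : Prop :=
  ∃ T ⊆ S, X = ⋃₀ T

/-- An automorphism of the S-ring `S`: a permutation `f` of `G` such that
for all `x, y` and all `X ∈ S`, `y·x⁻¹ ∈ X` iff `f(y)·f(x)⁻¹ ∈ X`. -/
def IsSRingAut {G : Type*} [Group G] (S : Set (Set G)) (f : Equiv.Perm G) : Prop :=
  ∀ X ∈ S, ∀ x y : G, (y * x⁻¹ ∈ X ↔ f y * (f x)⁻¹ ∈ X)

/-- The S-ring `S` is normal: the group of right translations is a normal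
subgroup of `Aut(S)`, i.e. every automorphism of `S` conjugates each right
translation to a right translation. -/
def IsNormalSRing {G : Type*} [Group G] (S : Set (Set G)) : Prop :=
  ∀ f : Equiv.Perm G, IsSRingAut S f →
    ∀ g : G, ∃ g' : G, ∀ x : G, f (x * g) = f x * g'


namespace SRP
open Classical Finset
open scoped Pointwise

universe u
set_option linter.all false
set_option linter.deprecated false

/-- S-ring over a finite abelian group, given by the equivalence relation of its classes. -/
structure SR (G : Type u) [AddCommGroup G] [Fintype G] where
  r : Setoid G
  zero : ∀ x, r 0 x → x = 0
  neg : ∀ x y, r x y → r (-x) (-y)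
  conv : ∀ f g : G → ℤ, (∀ x y, r x y → f x = f y) → (∀ x y, r x y → g x = g y) →
    ∀ z z', r z z' → ∑ x, f x * g (z - x) = ∑ x, f x * g (z' - x)

namespace SR
variable {G : Type u} [AddCommGroup G] [Fintype G] (S : SR G)

def Meas {α : Type*} (f : G → α) : Prop := ∀ x y, S.r x y → f x = f y
def Sat (A : Set G) : Prop := ∀ x y, S.r x y → x ∈ A → y ∈ A
def cls (x : G) : Set G := {y | S.r x y}

variable {S}

theorem rfl' (x : G) : S.r x x := S.r.refl x
theorem symm' {x y : G} (h : S.r x y) : S.r y x := S.r.symm h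
theorem trans' {x y z : G} (h : S.r x y) (h' : S.r y z) : S.r x z := S.r.trans h h'

theorem mem_cls {x y : G} : y ∈ S.cls x ↔ S.r x y := Iff.rfl
theorem self_mem_cls (x : G) : x ∈ S.cls x := S.rfl' x
theorem cls_sat (x : G) : S.Sat (S.cls x) := fun _ _ h h' => S.trans' h' h
theorem cls_eq {x y : G} (h : S.r x y) : S.cls x = S.cls y := by
  ext z; exact ⟨fun h' => S.trans' (S.symm' h) h', fun h' => S.trans' h h'⟩
theorem Sat.cls_subset {A : Set G} (hA : S.Sat A) {x : G} (hx : x ∈ A) : S.cls x ⊆ A :=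
  fun y hy => hA x y hy hx
theorem Sat.iff {A : Set G} (hA : S.Sat A) {x y : G} (h : S.r x y) : x ∈ A ↔ y ∈ A :=
  ⟨hA x y h, hA y x (S.symm' h)⟩
theorem Sat.meas {A : Set G} (hA : S.Sat A) {α : Type*} (a b : α) :
    S.Meas (fun x => if x ∈ A then a else b) := by
  intro x y h; simp only [hA.iff h]
theorem Sat.inter {A B : Set G} (hA : S.Sat A) (hB : S.Sat B) : S.Sat (A ∩ B) :=
  fun x y h hx => ⟨hA x y h hx.1, hB x y h hx.2⟩
theorem Sat.union {A B : Set G} (hA : S.Sat A) (hB : S.Sat B) : S.Sat (A ∪ B) :=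
  fun x y h hx => hx.imp (hA x y h) (hB x y h)
theorem Sat.compl {A : Set G} (hA : S.Sat A) : S.Sat Aᶜ :=
  fun x y h hx hy => hx (hA y x (S.symm' h) hy)
theorem Sat.diff {A B : Set G} (hA : S.Sat A) (hB : S.Sat B) : S.Sat (A \ B) :=
  hA.inter hB.compl
theorem sat_zero : S.Sat {0} := by
  rintro x y h hx; rw [Set.mem_singleton_iff] at *; subst hx; exact S.zero _ h
theorem sat_univ : S.Sat Set.univ := fun _ _ _ _ => trivial
theorem Meas.sat {α : Type*} {f : G → α} (hf : S.Meas f) (p : α → Prop) : S.Sat {x | p (f x)} := by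
  intro x y h hx; simp only [Set.mem_ofPred_eq] at *; rwa [← hf x y h]
theorem Meas.comp {α β : Type*} {f : G → α} (hf : S.Meas f) (g : α → β) :
    S.Meas (fun x => g (f x)) := fun x y h => congrArg g (hf x y h)
theorem Meas.comp₂ {α β γ : Type*} {f : G → α} {f' : G → β} (hf : S.Meas f) (hf' : S.Meas f')
    (g : α → β → γ) : S.Meas (fun x => g (f x) (f' x)) := fun x y h => congrArg₂ g (hf x y h) (hf' x y h)

theorem Meas.neg {α : Type*} {f : G → α} (hf : S.Meas f) : S.Meas (fun x => f (-x)) :=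
  fun x y h => hf _ _ (S.neg _ _ h)

/-- General convolution lemma. -/
theorem conv_gen {M : Type*} [AddCommMonoid M] (F : G → G → M)
    (h1 : ∀ x x' y, S.r x x' → F x y = F x' y) (h2 : ∀ x y y', S.r y y' → F x y = F x y') :
    S.Meas (fun z => ∑ x, F x (z - x)) := by
  have hF : ∃ F' : Quotient S.r → Quotient S.r → M, ∀ x y, F x y = F' ⟦x⟧ ⟦y⟧ := by
    refine ⟨fun a b => F a.out b.out, fun x y => ?_⟩
    have e1 := Quotient.mk_out (s := S.r) x
    have e2 := Quotient.mk_out (s := S.r) y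
    rw [h1 _ _ _ (S.symm' e1), h2 _ _ _ (S.symm' e2)]
  obtain ⟨F', hF'⟩ := hF
  have key : ∀ z, ∑ x, F x (z - x) = ∑ c : Quotient S.r × Quotient S.r,
      (#{x : G | (⟦x⟧, ⟦z - x⟧) = c}) • F' c.1 c.2 := by
    intro z
    rw [← Finset.sum_fiberwise (s := univ) (g := fun x => ((⟦x⟧ : Quotient S.r), (⟦z - x⟧ : Quotient S.r)))]
    apply Finset.sum_congr rfl
    intro c _
    rw [Finset.sum_congr rfl (g := fun _ => F' c.1 c.2)]
    · simp
    · intro x hx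
      simp only [mem_filter, mem_univ, true_and] at hx
      rw [hF', ← hx]
  intro z z' h
  simp only [key]
  apply Finset.sum_congr rfl
  intro c _
  congr 1
  have := S.conv (fun x => if (⟦x⟧ : Quotient S.r) = c.1 then 1 else 0)
    (fun x => if (⟦x⟧ : Quotient S.r) = c.2 then 1 else 0)
    (fun x y h => by rw [Quotient.sound h]) (fun x y h => by rw [Quotient.sound h]) z z' h
  have e : ∀ w : G, ((#{x : G | (⟦x⟧, ⟦w - x⟧) = c} : ℕ) : ℤ) =
     ∑ x, (if (⟦x⟧ : Quotient S.r) = c.1 then 1 else 0) * (if (⟦w - x⟧ : Quotient S.r) = c.2 then 1 else 0) := by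
    intro w
    rw [Finset.card_filter]
    push_cast
    apply Finset.sum_congr rfl
    intro x _
    simp only [Prod.ext_iff]
    by_cases a : (⟦x⟧ : Quotient S.r) = c.1 <;> by_cases b : (⟦w - x⟧ : Quotient S.r) = c.2 <;> simp [a, b]
  rw [← e, ← e] at this
  exact_mod_cast this

theorem Meas.conv {R : Type*} [NonUnitalNonAssocSemiring R] {f g : G → R} (hf : S.Meas f) (hg : S.Meas g) :
    S.Meas (fun z => ∑ x, f x * g (z - x)) :=
  conv_gen (fun x y => f x * g y) (fun x x' y h => by rw [hf _ _ h]) (fun x y y' h => by rw [hg _ _ h])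

/-- correlation -/
theorem Meas.corr {R : Type*} [NonUnitalNonAssocSemiring R] {f g : G → R} (hf : S.Meas f) (hg : S.Meas g) :
    S.Meas (fun z => ∑ x, f x * g (z + x)) := by
  have := (hf.neg).conv hg
  intro z z' h
  have := this z z' h
  simp only at this
  rw [← Equiv.sum_comp (Equiv.neg G), ← Equiv.sum_comp (Equiv.neg G) (fun x => f (-x) * g (z' - x))] at this
  simpa using this

theorem Sat.exists_sum {A B : Set G} (hA : S.Sat A) (hB : S.Sat B) :
    S.Sat {z | ∃ x ∈ A, z - x ∈ B} := by
  have := (hA.meas (1:ℕ) 0).conv (hB.meas (1:ℕ) 0)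
  have h2 := this.sat (fun n => n ≠ 0)
  convert h2 using 1
  ext z
  simp only [Set.mem_ofPred_eq, ne_eq, Finset.sum_eq_zero_iff, not_forall]
  constructor
  · rintro ⟨x, hx, hy⟩; exact ⟨x, mem_univ _, by simp [hx, hy]⟩
  · rintro ⟨x, _, h⟩; refine ⟨x, ?_, ?_⟩ <;> by_contra hc <;> simp [hc] at h

theorem Sat.add {A B : Set G} (hA : S.Sat A) (hB : S.Sat B) : S.Sat (A + B) := by
  convert hA.exists_sum hB using 1
  ext z; simp only [Set.mem_add, Set.mem_ofPred_eq]
  constructor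
  · rintro ⟨x, hx, y, hy, rfl⟩; exact ⟨x, hx, by simpa using hy⟩
  · rintro ⟨x, hx, h⟩; exact ⟨x, hx, _, h, by abel⟩

/-- if `x + y` is related to `z` then `z = x' + y'` with related summands -/
theorem split {x y z : G} (h : S.r (x + y) z) : ∃ x' y', S.r x x' ∧ S.r y y' ∧ z = x' + y' := by
  have := ((S.cls_sat x).add (S.cls_sat y)) _ _ h (Set.add_mem_add (S.self_mem_cls x) (S.self_mem_cls y))
  obtain ⟨x', hx, y', hy, e⟩ := this
  exact ⟨x', y', hx, hy, e.symm⟩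

theorem r_neg {x y : G} : S.r (-x) (-y) ↔ S.r x y :=
  ⟨fun h => by simpa using S.neg _ _ h, S.neg x y⟩

theorem r_zero_left {x : G} : S.r 0 x ↔ x = 0 := ⟨S.zero x, fun h => h ▸ S.rfl' 0⟩
theorem r_zero_right {x : G} : S.r x 0 ↔ x = 0 := ⟨fun h => S.zero x (S.symm' h), fun h => h ▸ S.rfl' 0⟩

def core (S : SR G) (K : AddSubgroup G) : AddSubgroup G where
  carrier := {x | ∀ y, S.r x y → y ∈ K}
  zero_mem' := by intro y h; rw [S.zero y h]; exact K.zero_mem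
  add_mem' := by
    intro a b ha hb y h
    obtain ⟨a', b', h1, h2, rfl⟩ := split h
    exact K.add_mem (ha _ h1) (hb _ h2)
  neg_mem' := by
    intro a ha y h
    have : S.r a (-y) := by rw [← r_neg]; simpa using h
    simpa using K.neg_mem (ha _ this)

theorem mem_core {K : AddSubgroup G} {x : G} : x ∈ S.core K ↔ ∀ y, S.r x y → y ∈ K := Iff.rfl
theorem core_sat (K : AddSubgroup G) : S.Sat (S.core K : Set G) := by
  intro x y h hx z hz; exact hx z (S.trans' h hz)
theorem core_le (K : AddSubgroup G) : S.core K ≤ K := fun x hx => hx x (S.rfl' x)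
theorem le_core {H K : AddSubgroup G} (hH : S.Sat (H : Set G)) (h : H ≤ K) : H ≤ S.core K :=
  fun x hx y hy => h (hH x y hy hx)

theorem sat_closure {A : Set G} (hA : S.Sat A) : S.Sat (AddSubgroup.closure A : Set G) := by
  have : S.core (AddSubgroup.closure A) = AddSubgroup.closure A := by
    apply le_antisymm (S.core_le _)
    rw [AddSubgroup.closure_le]
    intro x hx y hy
    exact AddSubgroup.subset_closure (hA x y hy hx)
  rw [← this]; exact S.core_sat _

theorem sat_sup {H K : AddSubgroup G} (hH : S.Sat (H : Set G)) (hK : S.Sat (K : Set G)) :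
    S.Sat ((H ⊔ K : AddSubgroup G) : Set G) := by
  have : S.core (H ⊔ K) = H ⊔ K := by
    apply le_antisymm (S.core_le _)
    exact sup_le (S.le_core hH le_sup_left) (S.le_core hK le_sup_right)
  rw [← this]; exact S.core_sat _

theorem sat_inf {H K : AddSubgroup G} (hH : S.Sat (H : Set G)) (hK : S.Sat (K : Set G)) :
    S.Sat ((H ⊓ K : AddSubgroup G) : Set G) := hH.inter hK

/-- radical (stabiliser) of a set -/
def _root_.SRP.rad (A : Set G) : AddSubgroup G where
  carrier := {g | ∀ x, x ∈ A ↔ g + x ∈ A}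
  zero_mem' := by intro x; simp
  add_mem' := by intro a b ha hb x; rw [hb, ha, add_assoc]
  neg_mem' := by intro a ha x; rw [ha (-a + x)]; simp

theorem mem_rad {A : Set G} {g : G} : g ∈ rad A ↔ ∀ x, x ∈ A ↔ g + x ∈ A := Iff.rfl

theorem mem_rad' {A : Set G} {g : G} (h : ∀ x ∈ A, g + x ∈ A) : g ∈ rad A := by
  intro x
  refine ⟨h x, fun hx => ?_⟩
  have hinj : Set.InjOn (fun x => g + x) A := fun a _ b _ e => add_left_cancel e
  have : (fun x => g + x) '' A = A := by
    apply Set.eq_of_subset_of_ncard_le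
    · rintro _ ⟨x, hx, rfl⟩; exact h x hx
    · rw [Set.InjOn.ncard_image hinj]
    · exact Set.toFinite _
  rw [← this] at hx
  obtain ⟨y, hy, e⟩ := hx
  rwa [← add_left_cancel e]

theorem sat_rad {A : Set G} (hA : S.Sat A) : S.Sat (rad A : Set G) := by
  have := (hA.meas (1:ℕ) 0).corr (hA.meas (1:ℕ) 0)
  have h2 := this.sat (fun n => n = #{x : G | x ∈ A})
  convert h2 using 1
  ext g
  simp only [Set.mem_ofPred_eq, SetLike.mem_coe]
  have e : ∀ x, (if x ∈ A then 1 else 0) * (if g + x ∈ A then 1 else 0) = if (x ∈ A ∧ g + x ∈ A) then 1 else 0 := by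
    intro x; by_cases a : x ∈ A <;> by_cases b : g + x ∈ A <;> simp [a, b]
  rw [Finset.sum_congr rfl (fun x _ => e x), ← Finset.card_filter]
  constructor
  · intro h; congr 1; ext x; simp only [mem_filter, mem_univ, true_and]
    exact ⟨fun h => h.1, fun hx => ⟨hx, (h x).1 hx⟩⟩
  · intro h
    apply mem_rad'
    intro x hx
    have := Finset.eq_of_subset_of_card_le (s := ({x : G | x ∈ A ∧ g + x ∈ A} : Finset G)) (t := ({x : G | x ∈ A} : Finset G))
      (by intro x hx; simp only [mem_filter, mem_univ, true_and] at *; exact hx.1) (by rw [h])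
    have hx' : x ∈ ({x : G | x ∈ A} : Finset G) := by simpa using hx
    rw [← this] at hx'
    simp only [mem_filter, mem_univ, true_and] at hx'
    exact hx'.2

def sub (S : SR G) (H : AddSubgroup G) (hH : S.Sat (H : Set G)) : SR H where
  r := S.r.comap Subtype.val
  zero := fun x h => Subtype.ext (S.zero x.1 h)
  neg := fun x y h => S.neg _ _ h
  conv := by
    intro f g hf hg z z' h
    have ext_meas : ∀ f : H → ℤ, (∀ x y : H, S.r x.1 y.1 → f x = f y) →
        S.Meas (fun x : G => if hx : x ∈ H then f ⟨x, hx⟩ else 0) := by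
      intro f hf x y h
      have : x ∈ H ↔ y ∈ H := hH.iff h
      by_cases hx : x ∈ H
      · have hy := this.1 hx
        simp only [dif_pos hx, dif_pos hy]; exact hf _ _ h
      · have hy : y ∉ H := fun hy => hx (this.2 hy)
        simp only [dif_neg hx, dif_neg hy]
    have := (ext_meas f hf).conv (ext_meas g hg) z.1 z'.1 h
    have key : ∀ w : H, ∑ x : H, f x * g (w - x) = ∑ x : G, (if hx : x ∈ H then f ⟨x, hx⟩ else 0) *
        (if hx : w.1 - x ∈ H then g ⟨w.1 - x, hx⟩ else 0) := by
      intro w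
      rw [← Finset.sum_subset (Finset.subset_univ (univ.map (Function.Embedding.subtype (fun x => x ∈ H))))]
      · rw [Finset.sum_map]
        apply Finset.sum_congr rfl
        rintro ⟨x, hx⟩ _
        have : w.1 - x ∈ H := H.sub_mem w.2 hx
        change _ = (if hx : x ∈ H then f ⟨x, hx⟩ else 0) *
          (if hx : w.1 - x ∈ H then g ⟨w.1 - x, hx⟩ else 0)
        rw [dif_pos hx, dif_pos this]
        rfl
      · intro x _ hx
        have : x ∉ H := by simpa using hx
        simp [this]
    rw [key, key]; exact this

theorem sub_r {H : AddSubgroup G} {hH : S.Sat (H : Set G)} {x y : H} : (S.sub H hH).r x y ↔ S.r x.1 y.1 := Iff.rfl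

/-- quotient by an S-subgroup -/
def quot (S : SR G) (L : AddSubgroup G) (hL : S.Sat (L : Set G)) : SR (G ⧸ L) where
  r := { r := fun a b => ∀ f : G ⧸ L → ℤ, S.Meas (fun x : G => f x) → f a = f b
         iseqv := ⟨fun _ _ _ => rfl, fun h f hf => (h f hf).symm, fun h h' f hf => (h f hf).trans (h' f hf)⟩ }
  zero := by
    intro x h
    by_contra hx
    have := h (fun y => if y = 0 then 1 else 0) (by
      have := hL.meas (1:ℤ) 0
      simpa only [QuotientAddGroup.eq_zero_iff, SetLike.mem_coe] using this)
    simp [hx] at this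
  neg := by
    intro x y h f hf
    exact h (fun z => f (-z)) (hf.neg)
  conv := by
    intro f g hf hg z z' h
    have hL0 : (Nat.card L : ℤ) ≠ 0 := by exact_mod_cast Nat.card_pos.ne'
    have mf : S.Meas (fun x : G => f x) := fun x y h => hf _ _ (fun k hk => hk _ _ h)
    have mg : S.Meas (fun x : G => g x) := fun x y h => hg _ _ (fun k hk => hk _ _ h)
    have := mf.conv mg
    have key : ∀ w : G, ∑ x : G, f x * g ((w - x : G)) = (Nat.card L : ℤ) * ∑ x : G ⧸ L, f x * g (w - x) := by
      intro w
      rw [← Finset.sum_fiberwise (s := univ) (g := fun x : G => (x : G ⧸ L)), Finset.mul_sum]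
      apply Finset.sum_congr rfl
      intro c _
      rw [Finset.sum_congr rfl (g := fun _ => f c * g (w - c))]
      · rw [Finset.sum_const, nsmul_eq_mul]
        congr 2
        obtain ⟨c, rfl⟩ := QuotientAddGroup.mk_surjective c
        rw [Nat.card_eq_fintype_card, ← Fintype.card_coe]
        refine Fintype.card_congr ⟨fun x => ⟨-c + x.1, ?_⟩, fun l => ⟨c + l.1, ?_⟩, ?_, ?_⟩
        · have := x.2; simp only [mem_filter, mem_univ, true_and] at this
          exact QuotientAddGroup.eq.1 this.symm
        · simp
        · intro x; ext; simp
        · intro x; ext; simp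
      · intro x hx
        simp only [mem_filter, mem_univ, true_and] at hx
        rw [← hx]; rfl
    have := h (fun w => ∑ x : G ⧸ L, f x * g (w - x)) (by
      intro x y hxy
      have := this x y hxy
      simp only [key] at this
      exact mul_left_cancel₀ hL0 this)
    exact this

section quot
variable {L : AddSubgroup G} {hL : S.Sat (L : Set G)}

theorem quot_mk {x y : G} (h : S.r x y) : (S.quot L hL).r x y := fun _ hf => hf _ _ h

theorem quot_meas {α : Type*} {f : G ⧸ L → α} : (S.quot L hL).Meas f ↔ S.Meas (fun x : G => f x) := by
  constructor
  · intro h x y hxy; exact h _ _ (quot_mk hxy)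
  · intro h a b hab
    have := hab (fun y => if f y = f a then 1 else 0) (fun x y hxy => by
      have := h x y hxy
      simp only at this ⊢
      rw [this])
    by_contra hc
    have hc' : f b ≠ f a := fun h => hc h.symm
    simp [hc'] at this

theorem quot_sat {A : Set (G ⧸ L)} : (S.quot L hL).Sat A ↔ S.Sat {x : G | (x : G ⧸ L) ∈ A} := by
  constructor
  · intro h x y hxy hx; exact h _ _ (quot_mk hxy) hx
  · intro h
    have : (S.quot L hL).Meas (fun a => if a ∈ A then 1 else 0) := quot_meas.2 (h.meas 1 0)
    intro a b hab ha
    by_contra hb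
    have := this a b hab
    simp [ha, hb] at this

theorem quot_r_out {x y : G} (h : (S.quot L hL).r x y) : ∃ l ∈ L, S.r x (y + l) := by
  have h1 : (S.quot L hL).Sat {a | ∃ x', S.r x x' ∧ (x' : G ⧸ L) = a} := by
    rw [quot_sat]
    convert (S.cls_sat x).exists_sum hL using 1
    ext z
    simp only [Set.mem_ofPred_eq, SetLike.mem_coe]
    refine exists_congr fun x' => and_congr Iff.rfl ?_
    rw [QuotientAddGroup.eq, neg_add_eq_sub]
  obtain ⟨x', hx', e⟩ := h1 _ _ h ⟨x, S.rfl' x, rfl⟩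
  refine ⟨-y + x', QuotientAddGroup.eq.1 e.symm, by simpa using hx'⟩

theorem quot_r_iff {x y : G} : (S.quot L hL).r x y ↔ ∃ l ∈ L, S.r x (y + l) := by
  refine ⟨quot_r_out, ?_⟩
  rintro ⟨l, hl, h⟩
  have := quot_mk (L := L) (hL := hL) h
  rwa [QuotientAddGroup.mk_add, (QuotientAddGroup.eq_zero_iff l).2 hl, add_zero] at this

theorem sat_comap_mk {B : AddSubgroup (G ⧸ L)} (hB : (S.quot L hL).Sat (B : Set (G ⧸ L))) :
    S.Sat ((B.comap (QuotientAddGroup.mk' L) : AddSubgroup G) : Set G) := quot_sat.1 hB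

theorem sat_map_mk {B : AddSubgroup G} (hB : S.Sat (B : Set G)) :
    (S.quot L hL).Sat ((B.map (QuotientAddGroup.mk' L) : AddSubgroup (G ⧸ L)) : Set (G ⧸ L)) := by
  rw [quot_sat]
  convert S.sat_sup hB hL using 1
  have := QuotientAddGroup.comap_map_mk' L B
  rw [sup_comm, ← this]
  rfl

end quot

section sub
variable {H : AddSubgroup G} {hH : S.Sat (H : Set G)}

theorem sub_sat {A : Set H} : (S.sub H hH).Sat A ↔ S.Sat (Subtype.val '' A) := by
  constructor
  · rintro h x y hxy ⟨x', hx', rfl⟩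
    exact ⟨⟨y, hH _ _ hxy x'.2⟩, h x' ⟨y, _⟩ hxy hx', rfl⟩
  · intro h x y hxy hx
    obtain ⟨y', hy', e⟩ := h _ _ hxy ⟨x, hx, rfl⟩
    rwa [← Subtype.ext e]

theorem sub_sat_pre {A : Set G} (hA : S.Sat A) : (S.sub H hH).Sat {x : H | x.1 ∈ A} :=
  fun x y h hx => hA _ _ h hx

theorem sat_map_sub {B : AddSubgroup H} (hB : (S.sub H hH).Sat (B : Set H)) :
    S.Sat ((B.map H.subtype : AddSubgroup G) : Set G) := sub_sat.1 hB

theorem sat_comap_sub {B : AddSubgroup G} (hB : S.Sat (B : Set G)) :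
    (S.sub H hH).Sat ((B.comap H.subtype : AddSubgroup H) : Set H) :=
  fun x y h hx => hB _ _ h hx
end sub

/-- the join -/
def join (S T : SR G) : SR G where
  r := S.r ⊔ T.r
  zero := by
    intro x h
    have : S.r ⊔ T.r ≤ Setoid.ker (fun x : G => x = 0) := by
      refine sup_le ?_ ?_
      · intro a b h; rw [Setoid.ker_def]; exact propext (S.sat_zero.iff h)
      · intro a b h; rw [Setoid.ker_def]; exact propext (T.sat_zero.iff h)
    have h2 := this h
    rw [Setoid.ker_def] at h2
    simpa using h2
  neg := by
    intro x y h
    have : S.r ⊔ T.r ≤ Setoid.comap (fun x => -x) (S.r ⊔ T.r) := by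
      refine sup_le ?_ ?_
      · intro a b h; exact (le_sup_left : S.r ≤ S.r ⊔ T.r) (S.neg _ _ h)
      · intro a b h; exact (le_sup_right : T.r ≤ S.r ⊔ T.r) (T.neg _ _ h)
    exact this h
  conv := by
    intro f g hf hg z z' h
    have hS : S.Meas (fun z => ∑ x, f x * g (z - x)) :=
      Meas.conv (fun x y h => hf x y ((le_sup_left : S.r ≤ S.r ⊔ T.r) h))
        (fun x y h => hg x y ((le_sup_left : S.r ≤ S.r ⊔ T.r) h))
    have hT : T.Meas (fun z => ∑ x, f x * g (z - x)) :=
      Meas.conv (fun x y h => hf x y ((le_sup_right : T.r ≤ S.r ⊔ T.r) h))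
        (fun x y h => hg x y ((le_sup_right : T.r ≤ S.r ⊔ T.r) h))
    have : S.r ⊔ T.r ≤ Setoid.ker (fun z => ∑ x, f x * g (z - x)) :=
      sup_le (fun a b h => hS a b h) (fun a b h => hT a b h)
    exact this h

theorem join_left {T : SR G} {x y : G} (h : S.r x y) : (S.join T).r x y :=
  (le_sup_left : S.r ≤ S.r ⊔ T.r) h
theorem join_right {T : SR G} {x y : G} (h : T.r x y) : (S.join T).r x y :=
  (le_sup_right : T.r ≤ S.r ⊔ T.r) h
theorem join_sat {T : SR G} {A : Set G} (hS : S.Sat A) (hT : T.Sat A) : (S.join T).Sat A := by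
  intro x y h hx
  have : S.r ⊔ T.r ≤ Setoid.ker (fun x : G => x ∈ A) :=
    sup_le (fun a b h => propext (hS.iff h)) (fun a b h => propext (hT.iff h))
  have h2 := this h
  rw [Setoid.ker_def] at h2
  exact h2 ▸ hx

end SR
end SRP

namespace SRP
open Classical Finset
open scoped Pointwise
universe u
set_option linter.all false
set_option linter.deprecated false

theorem lift_coprime {m n j : ℕ} (hn : n ≠ 0) (hmn : m ∣ n) (hj : j.Coprime m) :
    ∃ k : ℕ, k ≡ j [MOD m] ∧ k.Coprime n := by
  haveI : NeZero n := ⟨hn⟩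
  obtain ⟨v, hv⟩ := ZMod.unitsMap_surjective hmn (ZMod.unitOfCoprime j hj)
  refine ⟨v.val.val, ?_, ZMod.val_coe_unit_coprime v⟩
  rw [← ZMod.natCast_eq_natCast_iff]
  have := congrArg Units.val hv
  rw [ZMod.unitsMap_val, ZMod.coe_unitOfCoprime] at this
  rw [← this]
  rw [ZMod.natCast_val]

/-- simultaneous congruences plus coprimality -/
theorem crt_coprime {n : ℕ} (hn : n ≠ 0) {a b j : ℕ} (hab : a.Coprime b) (h : a * b ∣ n) (hj : j.Coprime a) :
    ∃ k : ℕ, k ≡ j [MOD a] ∧ k ≡ 1 [MOD b] ∧ k.Coprime n := by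
  obtain ⟨c, hc1, hc2⟩ := Nat.chineseRemainder hab j 1
  have h1 : c.Coprime a := by
    unfold Nat.Coprime at *; rw [hc1.gcd_eq, hj]
  have h2 : c.Coprime b := by
    unfold Nat.Coprime at *; rw [hc2.gcd_eq]; simp
  obtain ⟨k, hk, hk'⟩ := lift_coprime hn h (Nat.Coprime.mul_right h1 h2)
  exact ⟨k, (hk.of_mul_right _).trans hc1, (hk.of_mul_left _).trans hc2, hk'⟩

section cyc
variable {G : Type u} [AddCommGroup G] [Fintype G]

def tor (G : Type u) [AddCommGroup G] (d : ℕ) : AddSubgroup G := (nsmulAddMonoidHom (α := G) d).ker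
def mul (G : Type u) [AddCommGroup G] (d : ℕ) : AddSubgroup G := (nsmulAddMonoidHom (α := G) d).range

theorem mem_tor {d : ℕ} {x : G} : x ∈ tor G d ↔ d • x = 0 := Iff.rfl
theorem mem_mul {d : ℕ} {x : G} : x ∈ mul G d ↔ ∃ y, d • y = x := Iff.rfl
theorem nsmul_mem_mul (d : ℕ) (x : G) : d • x ∈ mul G d := ⟨x, rfl⟩

theorem mem_tor_ord {d : ℕ} {x : G} : x ∈ tor G d ↔ addOrderOf x ∣ d := by
  rw [mem_tor, addOrderOf_dvd_iff_nsmul_eq_zero]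

def IsGen (x : G) : Prop := addOrderOf x = Nat.card G

theorem isGen_iff {x : G} : IsGen x ↔ ∀ y, y ∈ AddSubgroup.zmultiples x := by
  unfold IsGen
  rw [← Nat.card_zmultiples, AddSubgroup.card_eq_iff_eq_top]
  exact AddSubgroup.eq_top_iff' _

theorem IsGen.exists_nsmul {x : G} (h : IsGen x) (y : G) : ∃ k : ℕ, y = k • x := by
  have := isGen_iff.1 h y
  rw [mem_zmultiples_iff_mem_range_addOrderOf] at this
  simp only [Finset.mem_image] at this
  obtain ⟨k, _, e⟩ := this
  exact ⟨k, e.symm⟩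

variable [IsAddCyclic G]

theorem exists_gen : ∃ x : G, IsGen x := by
  obtain ⟨g, hg⟩ := IsAddCyclic.exists_generator (α := G)
  exact ⟨g, isGen_iff.2 hg⟩

theorem card_tor_le {d : ℕ} (hd : 0 < d) : Nat.card (tor G d) ≤ d := by
  have := IsAddCyclic.card_nsmul_eq_zero_le (α := G) hd
  rw [Nat.card_eq_fintype_card]
  rw [Fintype.card_subtype]
  exact this

theorem eq_tor_card (H : AddSubgroup G) : H = tor G (Nat.card H) := by
  apply AddSubgroup.eq_of_le_of_card_ge
  · intro x hx
    rw [mem_tor]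
    have := card_nsmul_eq_zero' (x := (⟨x, hx⟩ : H))
    exact congrArg Subtype.val this
  · exact card_tor_le Nat.card_pos

theorem mem_iff_nsmul {H : AddSubgroup G} {x : G} : x ∈ H ↔ Nat.card H • x = 0 := by
  conv_lhs => rw [eq_tor_card H]
  exact mem_tor

theorem mem_iff_ord {H : AddSubgroup G} {x : G} : x ∈ H ↔ addOrderOf x ∣ Nat.card H := by
  rw [mem_iff_nsmul, addOrderOf_dvd_iff_nsmul_eq_zero]

theorem sub_eq_of_card {H K : AddSubgroup G} (h : Nat.card H = Nat.card K) : H = K := by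
  rw [eq_tor_card H, h, ← eq_tor_card]

theorem le_iff_card {H K : AddSubgroup G} : H ≤ K ↔ Nat.card H ∣ Nat.card K := by
  constructor
  · exact AddSubgroup.card_dvd_of_le
  · intro h x hx
    rw [mem_iff_ord] at *
    exact hx.trans h

theorem card_mul {d : ℕ} (hd : d ∣ Nat.card G) : Nat.card (mul G d) = Nat.card G / d := by
  have h := IsAddCyclic.card_nsmulAddMonoidHom_range (G := G) d
  rw [Nat.gcd_eq_right hd] at h
  exact h

theorem card_tor {d : ℕ} (hd : d ∣ Nat.card G) : Nat.card (tor G d) = d := by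
  have h := IsAddCyclic.card_nsmulAddMonoidHom_ker (G := G) d
  rw [Nat.gcd_eq_right hd] at h
  exact h

theorem mem_mul_iff {d : ℕ} (hd : d ∣ Nat.card G) {x : G} : x ∈ mul G d ↔ addOrderOf x ∣ Nat.card G / d := by
  rw [mem_iff_ord, card_mul hd]

theorem ord_dvd (x : G) : addOrderOf x ∣ Nat.card G := addOrderOf_dvd_natCard x

theorem exists_prime_of_ne_top {H : AddSubgroup G} (hH : H ≠ ⊤) :
    ∃ p : ℕ, p.Prime ∧ p ∣ Nat.card G ∧ H ≤ mul G p := by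
  have hd : Nat.card H ∣ Nat.card G := AddSubgroup.card_addSubgroup_dvd_card H
  obtain ⟨e, he⟩ := hd
  have : e ≠ 1 := by
    rintro rfl
    apply hH
    rw [← AddSubgroup.card_eq_iff_eq_top, he, mul_one]
  obtain ⟨p, hp, f, rfl⟩ := Nat.exists_prime_and_dvd this
  have hpn : p ∣ Nat.card G := ⟨Nat.card H * f, by rw [he]; ring⟩
  refine ⟨p, hp, hpn, ?_⟩
  rw [le_iff_card, card_mul hpn]
  refine ⟨f, ?_⟩
  rw [he, show Nat.card H * (p * f) = p * (Nat.card H * f) by ring]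
  exact Nat.mul_div_cancel_left _ hp.pos

theorem isGen_iff_prime {x : G} : IsGen x ↔ ∀ p : ℕ, p.Prime → p ∣ Nat.card G → x ∉ mul G p := by
  constructor
  · intro h p hp hpn hx
    rw [mem_mul_iff hpn, h] at hx
    have := Nat.le_of_dvd (Nat.div_pos (Nat.le_of_dvd Nat.card_pos hpn) hp.pos) hx
    exact absurd this (not_le.2 (Nat.div_lt_self Nat.card_pos hp.one_lt))
  · intro h
    by_contra hx
    have : AddSubgroup.zmultiples x ≠ ⊤ := by
      intro h'; apply hx; rw [isGen_iff, h']; simp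
    obtain ⟨p, hp, hpn, hle⟩ := exists_prime_of_ne_top this
    exact h p hp hpn (hle (AddSubgroup.mem_zmultiples x))

theorem IsGen.not_mem_mul {x : G} (h : IsGen x) {p : ℕ} (hp : p.Prime) (hpn : p ∣ Nat.card G) : x ∉ mul G p :=
  isGen_iff_prime.1 h p hp hpn

theorem IsGen.eq_top {x : G} (h : IsGen x) {H : AddSubgroup G} (hx : x ∈ H) : H = ⊤ := by
  rw [AddSubgroup.eq_top_iff']
  intro y
  obtain ⟨k, rfl⟩ := h.exists_nsmul y
  exact H.nsmul_mem hx k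

theorem nsmul_congr {x : G} {a b : ℕ} (h : a ≡ b [MOD addOrderOf x]) : a • x = b • x :=
  (nsmul_eq_nsmul_iff_modEq).2 h

/-- same order implies unit multiple -/
theorem exists_unit_of_ord_eq {x y : G} (h : addOrderOf x = addOrderOf y) :
    ∃ k : ℕ, k.Coprime (Nat.card G) ∧ y = k • x := by
  have hy : y ∈ AddSubgroup.zmultiples x := by
    rw [mem_iff_ord, Nat.card_zmultiples, h]
  rw [mem_zmultiples_iff_mem_range_addOrderOf] at hy
  simp only [Finset.mem_image] at hy
  obtain ⟨j, _, rfl⟩ := hy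
  have hj : j.Coprime (addOrderOf x) := by
    have h1 := addOrderOf_nsmul x (n := j)
    have h2 : addOrderOf x / Nat.gcd (addOrderOf x) j = addOrderOf x := h1.symm.trans h.symm
    have hpos := addOrderOf_pos x
    rw [Nat.div_eq_self] at h2
    rcases h2 with h2 | h2
    · omega
    · rw [Nat.coprime_comm]; exact h2
  obtain ⟨k, hk, hk'⟩ := lift_coprime Nat.card_pos.ne' (ord_dvd x) hj
  exact ⟨k, hk', (nsmul_congr hk).symm⟩

theorem ord_unit {x : G} {k : ℕ} (hk : k.Coprime (Nat.card G)) : addOrderOf (k • x) = addOrderOf x := by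
  apply Nat.Coprime.addOrderOf_nsmul
  exact (hk.coprime_dvd_right (ord_dvd x)).symm

theorem unit_inj {k : ℕ} (hk : k.Coprime (Nat.card G)) {x y : G} (h : k • x = k • y) : x = y := by
  have : addOrderOf (x - y) = 1 := by
    rw [← ord_unit hk, smul_sub, h, sub_self, addOrderOf_zero]
  rw [AddMonoid.addOrderOf_eq_one_iff, sub_eq_zero] at this
  exact this

theorem mem_unit {k : ℕ} (hk : k.Coprime (Nat.card G)) {H : AddSubgroup G} {x : G} : k • x ∈ H ↔ x ∈ H := by
  rw [mem_iff_ord, ord_unit hk, ← mem_iff_ord]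

theorem unit_inverse {k : ℕ} (hk : k.Coprime (Nat.card G)) : ∃ j : ℕ, j.Coprime (Nat.card G) ∧ (∀ x : G, j • k • x = x) ∧ (∀ x : G, k • j • x = x) := by
  obtain ⟨g, hg⟩ := exists_gen (G := G)
  have h1 : addOrderOf (k • g) = addOrderOf g := ord_unit hk
  obtain ⟨j, hj, e⟩ := exists_unit_of_ord_eq h1
  have h2 : ∀ x : G, j • k • x = x := by
    intro x
    obtain ⟨a, rfl⟩ := hg.exists_nsmul x
    conv_rhs => rw [e]
    simp only [smul_smul]
    congr 1; ring
  refine ⟨j, hj, h2, fun x => ?_⟩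
  rw [smul_comm]; exact h2 x

end cyc

namespace SR
variable {G : Type u} [AddCommGroup G] [Fintype G] {S : SR G}

theorem coeff_mul_meas {R : Type*} [CommSemiring R] {a b : AddMonoidAlgebra R G}
    (ha : S.Meas (fun x => a.coeff x)) (hb : S.Meas (fun x => b.coeff x)) : S.Meas (fun x => (a * b).coeff x) := by
  have := ha.conv hb
  intro z z' h
  have e : ∀ z, (a * b).coeff z = ∑ x, a.coeff x * b.coeff (z - x) := by
    intro z
    rw [AddMonoidAlgebra.coeff_mul, Finsupp.sum_fintype _ _ (by simp)]
    apply Finset.sum_congr rfl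
    intro x _
    rw [Finsupp.sum_fintype _ _ (by simp)]
    rw [Finset.sum_eq_single (z - x)]
    · simp
    · intro y _ hy
      rw [if_neg]
      intro h; apply hy; rw [← h]; abel
    · simp
  simp only [e]
  exact this z z' h

theorem push_meas (q : ℕ) [hq : Fact q.Prime] {f : G → ZMod q} (hf : S.Meas f) :
    S.Meas (fun y => ∑ z, if q • z = y then f z else 0) := by
  set a : AddMonoidAlgebra (ZMod q) G := ∑ z, AddMonoidAlgebra.single z (f z) with ha
  have hac : ∀ x, a.coeff x = f x := by
    intro x
    rw [ha, AddMonoidAlgebra.coeff_sum, Finsupp.finset_sum_apply]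
    simp [Finsupp.single_apply]
  have hpow : ∀ k : ℕ, S.Meas (fun x => (a ^ (k+1)).coeff x) := by
    intro k
    induction k with
    | zero => simp only [zero_add, pow_one, hac]; exact hf
    | succ k ih =>
      simp only [pow_succ a (k+1)]
      apply coeff_mul_meas ih
      simp only [hac]; exact hf
  have h1 := hpow (q - 1)
  rw [Nat.sub_add_cancel hq.out.one_le] at h1
  haveI : CharP (AddMonoidAlgebra (ZMod q) G) q := charP_of_injective_algebraMap (FaithfulSMul.algebraMap_injective (ZMod q) _) q
  haveI : ExpChar (AddMonoidAlgebra (ZMod q) G) q := ExpChar.prime hq.out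
  have e : a ^ q = ∑ z, AddMonoidAlgebra.single (q • z) (f z) := by
    rw [ha, sum_pow_char]
    apply Finset.sum_congr rfl
    intro x _
    rw [AddMonoidAlgebra.single_pow, ZMod.pow_card]
  intro y y' h
  have := h1 y y' h
  simp only [e, AddMonoidAlgebra.coeff_sum, Finsupp.finset_sum_apply] at this
  simpa [Finsupp.single_apply] using this

/-- number of p-th roots of `y` in a saturated set, mod p -/
theorem count_meas (q : ℕ) [hq : Fact q.Prime] {A : Set G} (hA : S.Sat A) :
    S.Meas (fun y => ((#{z : G | z ∈ A ∧ q • z = y} : ℕ) : ZMod q)) := by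
  have := S.push_meas q (hA.meas (1 : ZMod q) 0)
  intro y y' h
  have := this y y' h
  simp only [Finset.card_filter, Nat.cast_sum] at this ⊢
  convert this using 2
  all_goals
    rename_i x _
    by_cases h1 : x ∈ A <;> by_cases h2 : q • x = y <;> by_cases h3 : q • x = y' <;> simp [h1, h2, h3]

variable [IsAddCyclic G]

theorem sat_prime_smul (q : ℕ) (hq : q.Prime) (hqn : q.Coprime (Nat.card G)) {A : Set G} (hA : S.Sat A) :
    S.Sat {y | ∃ z ∈ A, q • z = y} := by
  haveI : Fact q.Prime := ⟨hq⟩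
  have := (S.count_meas q hA).sat (fun c => c ≠ 0)
  convert this using 1
  ext y
  simp only [Set.mem_ofPred_eq]
  have hle : #{z : G | z ∈ A ∧ q • z = y} ≤ 1 := by
    rw [Finset.card_le_one]
    intro a ha b hb
    simp only [mem_filter, mem_univ, true_and] at ha hb
    exact unit_inj hqn (ha.2.trans hb.2.symm)
  constructor
  · rintro ⟨z, hz, h⟩
    have : 0 < #{z : G | z ∈ A ∧ q • z = y} := Finset.card_pos.2 ⟨z, by simp [hz, h]⟩
    have : #{z : G | z ∈ A ∧ q • z = y} = 1 := by omega
    rw [this]; simp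
  · intro h
    by_contra hc
    push Not at hc
    apply h
    have : #{z : G | z ∈ A ∧ q • z = y} = 0 := by
      rw [Finset.card_eq_zero, Finset.filter_eq_empty_iff]
      rintro x _ ⟨h1, h2⟩; exact hc x h1 h2
    rw [this]; simp

theorem sat_unit_smul {k : ℕ} (hk : k.Coprime (Nat.card G)) {A : Set G} (hA : S.Sat A) :
    S.Sat {y | ∃ z ∈ A, k • z = y} := by
  by_cases hn : Nat.card G = 1
  · have : Subsingleton G := (Nat.card_eq_one_iff_unique.1 hn).1
    intro x y _ hx; rwa [Subsingleton.elim y x]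
  have hk0 : k ≠ 0 := by
    rintro rfl; rw [Nat.coprime_zero_left] at hk; exact hn hk
  clear hn
  induction k using Nat.recOnMul generalizing A with
  | zero => exact absurd rfl hk0
  | one => simpa using hA
  | prime q hq => exact sat_prime_smul q hq hk hA
  | mul a b iha ihb =>
    have h1 := ihb hk.coprime_mul_left hA (by rintro rfl; simp at hk0)
    have h2 := iha hk.coprime_mul_right h1 (by rintro rfl; simp at hk0)
    convert h2 using 1
    ext y
    simp only [Set.mem_ofPred_eq]
    constructor
    · rintro ⟨z, hz, e⟩; exact ⟨b • z, ⟨z, hz, rfl⟩, by rw [smul_smul, e]⟩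
    · rintro ⟨_, ⟨z, hz, rfl⟩, e⟩; exact ⟨z, hz, by rw [← e, smul_smul]⟩

/-- Schur: units preserve the relation -/
theorem schur {k : ℕ} (hk : k.Coprime (Nat.card G)) {x y : G} (h : S.r x y) : S.r (k • x) (k • y) := by
  obtain ⟨j, hj, hjk, hkj⟩ := unit_inverse (G := G) hk
  have h1 := sat_unit_smul (S := S) hj (S.cls_sat (k • x))
  obtain ⟨z, hz, e⟩ := h1 x y h ⟨k • x, S.rfl' _, hjk x⟩
  rw [← e, hkj]; exact hz

theorem schur_iff {k : ℕ} (hk : k.Coprime (Nat.card G)) {x y : G} : S.r (k • x) (k • y) ↔ S.r x y := by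
  obtain ⟨j, hj, hjk, hkj⟩ := unit_inverse (G := G) hk
  exact ⟨fun h => by simpa [hjk] using schur hj h, schur hk⟩

end SR
end SRP

namespace SRP
open Classical Finset
open scoped Pointwise
universe u
set_option linter.all false
set_option linter.deprecated false

section
variable {G : Type u} [AddCommGroup G] [Fintype G] [IsAddCyclic G]

theorem ord_add_tor {p : ℕ} {y t : G} (ht : t ∈ tor G p) (h1 : p ∣ addOrderOf y) (h2 : p ∣ addOrderOf (y + t)) :
    addOrderOf (y + t) = addOrderOf y := by
  rw [mem_tor] at ht
  have h0 : ∀ d, p ∣ d → d • t = 0 := by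
    rintro _ ⟨c, rfl⟩; rw [mul_comm, mul_smul, ht, smul_zero]
  apply Nat.dvd_antisymm
  · apply addOrderOf_dvd_of_nsmul_eq_zero
    rw [smul_add, addOrderOf_nsmul_eq_zero, h0 _ h1, add_zero]
  · apply addOrderOf_dvd_of_nsmul_eq_zero
    have := addOrderOf_nsmul_eq_zero (y + t)
    rwa [smul_add, h0 _ h2, add_zero] at this

theorem dvd_ord_add {p : ℕ} (hp : p.Prime) {y t : G} (ht : t ∈ tor G p) (ht0 : t ≠ 0) (h1 : ¬ p ∣ addOrderOf y) :
    p ∣ addOrderOf (y + t) := by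
  by_contra h2
  rw [mem_tor] at ht
  have h3 : (addOrderOf y * addOrderOf (y + t)) • t = 0 := by
    have e : (addOrderOf y * addOrderOf (y + t)) • t = (addOrderOf y * addOrderOf (y + t)) • ((y + t) - y) := by
      congr 1; abel
    rw [e, smul_sub, mul_smul, addOrderOf_nsmul_eq_zero, mul_comm, mul_smul, addOrderOf_nsmul_eq_zero]; simp
  have h4 := addOrderOf_dvd_of_nsmul_eq_zero ht
  have h5 := addOrderOf_dvd_of_nsmul_eq_zero h3
  rcases (Nat.dvd_prime hp).1 h4 with h | h
  · rw [AddMonoid.addOrderOf_eq_one_iff] at h; exact ht0 h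
  · rw [h, hp.dvd_mul] at h5; tauto

theorem ord_of_tor {p : ℕ} (hp : p.Prime) {t : G} (ht : t ∈ tor G p) (ht0 : t ≠ 0) : addOrderOf t = p := by
  have h4 := addOrderOf_dvd_of_nsmul_eq_zero (mem_tor.1 ht)
  rcases (Nat.dvd_prime hp).1 h4 with h | h
  · rw [AddMonoid.addOrderOf_eq_one_iff] at h; exact absurd h ht0
  · exact h

theorem tor_multiple {p : ℕ} (hp : p.Prime) {t t' : G} (ht : t ∈ tor G p) (ht0 : t ≠ 0) (ht' : t' ∈ tor G p) :
    ∃ j : ℕ, t' = j • t := by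
  have h1 := ord_of_tor hp ht ht0
  have : t' ∈ AddSubgroup.zmultiples t := by
    rw [mem_iff_ord, Nat.card_zmultiples, h1]
    exact addOrderOf_dvd_of_nsmul_eq_zero (mem_tor.1 ht')
  rw [mem_zmultiples_iff_mem_range_addOrderOf] at this
  simp only [Finset.mem_image] at this
  obtain ⟨k, _, e⟩ := this
  exact ⟨k, e.symm⟩

/-- coset count: `z ∈ A, p z = p y` -/
theorem coset_filter {p : ℕ} {A : Set G} {y : G} :
    ({z : G | z ∈ A ∧ p • z = p • y} : Finset G) = ({t : G | t ∈ tor G p ∧ y + t ∈ A} : Finset G).image (fun t => y + t) := by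
  ext z
  simp only [mem_filter, mem_univ, true_and, Finset.mem_image, mem_tor]
  constructor
  · rintro ⟨h1, h2⟩; exact ⟨z - y, ⟨by rw [smul_sub, h2, sub_self], by simpa using h1⟩, by abel⟩
  · rintro ⟨t, ⟨h1, h2⟩, rfl⟩; exact ⟨h2, by rw [smul_add, h1, add_zero]⟩

theorem coset_count {p : ℕ} {A : Set G} {y : G} :
    #{z : G | z ∈ A ∧ p • z = p • y} = #{t : G | t ∈ tor G p ∧ y + t ∈ A} := by
  rw [coset_filter, Finset.card_image_of_injective _ (add_right_injective y)]

theorem card_filter_tor {p : ℕ} (hp : p ∣ Nat.card G) : #{t : G | t ∈ tor G p} = p := by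
  have := card_tor hp
  rw [Nat.card_eq_fintype_card, Fintype.card_subtype] at this
  exact this

end

namespace SR
variable {G : Type u} [AddCommGroup G] [Fintype G] {S : SR G}

def Full (S : SR G) (p : ℕ) (x : G) : Prop := ∀ t ∈ tor G p, S.r x (x + t)
def PInv (S : SR G) (p : ℕ) (y : G) : Prop := tor G p ≤ rad (S.cls y)

theorem pinv_of_full {p : ℕ} {y : G} (h : ∀ z, S.r y z → S.Full p z) : S.PInv p y := by
  intro t ht
  apply mem_rad'
  intro x hx
  rw [add_comm]
  exact S.trans' hx (h x hx t ht)

theorem exists_not_full {p : ℕ} {y : G} (h : ¬ S.PInv p y) : ∃ z, S.r y z ∧ ¬ S.Full p z := by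
  by_contra hc
  push Not at hc
  exact h (pinv_of_full hc)

theorem PInv.full {p : ℕ} {y z : G} (h : S.PInv p y) (hz : S.r y z) : S.Full p z := by
  intro t ht
  have := (h ht z).1 hz
  rw [add_comm] at this
  exact S.trans' (S.symm' hz) this

variable [IsAddCyclic G]

theorem fr {p : ℕ} (hp : p.Prime) (hpn : p ∣ Nat.card G) {z : G} (h : ¬ S.Full p z) : p • z ∈ S.core (mul G p) := by
  haveI : Fact p.Prime := ⟨hp⟩
  intro y hy
  have h1 := S.count_meas p (S.cls_sat z) _ _ hy
  simp only [coset_count] at h1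
  have h2 : #{t : G | t ∈ tor G p ∧ z + t ∈ S.cls z} < p := by
    conv_rhs => rw [← card_filter_tor hpn]
    apply Finset.card_lt_card
    unfold Full at h
    push Not at h
    obtain ⟨t, ht, hn⟩ := h
    rw [Finset.ssubset_iff_of_subset]
    · exact ⟨t, by simpa using ht, by simp [ht]; exact hn⟩
    · intro t; simp only [mem_filter, mem_univ, true_and]; tauto
  have h3 : 0 < #{t : G | t ∈ tor G p ∧ z + t ∈ S.cls z} := by
    apply Finset.card_pos.2
    refine ⟨0, ?_⟩
    simp only [mem_filter, mem_univ, true_and, add_zero]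
    exact ⟨(tor G p).zero_mem, S.self_mem_cls z⟩
  have h4 : ((#{t : G | t ∈ tor G p ∧ z + t ∈ S.cls z} : ℕ) : ZMod p) ≠ 0 := by
    rw [Ne, ZMod.natCast_eq_zero_iff]
    intro h; exact absurd (Nat.le_of_dvd h3 h) (not_le.2 h2)
  rw [h1] at h4
  have : ({z_1 : G | z_1 ∈ S.cls z ∧ p • z_1 = y} : Finset G).Nonempty := by
    rw [Finset.nonempty_iff_ne_empty]
    intro h; apply h4; rw [h]; simp
  obtain ⟨w, hw⟩ := this
  simp only [mem_filter, mem_univ, true_and] at hw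
  exact ⟨w, hw.2⟩

theorem L1 {p : ℕ} (hp : p.Prime) (hpn : p ∣ Nat.card G) {x : G} (hx : IsGen x) (h : ¬ S.Full p x) :
    S.Sat (mul G p : Set G) := by
  have h1 := fr hp hpn h
  have : mul G p = S.core (mul G p) := by
    apply le_antisymm _ (S.core_le _)
    rintro _ ⟨y, rfl⟩
    obtain ⟨k, rfl⟩ := hx.exists_nsmul y
    simp only [nsmulAddMonoidHom_apply]
    rw [smul_comm]
    exact AddSubgroup.nsmul_mem _ h1 k
  rw [this]; exact S.core_sat _

/-- unit orbit of the class of `t` -/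
def orb (S : SR G) (t : G) : Set G := {g | ∃ k : ℕ, k.Coprime (Nat.card G) ∧ S.r (k • t) g}

theorem orb_sat (t : G) : S.Sat (S.orb t) := by
  rintro x y h ⟨k, hk, h'⟩; exact ⟨k, hk, S.trans' h' h⟩

theorem orb_unit {t g : G} {k : ℕ} (hk : k.Coprime (Nat.card G)) (hg : g ∈ S.orb t) : k • g ∈ S.orb t := by
  obtain ⟨j, hj, h⟩ := hg
  exact ⟨k * j, Nat.Coprime.mul_left hk hj, by rw [mul_smul]; exact schur hk h⟩

theorem orb_self (t : G) : t ∈ S.orb t := ⟨1, by simp, by simpa using S.rfl' t⟩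

theorem orb_ord {t g g' : G} (hg : g ∈ S.orb t) (h : addOrderOf g = addOrderOf g') : g' ∈ S.orb t := by
  obtain ⟨k, hk, rfl⟩ := exists_unit_of_ord_eq h
  exact orb_unit hk hg

theorem proportion_aux (f : G → ℤ) (hf : S.Meas f) (t : G) :
    ∃ (N c : ℤ), 0 < N ∧ ∀ A : Finset G, (∀ g ∈ A, g ∈ S.orb t) →
      (∀ g ∈ A, ∀ k : ℕ, k.Coprime (Nat.card G) → k • g ∈ A) → N * ∑ g ∈ A, f g = #A * c := by
  haveI : NeZero (Nat.card G) := ⟨Nat.card_pos.ne'⟩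
  let U := (ZMod (Nat.card G))ˣ
  let F : G → ℤ := fun g => ∑ v : U, f (v.val.val • g)
  have co : ∀ v : U, v.val.val.Coprime (Nat.card G) := fun v => ZMod.val_coe_unit_coprime v
  have hFr : ∀ g g', S.r g g' → F g = F g' := by
    intro g g' h
    apply Finset.sum_congr rfl
    intro v _
    exact hf _ _ (schur (co v) h)
  have hFu : ∀ (k : ℕ), k.Coprime (Nat.card G) → ∀ g, F (k • g) = F g := by
    intro k hk g
    let w : U := ZMod.unitOfCoprime k hk
    change ∑ v : U, f (v.val.val • k • g) = ∑ v : U, f (v.val.val • g)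
    rw [← Equiv.sum_comp (Equiv.mulRight w) (fun v : U => f (v.val.val • g))]
    apply Finset.sum_congr rfl
    intro v _
    rw [smul_smul]
    congr 1
    apply nsmul_congr
    apply Nat.ModEq.of_dvd (ord_dvd g)
    rw [← ZMod.natCast_eq_natCast_iff]
    simp [w]
    exact ((Units.val_mul v (ZMod.unitOfCoprime k hk)).trans (by rw [ZMod.coe_unitOfCoprime])).symm
  refine ⟨Fintype.card U, F t, by exact_mod_cast Fintype.card_pos, ?_⟩
  intro A h1 h2
  have e1 : ∑ g ∈ A, F g = #A * F t := by
    rw [Finset.sum_congr rfl (g := fun _ => F t), Finset.sum_const, nsmul_eq_mul]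
    intro g hg
    obtain ⟨k, hk, h⟩ := h1 g hg
    rw [← hFr _ _ h, hFu k hk]
  rw [← e1, Finset.sum_comm, ← smul_eq_mul, Nat.cast_smul_eq_nsmul, ← Finset.card_univ, ← Finset.sum_const]
  apply Finset.sum_congr rfl
  intro v _
  symm
  have hinj : Set.InjOn (fun g => v.val.val • g) (A : Set G) := fun a _ b _ h => unit_inj (co v) h
  have himg : A.image (fun g => v.val.val • g) = A := by
    apply Finset.eq_of_subset_of_card_le
    · intro x hx
      rw [Finset.mem_image] at hx
      obtain ⟨g, hg, rfl⟩ := hx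
      exact h2 g hg _ (co v)
    · rw [Finset.card_image_of_injOn hinj]
  conv_rhs => rw [← himg]
  rw [Finset.sum_image hinj]

theorem proportion {f : G → ℤ} (hf : S.Meas f) (t : G) (A B : Finset G) (hA : ∀ g ∈ A, g ∈ S.orb t)
    (hA' : ∀ g ∈ A, ∀ k : ℕ, k.Coprime (Nat.card G) → k • g ∈ A) (hB : ∀ g ∈ B, g ∈ S.orb t)
    (hB' : ∀ g ∈ B, ∀ k : ℕ, k.Coprime (Nat.card G) → k • g ∈ B) :
    (#B : ℤ) * ∑ g ∈ A, f g = #A * ∑ g ∈ B, f g := by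
  obtain ⟨N, c, hN, h⟩ := proportion_aux f hf t
  have h1 := h A hA hA'
  have h2 := h B hB hB'
  apply mul_left_cancel₀ hN.ne'
  linear_combination (#B : ℤ) * h1 - (#A : ℤ) * h2

end SR
end SRP

namespace SRP
open Classical Finset
open scoped Pointwise
universe u
set_option linter.all false
set_option linter.deprecated false
namespace SR
variable {G : Type u} [AddCommGroup G] [Fintype G] {S : SR G}
variable [IsAddCyclic G]

theorem ord_dvd_p_root {p : ℕ} (hp : p.Prime) {w t : G} (ht : t ∈ tor G p) (ht0 : t ≠ 0) (h : p • w = t) :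
    p * p ∣ addOrderOf w := by
  have h1 := ord_of_tor hp ht ht0
  have h2 : addOrderOf w / Nat.gcd (addOrderOf w) p = p := by
    have := addOrderOf_nsmul w (n := p)
    rw [h, h1] at this; exact this.symm
  have hdvd := Nat.gcd_dvd_left (addOrderOf w) p
  have h3 : p * Nat.gcd (addOrderOf w) p = addOrderOf w := by
    conv_lhs => rw [← h2]
    rw [h2]
    have := Nat.div_mul_cancel hdvd
    rw [h2] at this; exact this
  have h4 : p ∣ addOrderOf w := ⟨_, h3.symm⟩
  have h5 : Nat.gcd (addOrderOf w) p = p := Nat.gcd_eq_right h4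
  rw [h5] at h3
  rw [h3]

/-- structure of `s ∉ orb t0` with a `P`-translate in the orbit -/
theorem orb_fill {p : ℕ} (hp : p.Prime) (hpn : p ∣ Nat.card G) {t0 : G} (ht0 : t0 ∈ tor G p) (h0 : t0 ≠ 0)
    {s t : G} (hs : s ∉ S.orb t0) (ht : t ∈ tor G p) (hst : s + t ∈ S.orb t0) :
    ∀ t' ∈ tor G p, t' ≠ 0 → s + t' ∈ S.orb t0 := by
  haveI : Fact p.Prime := ⟨hp⟩
  have key : ∀ y ∈ S.orb t0, ∀ a ∈ tor G p, p ∣ addOrderOf y → p ∣ addOrderOf (y + a) → y + a ∈ S.orb t0 :=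
    fun y hy a ha h1 h2 => orb_ord hy (ord_add_tor ha h1 h2).symm
  by_cases h1 : p ∣ addOrderOf (s + t)
  · have hs' : ¬ p ∣ addOrderOf s := by
      intro h2
      apply hs
      have := key (s + t) hst (-t) ((tor G p).neg_mem ht) h1 (by simpa using h2)
      simpa using this
    intro t' ht' ht0'
    have h3 := dvd_ord_add hp ht' ht0' hs'
    have := key (s + t) hst (t' - t) ((tor G p).sub_mem ht' ht) h1 (by simpa using h3)
    simpa using this
  · exfalso
    set y := s + t with hy
    have hcount : #{a : G | a ∈ tor G p ∧ y + a ∈ S.orb t0} = 1 := by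
      rw [Finset.card_eq_one]
      refine ⟨0, ?_⟩
      ext a
      simp only [mem_filter, mem_univ, true_and, Finset.mem_singleton]
      constructor
      · rintro ⟨ha, h2⟩
        by_contra ha0
        apply hs
        have h3 := dvd_ord_add hp ha ha0 h1
        have ht1 : -t ≠ 0 := by
          intro h; rw [neg_eq_zero] at h; apply hs; rw [hy, h, add_zero] at hst; exact hst
        have h4 := dvd_ord_add hp ((tor G p).neg_mem ht) ht1 h1
        have := key (y + a) h2 (-t - a) ((tor G p).sub_mem ((tor G p).neg_mem ht) ha) h3 (by
          convert h4 using 2; abel)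
        convert this using 1; rw [hy]; abel
      · rintro rfl; simp only [add_zero]; exact ⟨(tor G p).zero_mem, hst⟩
    rw [← coset_count] at hcount
    have h5 : addOrderOf y = addOrderOf (p • y) := by
      rw [Nat.Coprime.addOrderOf_nsmul]
      exact ((Nat.Prime.coprime_iff_not_dvd hp).2 h1).symm
    obtain ⟨k, hk, hky⟩ := exists_unit_of_ord_eq h5
    obtain ⟨k', hk', hr⟩ := hst
    have h6 : S.r ((k * k') • t0) (p • y) := by
      rw [hky, mul_smul]; exact schur hk hr
    have hkk : (k * k').Coprime (Nat.card G) := Nat.Coprime.mul_left hk hk'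
    set t1 := (k * k') • t0 with ht1
    have ht1m : t1 ∈ tor G p := (tor G p).nsmul_mem ht0 _
    have ht10 : t1 ≠ 0 := by
      intro h
      apply h0
      apply unit_inj hkk
      rw [← ht1, h, smul_zero]
    have h7 := S.count_meas p (S.orb_sat t0) _ _ h6
    simp only [hcount, Nat.cast_one] at h7
    by_cases hw : ∃ w, w ∈ S.orb t0 ∧ p • w = t1
    · obtain ⟨w, hw, hwt⟩ := hw
      have hww := ord_dvd_p_root hp ht1m ht10 hwt
      rw [← hwt] at h7
      simp only [coset_count] at h7
      have : ({a : G | a ∈ tor G p ∧ w + a ∈ S.orb t0} : Finset G) = ({a : G | a ∈ tor G p} : Finset G) := by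
        ext a
        simp only [mem_filter, mem_univ, true_and, and_iff_left_iff_imp]
        intro ha
        apply key w hw a ha ((dvd_mul_right p p).trans hww)
        exact (dvd_mul_right p p).trans (ord_dvd_p_root hp ht1m ht10 (by rw [smul_add, hwt, mem_tor.1 ha, add_zero]))
      rw [this, card_filter_tor hpn] at h7
      simp at h7
    · have : ({z : G | z ∈ S.orb t0 ∧ p • z = t1} : Finset G) = ∅ := by
        rw [Finset.filter_eq_empty_iff]; intro z _ hz; exact hw ⟨z, hz⟩
      rw [this] at h7
      simp at h7

/-- sums invariant under translation by a subgroup -/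
theorem sum_translate (M : Finset G) (t : G) (hM : ∀ g, g ∈ M ↔ g + t ∈ M) (f : G → ℤ) :
    ∑ g ∈ M, f (g + t) = ∑ g ∈ M, f g := by
  apply Finset.sum_bij (fun g _ => g + t)
  · intro a ha; exact (hM a).1 ha
  · intro a _ b _ h; exact add_right_cancel h
  · intro b hb; exact ⟨b - t, (hM _).2 (by simpa using hb), by simp⟩
  · intro a _; rfl

theorem F_lemma {p : ℕ} (hp : p.Prime) (hp3 : 3 ≤ p) (hpn : p ∣ Nat.card G) (V Om : AddSubgroup G) (hV : V ≤ Om)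
    (hPOm : tor G p ≤ Om)
    (e : ℕ) (he : 3 * p ≤ e) (h1 : ∀ g ∉ Om, S.Full p g)
    (h2 : ∀ f : G → ℤ, S.Meas f → (∀ g ∈ V, f g = 0) → ((p : ℤ) - 1) * ∑ g, f g = (e - 1) * ∑ g with g ∈ Om, f g)
    (F : G → ℤ) (hF : S.Meas F) (hFV : ∀ g ∈ V, F g = 0)
    (hFO : ∀ g ∈ Om, ∑ t with t ∈ tor G p, F (g + t) = 0) : ∀ g, F g = 0 := by
  have hp0 : (0:ℤ) < p := by exact_mod_cast hp.pos
  obtain ⟨t0, ht0, h0⟩ : ∃ t0 ∈ tor G p, t0 ≠ 0 := by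
    by_contra hc
    push Not at hc
    have : #{t : G | t ∈ tor G p} ≤ 1 := by
      rw [Finset.card_le_one]; intro a ha b hb
      simp only [mem_filter, mem_univ, true_and] at ha hb
      rw [hc a ha, hc b hb]
    rw [card_filter_tor hpn] at this; omega
  set Pf : Finset G := {t : G | t ∈ tor G p} with hPf
  set O : Finset G := {g : G | g ∈ Om} with hO
  set Yp : Finset G := {g : G | g ∈ S.orb t0} with hYp
  set Y2 : Finset G := {s : G | s ∉ S.orb t0 ∧ ∃ t ∈ tor G p, s + t ∈ S.orb t0} with hY2
  have hPcard : (#Pf : ℤ) = p := by rw [hPf, card_filter_tor hpn]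
  have mPf : ∀ t, t ∈ Pf ↔ t ∈ tor G p := by intro t; simp [hPf]
  have mO : ∀ t, t ∈ O ↔ t ∈ Om := by intro t; simp [hO]
  have mYp : ∀ t, t ∈ Yp ↔ t ∈ S.orb t0 := by intro t; simp [hYp]
  set A : ℤ := ∑ g ∈ O, F g ^ 2 with hA
  set T : ℤ := ∑ g, F g ^ 2 with hT
  have hTA : ((p:ℤ) - 1) * T = (e - 1) * A := by
    apply h2 (fun g => F g ^ 2) (hF.comp (fun a => a ^ 2))
    intro g hg; simp [hFV g hg]
  let E : G → ℤ := fun t => ∑ x, F x * F (t + x)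
  have hE : S.Meas E := hF.corr hF
  -- sum of E over P
  have hEP : ∑ t ∈ Pf, E t = p * (T - A) := by
    have : ∀ x, ∑ t ∈ Pf, F x * F (t + x) = if x ∈ Om then 0 else p * F x ^ 2 := by
      intro x
      rw [← Finset.mul_sum]
      split_ifs with hx
      · have := hFO x hx
        simp only [add_comm x] at this
        rw [this, mul_zero]
      · rw [Finset.sum_congr rfl (g := fun _ => F x), Finset.sum_const, nsmul_eq_mul, hPcard]; ring
        intro t ht
        rw [add_comm]
        exact (hF _ _ (h1 x hx t ((mPf t).1 ht))).symm
    simp only [E]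
    rw [Finset.sum_comm, Finset.sum_congr rfl (fun x _ => this x)]
    have e2 : T - A = ∑ x, if x ∈ Om then 0 else F x ^ 2 := by
      rw [hT, hA, hO, Finset.sum_filter, ← Finset.sum_sub_distrib]
      apply Finset.sum_congr rfl; intro x _; split_ifs <;> ring
    rw [e2, Finset.mul_sum]
    apply Finset.sum_congr rfl; intro x _; split_ifs <;> ring
  have hE0 : E 0 = T := by simp only [E, hT, zero_add]; apply Finset.sum_congr rfl; intro x _; ring
  have hEP' : ∑ t ∈ Pf.erase 0, E t = (p - 1) * (T - A) - A := by
    have := Finset.sum_erase_eq_sub (f := E) ((mPf 0).2 (tor G p).zero_mem)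
    rw [this, hEP, hE0]; ring
  have hcardP' : (#(Pf.erase 0) : ℤ) = p - 1 := by
    rw [Finset.card_erase_of_mem ((mPf 0).2 (tor G p).zero_mem)]
    rw [Nat.cast_sub (Finset.card_pos.2 ⟨0, (mPf 0).2 (tor G p).zero_mem⟩), hPcard]; simp
  have hprop := S.proportion hE t0 Yp (Pf.erase 0) (fun g hg => (mYp g).1 hg)
    (fun g hg k hk => (mYp _).2 (orb_unit hk ((mYp g).1 hg)))
    (by
      intro g hg
      rw [Finset.mem_erase, mPf] at hg
      exact orb_ord (orb_self t0) ((ord_of_tor hp ht0 h0).trans (ord_of_tor hp hg.2 hg.1).symm))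
    (by
      intro g hg k hk
      rw [Finset.mem_erase, mPf] at *
      refine ⟨fun h => hg.1 (unit_inj hk (by rw [h, smul_zero])), (tor G p).nsmul_mem hg.2 _⟩)
  rw [hcardP', hEP'] at hprop
  let Ph : G → ℤ := fun x => F x * ∑ y ∈ Yp, F (x + y)
  have hPh : S.Meas Ph := by
    apply hF.comp₂ (g := fun a b => a * b)
    have := ((S.orb_sat t0).meas (1:ℤ) 0).corr hF
    convert this using 2 with x
    rw [hYp, Finset.sum_filter]
    apply Finset.sum_congr rfl; intro y _; split_ifs <;> simp
  have hPhS := h2 Ph hPh (fun g hg => by simp [Ph, hFV g hg])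
  have hsum : ∑ x, Ph x = ∑ y ∈ Yp, E y := by
    simp only [Ph, E, Finset.mul_sum]
    rw [Finset.sum_comm]
    simp only [add_comm]
  rw [hsum, hprop] at hPhS
  -- vanishing over the P-invariant set
  have hM : ∀ t ∈ tor G p, ∀ g, g ∈ Yp ∪ Y2 ↔ g + t ∈ Yp ∪ Y2 := by
    have aux : ∀ g, g ∈ Yp ∪ Y2 ↔ ∃ t ∈ tor G p, g + t ∈ S.orb t0 := by
      intro g
      simp only [Finset.mem_union, mYp, hY2, mem_filter, mem_univ, true_and]
      constructor
      · rintro (h | h)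
        · exact ⟨0, (tor G p).zero_mem, by simpa using h⟩
        · exact h.2
      · intro h; by_cases hg : g ∈ S.orb t0
        · exact Or.inl hg
        · exact Or.inr ⟨hg, h⟩
    intro t ht g
    rw [aux, aux]
    constructor
    · rintro ⟨a, ha, h⟩; exact ⟨a - t, (tor G p).sub_mem ha ht, by convert h using 1; abel⟩
    · rintro ⟨a, ha, h⟩; exact ⟨t + a, (tor G p).add_mem ht ha, by convert h using 1; abel⟩
  let Hs : G → ℤ := fun z => ∑ t ∈ Pf, F (z + t)
  have hvan : ∑ x ∈ O, F x * ∑ y ∈ Yp ∪ Y2, F (x + y) = 0 := by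
    have s1 : ∀ x, (p:ℤ) * ∑ y ∈ Yp ∪ Y2, F (x + y) = ∑ y ∈ Yp ∪ Y2, Hs (x + y) := by
      intro x
      simp only [Hs]
      rw [Finset.sum_comm]
      suffices hc : ∀ t ∈ Pf, ∑ y ∈ Yp ∪ Y2, F (x + y + t) = ∑ y ∈ Yp ∪ Y2, F (x + y) by
        exact ((Finset.sum_congr rfl hc).trans (by rw [Finset.sum_const, nsmul_eq_mul, hPcard])).symm
      intro t ht
      have := sum_translate (Yp ∪ Y2) t (hM t ((mPf t).1 ht)) (fun y => F (x + y))
      rw [← this]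
      apply Finset.sum_congr rfl; intro y _; rw [add_assoc]
    have hHinv : ∀ t ∈ tor G p, ∀ z, Hs (z + t) = Hs z := by
      intro t ht z
      simp only [Hs]
      rw [← sum_translate Pf t (fun g => by
        rw [mPf, mPf]; exact ⟨fun h => (tor G p).add_mem h ht, fun h => by simpa using (tor G p).sub_mem h ht⟩) (fun y => F (z + y))]
      apply Finset.sum_congr rfl; intro y _; congr 1; abel
    have s2 : ∀ y, (p:ℤ) * ∑ x ∈ O, F x * Hs (x + y) = 0 := by
      intro y
      have : (p:ℤ) * ∑ x ∈ O, F x * Hs (x + y) = ∑ t ∈ Pf, ∑ x ∈ O, F (x + t) * Hs (x + y) := by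
        suffices hc : ∀ t ∈ Pf, ∑ x ∈ O, F (x + t) * Hs (x + y) = ∑ x ∈ O, F x * Hs (x + y) by
          exact ((Finset.sum_congr rfl hc).trans (by rw [Finset.sum_const, nsmul_eq_mul, hPcard])).symm
        intro t ht
        have ht' := (mPf t).1 ht
        rw [← sum_translate O t (fun g => by
          rw [mO, mO]; exact ⟨fun h => Om.add_mem h (hPOm ht'), fun h => by simpa using Om.sub_mem h (hPOm ht')⟩) (fun x => F x * Hs (x + y))]
        apply Finset.sum_congr rfl; intro x _
        rw [show x + t + y = x + y + t by abel, hHinv t ht']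
      rw [this, Finset.sum_comm]
      apply Finset.sum_eq_zero
      intro x hx
      rw [← Finset.sum_mul, hPf, hFO x ((mO x).1 hx), zero_mul]
    have : ((p:ℤ) * p) * ∑ x ∈ O, F x * ∑ y ∈ Yp ∪ Y2, F (x + y) = 0 := by
      have : (p:ℤ) * ∑ x ∈ O, F x * ∑ y ∈ Yp ∪ Y2, F (x + y) = ∑ y ∈ Yp ∪ Y2, ∑ x ∈ O, F x * Hs (x + y) := by
        rw [Finset.sum_comm, Finset.mul_sum]
        apply Finset.sum_congr rfl; intro x _
        rw [← Finset.mul_sum, ← s1]; ring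
      rw [mul_assoc, this, Finset.mul_sum]
      exact Finset.sum_eq_zero (fun y _ => s2 y)
    exact (mul_eq_zero.1 this).resolve_left (by positivity)
  have hdisj : Disjoint Yp Y2 := by
    rw [Finset.disjoint_left]; intro a ha hb
    simp only [hY2, mem_filter] at hb
    exact hb.2.1 ((mYp a).1 ha)
  have hY2O : ∀ s ∈ Y2, s ∈ Om := by
    intro s hs
    simp only [hY2, mem_filter, mem_univ, true_and] at hs
    by_contra hc
    obtain ⟨h3, t, ht, h4⟩ := hs
    exact h3 (S.orb_sat t0 _ _ (S.symm' (h1 s hc t ht)) h4)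
  have hbound : ∑ x ∈ O, Ph x ≤ #Y2 * A := by
    have e1 : ∑ x ∈ O, Ph x = - ∑ y ∈ Y2, ∑ x ∈ O, F x * F (x + y) := by
      have : ∑ x ∈ O, F x * ∑ y ∈ Yp ∪ Y2, F (x + y) = ∑ x ∈ O, Ph x + ∑ y ∈ Y2, ∑ x ∈ O, F x * F (x + y) := by
        rw [Finset.sum_comm (s := Y2), ← Finset.sum_add_distrib]
        apply Finset.sum_congr rfl; intro x _
        rw [Finset.sum_union hdisj, mul_add, Finset.mul_sum (s := Y2)]
      linarith
    have e2 : ∀ y ∈ Y2, - A ≤ ∑ x ∈ O, F x * F (x + y) := by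
      intro y hy
      have hy' := hY2O y hy
      have e3 : ∑ x ∈ O, F (x + y) ^ 2 = A := sum_translate O y (fun g => by
          rw [mO, mO]; exact ⟨fun h => Om.add_mem h hy', fun h => by simpa using Om.sub_mem h hy'⟩) (fun x => F x ^ 2)
      have : 0 ≤ ∑ x ∈ O, (F x + F (x + y)) ^ 2 := Finset.sum_nonneg (fun _ _ => sq_nonneg _)
      have e4 : ∑ x ∈ O, (F x + F (x + y)) ^ 2 = A + 2 * ∑ x ∈ O, F x * F (x + y) + A := by
        conv_rhs => rw [← e3]
        rw [e3, hA, Finset.mul_sum, ← Finset.sum_add_distrib]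
        conv_rhs => arg 2; rw [← hA, ← e3]
        rw [← Finset.sum_add_distrib]
        apply Finset.sum_congr rfl; intro x _; ring
      linarith
    have e5 : ∑ y ∈ Y2, (-A) ≤ ∑ y ∈ Y2, ∑ x ∈ O, F x * F (x + y) := Finset.sum_le_sum e2
    rw [Finset.sum_const, nsmul_eq_mul] at e5
    rw [e1]; linarith
  have hY2card : (p - 1 : ℤ) * #Y2 ≤ #Yp := by
    rw [← hcardP']
    have : #(Pf.erase 0 ×ˢ Y2) ≤ #Yp := by
      apply Finset.card_le_card_of_injOn (fun a => a.2 + a.1)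
      · rintro ⟨t, s⟩ h
        simp only [Finset.coe_product, Set.mem_prod, Finset.mem_coe, Finset.mem_erase, mPf, hY2, mem_filter, mem_univ, true_and] at h
        simp only [Finset.mem_coe, mYp]
        obtain ⟨⟨h3, h4⟩, h5, t', ht', h6⟩ := h
        exact orb_fill hp hpn ht0 h0 h5 ht' h6 t h4 h3
      · rintro ⟨t, s⟩ h ⟨t', s'⟩ h' heq
        simp only [Finset.coe_product, Set.mem_prod, Finset.mem_coe, Finset.mem_erase, mPf, hY2, mem_filter, mem_univ, true_and] at h h'
        simp only at heq
        obtain ⟨⟨h3, h4⟩, h5, a, ha, h6⟩ := h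
        obtain ⟨⟨h3', h4'⟩, h5', a', ha', h6'⟩ := h'
        have hs : s' = s + (t - t') := by rw [← add_sub_assoc, heq]; abel
        have : t - t' = 0 := by
          by_contra hne
          apply h5'
          rw [hs]
          exact orb_fill hp hpn ht0 h0 h5 ha h6 _ ((tor G p).sub_mem h4 h4') hne
        rw [this, add_zero] at hs
        rw [hs, sub_eq_zero.1 this]
    rw [Finset.card_product] at this
    exact_mod_cast this
  have hYpos : (0:ℤ) < #Yp := by
    exact_mod_cast Finset.card_pos.2 ⟨t0, (mYp t0).2 (orb_self t0)⟩
  have hA0 : 0 ≤ A := Finset.sum_nonneg (fun _ _ => sq_nonneg _)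
  have hp3' : (3:ℤ) ≤ p := by exact_mod_cast hp3
  have he' : 3 * (p:ℤ) ≤ e := by exact_mod_cast he
  have hfin : ((p:ℤ) - 1) * ((p - 1) * (T - A) - A) ≤ (e - 1) * A := by
    have k1 : (#Yp : ℤ) * ((p - 1) * (T - A) - A) ≤ (e - 1) * (#Y2 * A) := by
      rw [hPhS]; apply mul_le_mul_of_nonneg_left hbound; linarith
    have k2 : (#Yp : ℤ) * (((p:ℤ) - 1) * ((p - 1) * (T - A) - A)) ≤ #Yp * ((e - 1) * A) := by
      calc (#Yp : ℤ) * (((p:ℤ) - 1) * ((p - 1) * (T - A) - A)) = (p - 1) * (#Yp * ((p - 1) * (T - A) - A)) := by ring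
        _ ≤ (p - 1) * ((e - 1) * (#Y2 * A)) := mul_le_mul_of_nonneg_left k1 (by linarith)
        _ = ((p - 1) * #Y2) * ((e - 1) * A) := by ring
        _ ≤ #Yp * ((e - 1) * A) := mul_le_mul_of_nonneg_right hY2card (mul_nonneg (by linarith) hA0)
    exact le_of_mul_le_mul_left k2 hYpos
  have hA00 : A = 0 := by
    by_contra hne
    have hApos : 0 < A := lt_of_le_of_ne hA0 (Ne.symm hne)
    have k3 : ((p:ℤ) - 1) * ((p - 1) * (T - A) - A) = ((p - 1) * (e - p - 1)) * A := by
      linear_combination ((p:ℤ) - 1) * hTA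
    rw [k3] at hfin
    have k4 : ((p:ℤ) - 1) * (e - p - 1) ≤ e - 1 := le_of_mul_le_mul_right hfin hApos
    nlinarith
  have hT0 : T = 0 := by
    rw [hA00, mul_zero] at hTA
    exact (mul_eq_zero.1 hTA).resolve_left (by linarith)
  intro g
  have := (Finset.sum_eq_zero_iff_of_nonneg (fun x _ => sq_nonneg (F x))).1 hT0 g (mem_univ g)
  exact pow_eq_zero_iff (two_ne_zero) |>.1 this

end SR
end SRP

namespace SRP
open Classical Finset
open scoped Pointwise
universe u
set_option linter.all false
set_option linter.deprecated false

section pre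
variable {G : Type u} [AddCommGroup G] [Fintype G] [IsAddCyclic G]

instance quotCyc (L : AddSubgroup G) : IsAddCyclic (G ⧸ L) :=
  isAddCyclic_of_surjective (QuotientAddGroup.mk' L) (QuotientAddGroup.mk'_surjective L)

theorem gen_quot {x : G} (hx : IsGen x) (L : AddSubgroup G) : IsGen (x : G ⧸ L) := by
  rw [isGen_iff] at *
  intro y
  obtain ⟨y, rfl⟩ := QuotientAddGroup.mk_surjective y
  obtain ⟨k, hk⟩ := AddSubgroup.mem_zmultiples_iff.1 (hx y)
  exact AddSubgroup.mem_zmultiples_iff.2 ⟨k, by rw [← hk]; rfl⟩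

theorem mk_eq {L : AddSubgroup G} {a b : G} : (a : G ⧸ L) = (b : G ⧸ L) ↔ b - a ∈ L := by
  rw [QuotientAddGroup.eq, neg_add_eq_sub]

theorem mk_zero {L : AddSubgroup G} {a : G} : (a : G ⧸ L) = 0 ↔ a ∈ L := QuotientAddGroup.eq_zero_iff a

theorem card_quot (L : AddSubgroup G) : Nat.card G = Nat.card (G ⧸ L) * Nat.card L :=
  AddSubgroup.card_eq_card_quotient_mul_card_addSubgroup L

theorem ncard_ne : Nat.card G ≠ 0 := Nat.card_pos.ne'
theorem sub_ne (H : AddSubgroup G) : Nat.card H ≠ 0 := Nat.card_pos.ne'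
theorem sub_dvd (H : AddSubgroup G) : Nat.card H ∣ Nat.card G := AddSubgroup.card_addSubgroup_dvd_card H

theorem smul_one_mod {L : AddSubgroup G} {a : G} (ha : a ∈ L) {j k : ℕ} (h : k ≡ j [MOD Nat.card L]) : k • a = j • a :=
  nsmul_congr (h.of_dvd (mem_iff_ord.1 ha))

/-- if `p` exactly divides `n` then translates by `tor p` meet `mul p` -/
theorem exists_tor_add {p : ℕ} (hp : p.Prime) (hpn : p ∣ Nat.card G) (h : ¬ p ∣ Nat.card G / p) (x : G) :
    ∃ t ∈ tor G p, x + t ∈ mul G p := by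
  have hc : p.Coprime (Nat.card G / p) := (Nat.Prime.coprime_iff_not_dvd hp).2 h
  obtain ⟨c, hc1, hc2⟩ := Nat.chineseRemainder hc 0 1
  have e : p * (Nat.card G / p) = Nat.card G := Nat.mul_div_cancel' hpn
  refine ⟨c • x - x, ?_, ?_⟩
  · rw [mem_tor, smul_sub, sub_eq_zero, ← mul_smul]
    have h1 := hc2.mul_left' p
    rw [e, mul_one] at h1
    exact nsmul_congr (h1.of_dvd (ord_dvd x))
  · have : p ∣ c := (Nat.modEq_zero_iff_dvd).1 hc1
    obtain ⟨d, rfl⟩ := this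
    exact ⟨d • x, by simp [mul_smul]⟩

theorem tor_le_iff {p : ℕ} (hp : p.Prime) (hpn : p ∣ Nat.card G) {H : AddSubgroup G} : tor G p ≤ H ↔ p ∣ Nat.card H := by
  rw [le_iff_card, card_tor hpn]

theorem tor_inf {p : ℕ} (hp : p.Prime) {H : AddSubgroup G} (h : ¬ p ∣ Nat.card H) {t : G} (ht : t ∈ tor G p) (htH : t ∈ H) : t = 0 := by
  by_contra h0
  apply h
  rw [← ord_of_tor hp ht h0]
  exact mem_iff_ord.1 htH

theorem exists_tor_ne {p : ℕ} (hp : p.Prime) (hpn : p ∣ Nat.card G) : ∃ t ∈ tor G p, t ≠ 0 := by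
  by_contra hc
  push Not at hc
  have : tor G p = ⊥ := by rw [eq_bot_iff]; intro a ha; exact hc a ha
  have h2 := card_tor hpn
  rw [this] at h2
  simp at h2
  exact hp.one_lt.ne' h2.symm

theorem mk_mem_mul {L : AddSubgroup G} {p : ℕ} (h : L ≤ mul G p) {x : G} : (x : G ⧸ L) ∈ mul (G ⧸ L) p ↔ x ∈ mul G p := by
  constructor
  · rintro ⟨y, hy⟩
    obtain ⟨y, rfl⟩ := QuotientAddGroup.mk_surjective y
    have : ((p • y : G) : G ⧸ L) = x := hy
    rw [mk_eq] at this
    have := (mul G p).add_mem (h this) (nsmul_mem_mul p y)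
    simpa using this
  · rintro ⟨y, rfl⟩
    exact ⟨y, rfl⟩

theorem mk_mem_tor {L : AddSubgroup G} {p : ℕ} {x : G} : (x : G ⧸ L) ∈ tor (G ⧸ L) p ↔ p • x ∈ L := by
  rw [mem_tor, ← mk_zero]; rfl
end pre

namespace SR
variable {G : Type u} [AddCommGroup G] [Fintype G] {S : SR G}

theorem Sat.forall_add {A B : Set G} (hA : S.Sat A) (hB : S.Sat B) : S.Sat {g | ∀ v ∈ A, g + v ∈ B} := by
  have hA' : S.Sat {x | -x ∈ A} := fun x y h hx => hA _ _ (S.neg _ _ h) hx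
  have := (hA'.exists_sum hB.compl).compl
  convert this using 1
  ext g
  simp only [Set.mem_ofPred_eq, Set.mem_compl_iff, not_exists, not_and, not_not]
  constructor
  · intro h x hx; simpa [sub_eq_add_neg] using h _ hx
  · intro h v hv; simpa using h (-v) (by simpa using hv)

variable [IsAddCyclic G]

theorem Q_lemma {p : ℕ} (hp : p.Prime) (hpn : p ∣ Nat.card G) (hcore : S.core (mul G p) = ⊥) {x z0 : G} (hx : IsGen x)
    (hr : S.r x z0) (hz : z0 ∈ tor G p) (hz0 : z0 ≠ 0) : ∀ g, g ≠ 0 → g ∈ S.orb z0 := by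
  have hA : S.Sat (S.orb z0 ∪ {0}) := (S.orb_sat z0).union S.sat_zero
  have hxo : x ∈ S.orb z0 := ⟨1, by simp, by simpa using S.symm' hr⟩
  have hP : tor G p ≤ rad (S.orb z0 ∪ {0}) := by
    intro t ht
    apply mem_rad'
    intro g hg
    by_cases hpg : p • g = 0
    · have h1 : t + g ∈ tor G p := (tor G p).add_mem ht hpg
      by_cases h2 : t + g = 0
      · exact Or.inr h2
      · exact Or.inl (orb_ord (orb_self z0) ((ord_of_tor hp hz hz0).trans (ord_of_tor hp h1 h2).symm))
    · have hf : S.Full p g := by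
        by_contra hf
        have := fr hp hpn hf
        rw [hcore] at this
        exact hpg this
      rw [add_comm]
      exact hA _ _ (hf t ht) hg
  have hrad := S.sat_rad hA
  have hxr : x ∈ rad (S.orb z0 ∪ {0}) := hrad _ _ (S.symm' hr) (hP hz)
  have htop := hx.eq_top hxr
  intro g hg
  have : g ∈ rad (S.orb z0 ∪ {0}) := by rw [htop]; trivial
  have h3 := (this 0).1 (Or.inr rfl)
  rw [add_zero] at h3
  exact h3.resolve_right hg

theorem core_quot_bot {p : ℕ} : (S.quot (S.core (mul G p)) (S.core_sat _)).core (mul _ p) = ⊥ := by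
  rw [eq_bot_iff]
  intro a ha
  obtain ⟨a, rfl⟩ := QuotientAddGroup.mk_surjective a
  have h1 := S.sat_comap_mk ((S.quot (S.core (mul G p)) (S.core_sat _)).core_sat (mul _ p))
  have h2 := S.le_core (K := mul G p) h1 (by
    intro y hy
    exact (mk_mem_mul (S.core_le _)).1 (core_le _ hy))
  exact mk_zero.2 (h2 ha)

theorem h2_quot {p : ℕ} (V : AddSubgroup G) (hV : S.Sat (V : Set G)) {z0 : G ⧸ V} (hpn : p ∣ Nat.card (G ⧸ V))
    (hall : ∀ a : G ⧸ V, a ≠ 0 → a ∈ (S.quot V hV).orb z0)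
    (f : G → ℤ) (hf : S.Meas f) (hf0 : ∀ g ∈ V, f g = 0) :
    ((p : ℤ) - 1) * ∑ g, f g = ((Nat.card (G ⧸ V) : ℕ) - 1) * ∑ g with p • g ∈ V, f g := by
  let fb : G ⧸ V → ℤ := fun a => ∑ g ∈ univ.filter (fun g : G => (g : G ⧸ V) = a), f g
  have hfb : (S.quot V hV).Meas fb := by
    rw [quot_meas]
    have := hf.conv (hV.meas (1:ℤ) 0)
    convert this using 2 with x
    simp only [fb]
    rw [Finset.sum_filter]
    apply Finset.sum_congr rfl
    intro g _
    simp only [mk_eq, SetLike.mem_coe]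
    split_ifs <;> simp
  have hfb0 : fb 0 = 0 := by
    apply Finset.sum_eq_zero
    intro g hg
    simp only [mem_filter, mem_univ, true_and] at hg
    exact hf0 g (mk_zero.1 hg)
  have hu : ∀ a : G ⧸ V, a ≠ 0 → ∀ k : ℕ, k.Coprime (Nat.card (G ⧸ V)) → k • a ≠ 0 := by
    intro a ha k hk h
    exact ha (unit_inj hk (by rw [h, smul_zero]))
  have := (S.quot V hV).proportion hfb z0 (univ.erase 0) (({a | a ∈ tor (G ⧸ V) p} : Finset (G ⧸ V)).erase 0)
    (fun g hg => hall g (Finset.ne_of_mem_erase hg))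
    (fun g hg k hk => by
      rw [Finset.mem_erase] at *; exact ⟨hu g hg.1 k hk, mem_univ _⟩)
    (fun g hg => hall g (Finset.ne_of_mem_erase hg))
    (fun g hg k hk => by
      rw [Finset.mem_erase, mem_filter] at *
      exact ⟨hu g hg.1 k hk, mem_univ _, (tor _ p).nsmul_mem hg.2.2 k⟩)
  rw [Finset.sum_erase _ hfb0, Finset.sum_erase _ hfb0, Finset.card_erase_of_mem (mem_univ _), Finset.card_erase_of_mem
    (by rw [mem_filter]; exact ⟨mem_univ _, (tor _ p).zero_mem⟩), card_filter_tor hpn, Finset.card_univ,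
    ← Nat.card_eq_fintype_card, Nat.cast_sub Nat.card_pos, Nat.cast_sub (Nat.pos_of_dvd_of_pos hpn Nat.card_pos)] at this
  have e1 : ∑ a, fb a = ∑ g, f g := Finset.sum_fiberwise univ (fun g : G => (g : G ⧸ V)) f
  have e2 : ∑ a with a ∈ tor (G ⧸ V) p, fb a = ∑ g with p • g ∈ V, f g := by
    simp only [fb]
    rw [Finset.sum_fiberwise_eq_sum_filter univ _ (fun g : G => (g : G ⧸ V)) f]
    apply Finset.sum_congr _ (fun _ _ => rfl)
    ext g
    simp only [mem_filter, mem_univ, true_and, mk_mem_tor]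
  rw [e1, e2] at this
  simpa using this

/-- arithmetic: `|G/V| ≥ 3 p`. -/
theorem L2_card {p : ℕ} (hp : p.Prime) (hpn : p ∣ Nat.card G) (hodd : Odd (Nat.card G)) {x z0 : G} (hx : IsGen x)
    (hfull : S.Full p x) (hr : S.r x z0) (hnf : ¬ S.Full p z0) :
    p ∣ Nat.card (G ⧸ S.core (mul G p)) ∧ 3 * p ≤ Nat.card (G ⧸ S.core (mul G p)) := by
  set V := S.core (mul G p) with hVdef
  have hVle : V ≤ mul G p := S.core_le _
  have hVsat : S.Sat (V : Set G) := S.core_sat _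
  have hxV : x ∉ V := fun h => hx.not_mem_mul hp hpn (hVle h)
  have hzV : z0 ∉ V := fun h => hxV (hVsat _ _ (S.symm' hr) h)
  have hd : Nat.card V ∣ Nat.card G / p := by rw [← card_mul hpn]; exact le_iff_card.1 hVle
  have hn : p * (Nat.card G / p) = Nat.card G := Nat.mul_div_cancel' hpn
  have hq := card_quot V
  have hV0 : 0 < Nat.card V := Nat.card_pos
  obtain ⟨c, hc⟩ := hd
  have hpe : Nat.card (G ⧸ V) = p * c := by
    apply Nat.eq_of_mul_eq_mul_right hV0
    rw [← hq, ← hn, hc]; ring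
  refine ⟨⟨c, hpe⟩, ?_⟩
  rw [hpe]
  have hcodd : Odd c := by
    rw [← hn, hc] at hodd
    exact ((Nat.odd_mul.1 (Nat.odd_mul.1 hodd).2).2)
  rcases Nat.lt_or_ge c 3 with h | h
  · exfalso
    have hc1 : c = 1 := by
      obtain ⟨d, rfl⟩ := hcodd; omega
    have hVm : Nat.card V = Nat.card G / p := by rw [hc, hc1, mul_one]
    by_cases hpp : p ∣ Nat.card G / p
    · apply hnf
      intro t ht
      have hw : Nat.card V • z0 ≠ 0 := fun h => hzV (mem_iff_nsmul.2 h)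
      have hw' : ∀ y : G, Nat.card V • y ∈ tor G p := by
        intro y
        rw [mem_tor, ← mul_smul, hVm, hn]; exact card_nsmul_eq_zero'
      obtain ⟨j, hj⟩ := tor_multiple hp (hw' z0) hw ht
      have hu : (1 + j * Nat.card V).Coprime (Nat.card G) := by
        rw [← hn, hVm]
        apply Nat.Coprime.mul_right
        · obtain ⟨b, hb⟩ := hpp
          rw [hb, show 1 + j * (p * b) = 1 + (j * b) * p by ring]
          simp
        · simp
      have h1 : (1 + j * Nat.card V) • z0 = z0 + t := by
        rw [add_smul, one_smul, mul_smul, ← hj]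
      have h2 : (1 + j * Nat.card V) • x = x + j • Nat.card V • x := by
        rw [add_smul, one_smul, mul_smul]
      have h3 := schur hu hr
      rw [h1, h2] at h3
      exact S.trans' (S.symm' hr) (S.trans' (hfull _ ((tor G p).nsmul_mem (hw' x) j)) h3)
    · obtain ⟨t, ht, htm⟩ := exists_tor_add hp hpn hpp x
      have : V = mul G p := sub_eq_of_card (by rw [hVm, card_mul hpn])
      rw [← this] at htm
      exact hxV (hVsat _ _ (S.symm' (hfull t ht)) htm)
  · rw [mul_comm]; exact Nat.mul_le_mul_left _ h

theorem L2 {p : ℕ} (hp : p.Prime) (hpn : p ∣ Nat.card G) (hodd : Odd (Nat.card G)) {x z0 : G} (hx : IsGen x)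
    (hfull : S.Full p x) (hr : S.r x z0) (hnf : ¬ S.Full p z0) :
    ¬ p ∣ Nat.card (S.core (mul G p)) ∧ (∀ D : AddSubgroup G, S.Sat (D : Set G) → S.core (mul G p) ≤ D → D = S.core (mul G p) ∨ D = ⊤) ∧
    ∃ W : AddSubgroup G, S.Sat (W : Set G) ∧ tor G p ≤ W ∧ W ⊔ S.core (mul G p) = ⊤ ∧ W ⊓ S.core (mul G p) ≤ rad (S.cls x) ∧
    ∃ X2 : Set G, S.Sat X2 ∧ X2.Nonempty ∧ X2 ⊆ S.core (mul G p) ∧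
      ∀ y, S.r x y ↔ ∃ w ∈ W, w ∉ S.core (mul G p) ∧ ∃ s ∈ X2, y = w + s := by
  obtain ⟨hpQ, h3p⟩ := L2_card hp hpn hodd hx hfull hr hnf
  have hz0p : p • z0 ∈ S.core (mul G p) := fr hp hpn hnf
  have hfrV : ∀ g, p • g ∉ S.core (mul G p) → S.Full p g := fun g hg => by
    by_contra h; exact hg (fr hp hpn h)
  have hcoreQ := S.core_quot_bot (p := p)
  have hVsat : S.Sat (S.core (mul G p) : Set G) := S.core_sat _
  have hVle : S.core (mul G p) ≤ mul G p := S.core_le _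
  set V := S.core (mul G p) with hVdef
  haveI : Fact p.Prime := ⟨hp⟩
  have hp3 : 3 ≤ p := by
    have h2 := hp.two_le
    rcases Nat.lt_or_ge p 3 with h | h
    · exfalso
      have : p = 2 := by omega
      subst this
      obtain ⟨a, ha⟩ := hodd; omega
    · exact h
  have hxV : x ∉ V := fun h => hx.not_mem_mul hp hpn (hVle h)
  have hXV : ∀ y, S.r x y → y ∉ V := fun y hy h => hxV (hVsat _ _ (S.symm' hy) h)
  have hzV : z0 ∉ V := hXV _ hr
  have hzb : (z0 : G ⧸ V) ≠ 0 := fun h => hzV (mk_zero.1 h)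
  have hall := Q_lemma hp hpQ hcoreQ (gen_quot hx V) (quot_mk hr) (mk_mem_tor.2 hz0p) hzb
  let Om : AddSubgroup G := V.comap (nsmulAddMonoidHom p)
  have mOm : ∀ g, g ∈ Om ↔ p • g ∈ V := fun g => Iff.rfl
  have hVOm : V ≤ Om := fun v hv => V.nsmul_mem hv p
  have hPOm : tor G p ≤ Om := fun t ht => by
    rw [mOm, mem_tor.1 ht]; exact V.zero_mem
  have hOmord : ∀ w ∈ Om, addOrderOf w ∣ p * Nat.card V := by
    intro w hw
    rw [addOrderOf_dvd_iff_nsmul_eq_zero, mul_comm, mul_smul]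
    exact mem_iff_nsmul.1 hw
  have hpVn : p * Nat.card V ∣ Nat.card G := by
    obtain ⟨c, hc⟩ := hpQ
    rw [card_quot V, hc]; exact ⟨c, by ring⟩
  -- the unit invariance
  have hM : ∀ m : ℕ, m.Coprime (Nat.card G) → (∀ w ∈ Om, m • w - w ∈ tor G p) → ∀ g, S.r x g ↔ S.r x (m • g) := by
    intro m hm hmw
    let F : G → ℤ := fun g => (if g ∈ S.cls x then 1 else 0) - (if m • g ∈ S.cls x then 1 else 0)
    have hF1 : S.Meas (fun g => if g ∈ S.cls x then (1:ℤ) else 0) := (S.cls_sat x).meas 1 0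
    have hF : S.Meas F := by
      apply hF1.comp₂ (g := fun a b => a - b)
      intro a b h
      exact hF1 _ _ (schur hm h)
    have := F_lemma hp hp3 hpn V Om hVOm hPOm _ h3p (fun g hg => hfrV g hg)
      (fun f hf hf0 => h2_quot V hVsat hpQ hall f hf hf0) F hF
      (by
        intro g hg
        have h1 : g ∉ S.cls x := fun h => hXV _ h hg
        have h2 : m • g ∉ S.cls x := fun h => hXV _ h (V.nsmul_mem hg m)
        simp only [F, if_neg h1, if_neg h2, sub_self])
      (by
        intro g hg
        simp only [F]
        rw [Finset.sum_sub_distrib, sub_eq_zero]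
        symm
        have hmaps : ∀ t ∈ ({t : G | t ∈ tor G p} : Finset G), (m • g - g) + m • t ∈ ({t : G | t ∈ tor G p} : Finset G) := by
          intro t ht
          simp only [mem_filter, mem_univ, true_and] at *
          exact (tor G p).add_mem (hmw g hg) ((tor G p).nsmul_mem ht m)
        have hinj : Set.InjOn (fun t => (m • g - g) + m • t) ({t : G | t ∈ tor G p} : Finset G) := by
          intro a _ b _ h
          exact unit_inj hm (add_left_cancel h)
        apply Finset.sum_nbij (fun t => (m • g - g) + m • t) hmaps hinj
        · exact Finset.surjOn_of_injOn_of_card_le _ hmaps hinj le_rfl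
        · intro t _
          rw [show g + (m • g - g + m • t) = m • (g + t) by rw [smul_add]; abel])
    intro g
    have h := this g
    simp only [F] at h
    rw [← mem_cls, ← mem_cls]
    by_cases h1 : g ∈ S.cls x <;> by_cases h2 : m • g ∈ S.cls x <;> simp [h1, h2] at h ⊢
  have hpV : ¬ p ∣ Nat.card V := by
    intro hd
    apply hnf
    intro t ht
    have hw : Nat.card V • z0 ≠ 0 := fun h => hzV (mem_iff_nsmul.2 h)
    have hw' : ∀ y ∈ Om, Nat.card V • y ∈ tor G p := by
      intro y hy
      rw [mem_tor, ← mul_smul]; exact addOrderOf_dvd_iff_nsmul_eq_zero.1 (hOmord y hy)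
    obtain ⟨j, hj⟩ := tor_multiple hp (hw' z0 hz0p) hw ht
    obtain ⟨k, hk, hkn⟩ := lift_coprime (j := 1 + j * Nat.card V) ncard_ne hpVn (by
      apply Nat.Coprime.mul_right
      · obtain ⟨b, hb⟩ := hd
        rw [hb, show 1 + j * (p * b) = 1 + (j * b) * p by ring]
        simp
      · simp)
    have hkw : ∀ w ∈ Om, k • w = w + j • Nat.card V • w := by
      intro w hw
      rw [nsmul_congr (hk.of_dvd (hOmord w hw)), add_smul, one_smul, mul_smul]
    have := (hM k hkn (fun w hw => by
      rw [hkw w hw, add_sub_cancel_left]; exact (tor G p).nsmul_mem (hw' w hw) j) z0).1 hr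
    rw [hkw z0 hz0p, ← hj] at this
    exact S.trans' (S.symm' hr) this
  have hcop : p.Coprime (Nat.card V) := (Nat.Prime.coprime_iff_not_dvd hp).2 hpV
  have hdec : ∀ z ∈ Om, ∃ t ∈ tor G p, ∃ v ∈ V, z = t + v := by
    intro z hz
    obtain ⟨c, hc1, hc2⟩ := Nat.chineseRemainder hcop 0 1
    refine ⟨z - c • z, ?_, c • z, ?_, by abel⟩
    · rw [mem_tor, smul_sub, sub_eq_zero, smul_comm]
      rw [smul_one_mod ((mOm z).1 hz) hc2, one_smul]
    · obtain ⟨d, rfl⟩ := (Nat.modEq_zero_iff_dvd).1 hc1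
      rw [mul_comm, mul_smul]
      exact V.nsmul_mem hz d
  have hmove : ∀ t ∈ tor G p, ∀ v ∈ V, S.r x (t + v) → ∀ t' ∈ tor G p, t' ≠ 0 → S.r x (t' + v) := by
    intro t ht v hv h t' ht' h0'
    have h0 : t ≠ 0 := by rintro rfl; rw [zero_add] at h; exact hXV _ h hv
    obtain ⟨j, rfl⟩ := tor_multiple hp ht h0 ht'
    have hj : j.Coprime p := by
      rw [Nat.coprime_comm, Nat.Prime.coprime_iff_not_dvd hp]
      rintro ⟨d, rfl⟩
      apply h0'
      rw [mul_comm, mul_smul, mem_tor.1 ht, smul_zero]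
    obtain ⟨k, hk1, hk2, hkn⟩ := crt_coprime ncard_ne hcop hpVn hj
    have := (hM k hkn (fun w hw => by
      rw [mem_tor, smul_sub, smul_comm, smul_one_mod ((mOm w).1 hw) hk2, one_smul, sub_self]) _).1 h
    rw [smul_add, smul_one_mod hv hk2, one_smul, nsmul_congr (hk1.of_dvd (mem_tor_ord.1 ht))] at this
    exact this
  obtain ⟨t1, ht1, ht10⟩ := exists_tor_ne hp hpn
  let X2 : Set G := {v | v ∈ V ∧ ∃ t ∈ tor G p, S.r x (t + v)}
  have hX2t : ∀ v ∈ X2, ∀ t ∈ tor G p, t ≠ 0 → S.r x (t + v) := by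
    rintro v ⟨hv, t, ht, h⟩ t' ht' h0
    exact hmove t ht v hv h t' ht' h0
  have hX2ne : X2.Nonempty := by
    obtain ⟨t, ht, v, hv, e⟩ := hdec z0 hz0p
    exact ⟨v, hv, t, ht, e ▸ hr⟩
  have hX2sat : S.Sat X2 := by
    obtain ⟨k, hk, hkn⟩ := lift_coprime (n := Nat.card G) ncard_ne (sub_dvd V) hcop
    have h1 := (S.count_meas p (S.cls_sat x)).sat (fun a => a ≠ 0)
    have h2 : S.Sat ((V : Set G) ∩ {v | k • v ∈ {y | ((#{z : G | z ∈ S.cls x ∧ p • z = y} : ℕ) : ZMod p) ≠ 0}}) :=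
      hVsat.inter (fun a b h ha => h1 _ _ (schur hkn h) ha)
    convert h2 using 1
    ext v
    simp only [X2, Set.mem_inter_iff, Set.mem_ofPred_eq, SetLike.mem_coe]
    apply and_congr_right
    intro hv
    rw [smul_one_mod hv hk, coset_count]
    constructor
    · rintro ⟨t, ht, h⟩
      have : ({t : G | t ∈ tor G p ∧ v + t ∈ S.cls x} : Finset G) = ({t : G | t ∈ tor G p} : Finset G).erase 0 := by
        ext a
        simp only [mem_filter, mem_univ, true_and, Finset.mem_erase]
        constructor
        · rintro ⟨ha, hb⟩
          refine ⟨?_, ha⟩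
          rintro rfl
          rw [add_zero] at hb
          exact hXV _ hb hv
        · rintro ⟨ha, hb⟩
          rw [add_comm]
          exact ⟨hb, hmove t ht v hv h a hb ha⟩
      rw [this, Finset.card_erase_of_mem (by rw [mem_filter]; exact ⟨mem_univ _, (tor G p).zero_mem⟩), card_filter_tor hpn,
        Nat.cast_sub hp.one_lt.le]
      simp
    · intro h
      by_contra hc
      push Not at hc
      apply h
      have : ({t : G | t ∈ tor G p ∧ v + t ∈ S.cls x} : Finset G) = ∅ := by
        rw [Finset.filter_eq_empty_iff]
        rintro a _ ⟨ha, hb⟩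
        rw [add_comm] at hb
        exact hc a ha hb
      rw [this]; simp
  have hrel : ∀ g, g ∉ V → ∃ v ∈ V, S.r x (g + v) := by
    intro g hg
    have h1 := hall (g : G ⧸ V) (fun h => hg (mk_zero.1 h))
    obtain ⟨k, hk, h2⟩ := h1
    apply quot_r_out (hL := hVsat)
    refine trans' ?_ h2
    obtain ⟨t, ht, v, hv, e⟩ := hdec z0 hz0p
    have ht0 : t ≠ 0 := by rintro rfl; rw [e, zero_add] at hzV; exact hzV hv
    have e2 : (z0 : G ⧸ V) = (t : G ⧸ V) := by rw [mk_eq, e, sub_add_cancel_left]; exact V.neg_mem hv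
    have hkt : k • t ≠ 0 := by
      intro h
      apply ht0
      have hpk : k.Coprime p := Nat.Coprime.coprime_dvd_right hpQ hk
      have h3 : addOrderOf t ∣ k := addOrderOf_dvd_iff_nsmul_eq_zero.2 h
      rw [ord_of_tor hp ht ht0] at h3
      exact absurd (Nat.dvd_gcd h3 dvd_rfl) (by rw [hpk]; exact fun h => hp.one_lt.ne' (Nat.dvd_one.1 h))
    have h4 := hX2t v ⟨hv, t, ht, e ▸ hr⟩ (k • t) ((tor G p).nsmul_mem ht k) hkt
    have h5 := quot_mk (hL := hVsat) h4
    have e3 : ((k • t + v : G) : G ⧸ V) = k • (z0 : G ⧸ V) := by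
      rw [e2]
      have : ((k • t : G) : G ⧸ V) = k • (t : G ⧸ V) := rfl
      rw [← this, mk_eq, sub_add_cancel_left]; exact V.neg_mem hv
    rw [e3] at h5
    exact h5
  have hDV : ∀ D : AddSubgroup G, S.Sat (D : Set G) → V ≤ D → D = V ∨ D = ⊤ := by
    intro D hD hVD
    by_cases h : D ≤ V
    · exact Or.inl (le_antisymm h hVD)
    · right
      obtain ⟨g, hgD, hgV⟩ := Set.not_subset.1 h
      obtain ⟨v, hv, h1⟩ := hrel g hgV
      exact hx.eq_top (hD _ _ (S.symm' h1) (D.add_mem hgD (hVD hv)))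
  -- count in cosets
  have hcount : ∀ g, g ∉ V → #{v : G | v ∈ V ∧ S.r x (g + v)} = #{v : G | v ∈ X2} := by
    have hcm := (hVsat.meas (1:ℕ) 0).corr ((S.cls_sat x).meas (1:ℕ) 0)
    have hc : ∀ g, (∑ v, (if v ∈ (V : Set G) then 1 else 0) * (if g + v ∈ S.cls x then 1 else 0)) = #{v : G | v ∈ V ∧ S.r x (g + v)} := by
      intro g
      rw [Finset.card_filter]
      apply Finset.sum_congr rfl
      intro v _
      by_cases h1 : v ∈ V <;> by_cases h2 : S.r x (g + v) <;> simp [h1, h2, mem_cls]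
    have hshift : ∀ g, ∀ w ∈ V, #{v : G | v ∈ V ∧ S.r x (g + w + v)} = #{v : G | v ∈ V ∧ S.r x (g + v)} := by
      intro g w hw
      apply Finset.card_bij (fun v _ => w + v)
      · intro a ha
        simp only [mem_filter, mem_univ, true_and] at *
        exact ⟨V.add_mem hw ha.1, by rw [← add_assoc]; exact ha.2⟩
      · intro a _ b _ h; exact add_left_cancel h
      · intro b hb
        simp only [mem_filter, mem_univ, true_and] at *
        refine ⟨-w + b, ⟨V.add_mem (V.neg_mem hw) hb.1, ?_⟩, by abel⟩
        rw [show g + w + (-w + b) = g + b by abel]; exact hb.2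
    have hx' : ∀ g, g ∉ V → #{v : G | v ∈ V ∧ S.r x (g + v)} = #{v : G | v ∈ V ∧ S.r x (x + v)} := by
      intro g hg
      obtain ⟨v, hv, h⟩ := hrel g hg
      have := hcm _ _ h
      simp only [hc] at this
      rw [this, hshift g v hv]
    intro g hg
    have ht1V : t1 ∉ V := fun h => ht10 (tor_inf hp hpV ht1 h)
    rw [hx' g hg, ← hx' t1 ht1V]
    congr 1
    ext v
    simp only [mem_filter, mem_univ, true_and, X2, Set.mem_ofPred_eq]
    apply and_congr_right
    intro hv
    exact ⟨fun h => ⟨t1, ht1, h⟩, fun ⟨t, ht, h⟩ => hmove t ht v hv h t1 ht1 ht10⟩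
  set R' : Set G := {g | ∀ v ∈ X2, g + v ∈ S.cls x ∪ X2} with hR'
  have hR'sat : S.Sat R' := hX2sat.forall_add ((S.cls_sat x).union hX2sat)
  have hPR : tor G p ≤ rad R' := by
    intro t ht
    apply mem_rad'
    intro g hg v hv
    by_cases ht0 : t = 0
    · rw [ht0, zero_add]; exact hg v hv
    rw [add_assoc]
    rcases hg v hv with h | h
    · by_cases ho : g + v ∈ Om
      · obtain ⟨t2, ht2, v2, hv2, e⟩ := hdec _ ho
        have hv2' : v2 ∈ X2 := ⟨hv2, t2, ht2, e ▸ h⟩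
        rw [e, ← add_assoc]
        by_cases h0 : t + t2 = 0
        · rw [h0, zero_add]; exact Or.inr hv2'
        · exact Or.inl (hX2t v2 hv2' _ ((tor G p).add_mem ht ht2) h0)
      · left
        rw [add_comm]
        exact S.trans' h (hfrV _ ho t ht)
    · exact Or.inl (hX2t _ h t ht ht0)
  have hWsat := S.sat_rad hR'sat
  have hWR : ∀ w ∈ rad R', w ∈ R' := by
    intro w hw
    have := (hw 0).1 (by intro v hv; rw [zero_add]; exact Or.inr hv)
    rwa [add_zero] at this
  have hWX : ∀ w ∈ rad R', w ∉ V → ∀ s ∈ X2, S.r x (w + s) := by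
    intro w hw hwV s hs
    refine (hWR w hw s hs).resolve_right ?_
    intro h
    exact hwV (by simpa using V.sub_mem h.1 hs.1)
  have htop : rad R' ⊔ V = ⊤ := by
    refine (hDV _ (S.sat_sup hWsat hVsat) le_sup_right).resolve_left ?_
    intro h
    have : t1 ∈ V := by rw [← h]; exact AddSubgroup.mem_sup_left (hPR ht1)
    exact ht10 (tor_inf hp hpV ht1 this)
  have hWX' : ∀ w ∈ rad R', w ∉ V → ∀ v ∈ V, S.r x (w + v) → v ∈ X2 := by
    intro w hw hwV v hv h
    have h1 : ({v : G | v ∈ X2} : Finset G) ⊆ ({v : G | v ∈ V ∧ S.r x (w + v)} : Finset G) := by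
      intro s hs
      simp only [mem_filter, mem_univ, true_and] at *
      exact ⟨hs.1, hWX w hw hwV s hs⟩
    have h2 := Finset.eq_of_subset_of_card_le h1 (hcount w hwV).le
    have : v ∈ ({v : G | v ∈ V ∧ S.r x (w + v)} : Finset G) := by
      rw [mem_filter]; exact ⟨mem_univ _, hv, h⟩
    rw [← h2, mem_filter] at this
    exact this.2
  have hfin : ∀ y, S.r x y ↔ ∃ w ∈ rad R', w ∉ V ∧ ∃ s ∈ X2, y = w + s := by
    intro y
    constructor
    · intro h
      have : y ∈ rad R' ⊔ V := by rw [htop]; trivial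
      obtain ⟨w, hw, v, hv, rfl⟩ := AddSubgroup.mem_sup.1 this
      have hwV : w ∉ V := fun h1 => hXV _ h (V.add_mem h1 hv)
      exact ⟨w, hw, hwV, v, hWX' w hw hwV v hv h, rfl⟩
    · rintro ⟨w, hw, hwV, s, hs, rfl⟩
      exact hWX w hw hwV s hs
  refine ⟨hpV, hDV, rad R', hWsat, hPR, htop, ?_, X2, hX2sat, hX2ne, fun v hv => hv.1, hfin⟩
  intro u hu
  rw [AddSubgroup.mem_inf] at hu
  apply mem_rad'
  intro y hy
  obtain ⟨w, hw, hwV, s, hs, rfl⟩ := (hfin y).1 hy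
  refine (hfin _).2 ⟨u + w, (rad R').add_mem hu.1 hw, fun h => hwV (by simpa using V.sub_mem h hu.2), s, hs, by abel⟩

end SR
end SRP

namespace SRP
open Classical Finset
open scoped Pointwise
universe u
set_option linter.all false
set_option linter.deprecated false

/-- geometric sum mod q -/
theorem geom_mod {k q : ℤ} (h : q ∣ k - 1) (M : ℕ) : q ∣ (∑ i ∈ range M, k ^ i) - M := by
  have : ∀ i ∈ range M, q ∣ k ^ i - 1 := fun i _ => h.trans (by simpa using sub_dvd_pow_sub_pow k 1 i)
  have h2 := Finset.dvd_sum this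
  rw [Finset.sum_sub_distrib] at h2
  simpa using h2

theorem geom_val {p : ℕ} (hp : p.Prime) (hodd : Odd p) {k : ℤ} (h : (p:ℤ) ∣ k - 1) :
    ∃ s : ℤ, (∑ i ∈ range p, k ^ i) = p * s ∧ ¬ (p : ℤ) ∣ s := by
  obtain ⟨b, hb⟩ := h
  have h1 := odd_sq_dvd_geom_sum₂_sub (a := (1:ℤ)) (b := b) hodd
  have hk : k = 1 + p * b := by linarith
  simp only [one_pow, mul_one] at h1
  rw [← hk] at h1
  obtain ⟨c, hc⟩ := h1
  have hp0 : (p:ℤ) ≠ 0 := by exact_mod_cast hp.ne_zero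
  refine ⟨1 + p * c, by linear_combination hc, ?_⟩
  intro hd
  have : (p:ℤ) ∣ 1 := by
    have := dvd_sub hd (dvd_mul_right (p:ℤ) c)
    simpa using this
  have := Int.isUnit_iff.1 (isUnit_of_dvd_one this)
  have := hp.two_le
  omega

/-- coprimality from primes -/
theorem int_coprime_of_primes {s : ℤ} {n : ℕ} (hn : n ≠ 0) (h : ∀ q : ℕ, q.Prime → q ∣ n → ¬ (q:ℤ) ∣ s) : IsCoprime s (n:ℤ) := by
  rw [Int.isCoprime_iff_gcd_eq_one]
  by_contra hc
  obtain ⟨q, hq, hqd⟩ := Nat.exists_prime_and_dvd hc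
  have h1 : q ∣ n := by
    have := hqd.trans (Int.gcd_dvd_natAbs_right s n)
    simpa using this
  exact h q hq h1 ((Int.natCast_dvd_natCast.2 hqd).trans (Int.gcd_dvd_left _ _))

theorem unit_trick {n p : ℕ} (hn : Odd n) (hp : p.Prime) {k : ℤ} (hk : ∀ q : ℕ, q.Prime → q ∣ n → (q:ℤ) ∣ k - 1)
    (hkp : (n:ℤ) ∣ k ^ p - 1) : (n:ℤ) ∣ p * (k - 1) ∧ (¬ p ∣ n → (n:ℤ) ∣ k - 1) := by
  have hn0 : n ≠ 0 := by rintro rfl; simp at hn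
  have hS := geom_sum_mul k p
  have hpr : ∀ q : ℕ, q.Prime → q ≠ p → ¬ (q:ℤ) ∣ p := by
    intro q hq hne hd
    exact hne ((Nat.prime_dvd_prime_iff_eq hq hp).1 (by exact_mod_cast hd))
  have hq : ∀ q : ℕ, q.Prime → q ∣ n → q ≠ p → ¬ (q:ℤ) ∣ ∑ i ∈ range p, k ^ i := by
    intro q hq hqn hne hd
    have := dvd_sub hd (geom_mod (hk q hq hqn) p)
    exact hpr q hq hne (by simpa using this)
  by_cases hpn : p ∣ n
  · refine ⟨?_, fun h => absurd hpn h⟩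
    obtain ⟨s, hs, hps⟩ := geom_val hp (hn.of_dvd_nat hpn) (hk p hp hpn)
    have hcop : IsCoprime s (n:ℤ) := by
      apply int_coprime_of_primes hn0
      intro q hqp hqn hd
      by_cases hqe : q = p
      · subst hqe; exact hps hd
      · exact hq q hqp hqn hqe (hs ▸ hd.mul_left _)
    apply (hcop.symm).dvd_of_dvd_mul_left
    rw [← hS, hs] at hkp
    have he : (p:ℤ) * s * (k - 1) = s * (p * (k - 1)) := by ring
    rwa [he] at hkp
  · have hcop : IsCoprime (∑ i ∈ range p, k ^ i) (n:ℤ) := by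
      apply int_coprime_of_primes hn0
      intro q hqp hqn hd
      exact hq q hqp hqn (by rintro rfl; exact hpn hqn) hd
    have : (n:ℤ) ∣ k - 1 := by
      apply (hcop.symm).dvd_of_dvd_mul_left
      rw [hS]; exact hkp
    exact ⟨this.mul_left _, fun _ => this⟩

theorem exists_prime_power {n k : ℕ} (hn : n ≠ 0) (hk : k.Coprime n) (hne : ¬ k ≡ 1 [MOD n]) :
    ∃ p j : ℕ, p.Prime ∧ (k ^ j) ^ p ≡ 1 [MOD n] ∧ ¬ k ^ j ≡ 1 [MOD n] := by
  haveI : NeZero n := ⟨hn⟩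
  let u := ZMod.unitOfCoprime k hk
  have hu : ∀ i, u ^ i = 1 ↔ k ^ i ≡ 1 [MOD n] := by
    intro i
    rw [Units.ext_iff, ← ZMod.natCast_eq_natCast_iff]
    simp [u]
  have ho : orderOf u ≠ 1 := by
    intro h
    rw [orderOf_eq_one_iff] at h
    apply hne
    have := (hu 1).1 (by simpa using h)
    simpa using this
  obtain ⟨p, hp, hd⟩ := Nat.exists_prime_and_dvd ho
  refine ⟨p, orderOf u / p, hp, ?_, ?_⟩
  · rw [← pow_mul, Nat.div_mul_cancel hd]
    exact (hu _).1 (pow_orderOf_eq_one u)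
  · intro h
    have hpos : 0 < orderOf u := orderOf_pos u
    exact pow_ne_one_of_lt_orderOf (Nat.div_pos (Nat.le_of_dvd hpos hd) hp.pos).ne' (Nat.div_lt_self hpos hp.one_lt) ((hu _).2 h)

namespace SR
variable {G : Type u} [AddCommGroup G] [Fintype G] {S : SR G}
variable [IsAddCyclic G]

/-- the class is stable under its stabiliser -/
theorem stab_mul {x : G} {k : ℕ} (hk : k.Coprime (Nat.card G)) (h : S.r x (k • x)) {y : G} (hy : S.r x y) : S.r x (k • y) :=
  S.trans' h (schur hk hy)

theorem stab_pow {x : G} {k : ℕ} (hk : k.Coprime (Nat.card G)) (h : S.r x (k • x)) (i : ℕ) : S.r x (k ^ i • x) := by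
  induction i with
  | zero => simpa using S.rfl' x
  | succ i ih => rw [pow_succ, mul_comm, mul_smul]; exact stab_mul hk h ih

/-- an element of the stabiliser moving `x` by `t ∈ tor p`, fixing `t` -/
theorem full_of_stab {p : ℕ} (hp : p.Prime) {x t : G} {k : ℕ} (hk : k.Coprime (Nat.card G)) (h : S.r x (k • x))
    (ht : t ∈ tor G p) (h0 : t ≠ 0) (hkx : k • x = x + t) (hkt : k • t = t) : S.Full p x := by
  have : ∀ i : ℕ, k ^ i • x = x + i • t := by
    intro i
    induction i with
    | zero => simp
    | succ i ih => rw [pow_succ, mul_comm, mul_smul, ih, smul_add, hkx, smul_comm, hkt, add_smul, one_smul]; abel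
  intro t' ht'
  obtain ⟨j, rfl⟩ := tor_multiple hp ht h0 ht'
  rw [← this]
  exact stab_pow hk h j

theorem smul_sub_one {x : G} {k : ℕ} {m : ℕ} : (m:ℤ) • (k • x - x) = ((m:ℤ) * ((k:ℤ) - 1)) • x := by
  rw [mul_smul, sub_smul, natCast_zsmul x k, one_zsmul]

theorem zsmul_eq_zero_of_card {a : ℤ} (h : ((Nat.card G : ℕ) : ℤ) ∣ a) (x : G) : a • x = 0 := by
  obtain ⟨c, rfl⟩ := h
  rw [mul_smul, natCast_zsmul]; exact card_nsmul_eq_zero'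

theorem PA (hodd : Odd (Nat.card G)) {x : G} (hx : IsGen x) (hnf : ∀ p : ℕ, p.Prime → p ∣ Nat.card G → ¬ S.Full p x)
    {k : ℕ} (hk : k.Coprime (Nat.card G)) (h : S.r x (k • x)) (hk1 : ∀ q : ℕ, q.Prime → q ∣ Nat.card G → k ≡ 1 [MOD q]) :
    k ≡ 1 [MOD Nat.card G] := by
  by_contra hne
  obtain ⟨p, j, hp, h1, h2⟩ := exists_prime_power ncard_ne hk hne
  set k' := k ^ j with hk'
  have hk'c : k'.Coprime (Nat.card G) := hk.pow_left j
  have hr := stab_pow hk h j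
  rw [← hk'] at hr
  have hq : ∀ q : ℕ, q.Prime → q ∣ Nat.card G → (q:ℤ) ∣ (k':ℤ) - 1 := by
    intro q hq hqn
    have := ((hk1 q hq hqn).pow j)
    rw [one_pow] at this
    exact_mod_cast (Nat.modEq_iff_dvd.1 this.symm)
  have hh := unit_trick hodd hp hq (by exact_mod_cast (Nat.modEq_iff_dvd.1 h1.symm))
  have hne' : ¬ ((Nat.card G : ℕ) : ℤ) ∣ (k':ℤ) - 1 := by
    intro hd
    exact h2 (Nat.modEq_iff_dvd.2 (by exact_mod_cast hd)).symm
  have hpn : p ∣ Nat.card G := by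
    by_contra hc; exact hne' (hh.2 hc)
  have ht : k' • x - x ∈ tor G p := by
    rw [mem_tor, ← natCast_zsmul, smul_sub_one]
    exact zsmul_eq_zero_of_card hh.1 x
  have h0 : k' • x - x ≠ 0 := by
    intro h0
    apply h2
    rw [sub_eq_zero] at h0
    have : k' • x = 1 • x := by rw [one_smul]; exact h0
    rw [nsmul_eq_nsmul_iff_modEq, hx] at this
    exact this
  apply hnf p hp hpn
  apply full_of_stab hp hk'c hr ht h0 (by abel)
  have : k' ≡ 1 [MOD p] := (Nat.modEq_iff_dvd.2 (by exact_mod_cast (hq p hp hpn))).symm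
  rw [nsmul_congr (this.of_dvd (mem_tor_ord.1 ht)), one_smul]

end SR
end SRP

namespace SRP
open Classical Finset
open scoped Pointwise
universe u
set_option linter.all false
set_option linter.deprecated false

namespace SR
variable {G : Type u} [AddCommGroup G] [Fintype G] {S : SR G}
variable [IsAddCyclic G]

theorem gen_zsmul {x : G} (hx : IsGen x) {a : ℤ} (h : a • x = 0) : ((Nat.card G : ℕ) : ℤ) ∣ a := by
  rw [← hx]; exact addOrderOf_dvd_iff_zsmul_eq_zero.2 h

theorem gen_nsmul {x : G} (hx : IsGen x) {a : ℕ} (h : a • x = 0) : Nat.card G ∣ a := by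
  rw [← hx]; exact addOrderOf_dvd_iff_nsmul_eq_zero.2 h

/-- the class of `x` consists of generators and nothing is full -/
def Cyc (S : SR G) (x : G) : Prop := IsGen x ∧ ∀ p : ℕ, p.Prime → p ∣ Nat.card G → ¬ S.Full p x

theorem Full.unit {p : ℕ} {x : G} {k : ℕ} (hk : k.Coprime (Nat.card G)) (h : S.Full p (k • x)) : S.Full p x := by
  intro t ht
  have := h (k • t) (AddSubgroup.nsmul_mem _ ht k)
  rw [← smul_add] at this
  exact (schur_iff hk).1 this

theorem Cyc.gen {x y : G} (hx : S.Cyc x) (h : S.r x y) : IsGen y := by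
  rw [isGen_iff_prime]
  intro p hp hpn hy
  exact hx.1.not_mem_mul hp hpn ((L1 hp hpn hx.1 (hx.2 p hp hpn)) y x (S.symm' h) hy)

theorem Cyc.unit {x y : G} (hx : S.Cyc x) (h : S.r x y) : ∃ k : ℕ, k.Coprime (Nat.card G) ∧ y = k • x :=
  exists_unit_of_ord_eq (hx.1.trans (hx.gen h).symm)

theorem Cyc.of_r {x y : G} (hx : S.Cyc x) (h : S.r x y) : S.Cyc y := by
  refine ⟨hx.gen h, fun p hp hpn hf => ?_⟩
  obtain ⟨k, hk, rfl⟩ := hx.unit h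
  exact hx.2 p hp hpn (hf.unit hk)

theorem Cyc.sat_dvd (hodd : Odd (Nat.card G)) {x : G} (hx : S.Cyc x) (d : ℕ) (hd : d ∣ Nat.card G) :
    S.Sat {y | ∃ z, S.r x z ∧ d • z = y} := by
  induction d using Nat.strong_induction_on with
  | _ d ih =>
  have hd0 : d ≠ 0 := by rintro rfl; exact ncard_ne (zero_dvd_iff.1 hd)
  by_cases hd1 : d = 1
  · subst hd1
    convert S.cls_sat x using 1
    ext y; simp [cls]
  obtain ⟨p, hp, hpd, hcase⟩ : ∃ p : ℕ, p.Prime ∧ p ∣ d ∧ (p ∣ Nat.card G / d → ∀ q : ℕ, q.Prime → q ∣ d → q ∣ Nat.card G / d) := by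
    by_cases h : ∃ p : ℕ, p.Prime ∧ p ∣ d ∧ ¬ p ∣ Nat.card G / d
    · obtain ⟨p, h1, h2, h3⟩ := h
      exact ⟨p, h1, h2, fun h => absurd h h3⟩
    · push Not at h
      obtain ⟨p, h1, h2⟩ := Nat.exists_prime_and_dvd hd1
      exact ⟨p, h1, h2, fun _ => h⟩
  obtain ⟨m, hm⟩ := hd
  have hdiv : Nat.card G / d = m := by rw [hm, Nat.mul_div_cancel_left _ (Nat.pos_of_ne_zero hd0)]
  rw [hdiv] at hcase
  have hm0 : m ≠ 0 := by rintro rfl; exact ncard_ne (G := G) (by simpa using hm)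
  obtain ⟨d', rfl⟩ := hpd
  have hd'0 : d' ≠ 0 := by rintro rfl; simp at hd0
  have hpn : p ∣ Nat.card G := ⟨d' * m, by rw [hm]; ring⟩
  obtain ⟨Y, hY, hsat⟩ : ∃ Y : Set G, (∀ y, y ∈ Y ↔ ∃ z, S.r x z ∧ d' • z = y) ∧ S.Sat Y :=
    ⟨_, fun _ => Iff.rfl, ih d' (by nlinarith [hp.two_le, Nat.pos_of_ne_zero hd'0]) ⟨p * m, by rw [hm]; ring⟩⟩
  haveI : Fact p.Prime := ⟨hp⟩
  have h1 := (S.count_meas p hsat).sat (fun c => c ≠ 0)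
  convert h1 using 1
  ext y
  simp only [Set.mem_ofPred_eq]
  constructor
  · rintro ⟨z, hz, rfl⟩
    rw [mul_smul, coset_count]
    intro h0
    rw [ZMod.natCast_eq_zero_iff] at h0
    set B : Finset G := {t : G | t ∈ tor G p ∧ d' • z + t ∈ Y} with hB
    have hpos : 0 < #B := by
      apply Finset.card_pos.2
      refine ⟨0, ?_⟩
      rw [hB, mem_filter]
      exact ⟨mem_univ _, (tor G p).zero_mem, (hY _).2 ⟨z, hz, by simp⟩⟩
    have hle := Nat.le_of_dvd hpos h0
    have hall : ∀ t ∈ tor G p, ∃ z', S.r x z' ∧ d' • z' = d' • z + t := by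
      have : B = ({t : G | t ∈ tor G p} : Finset G) := by
        apply Finset.eq_of_subset_of_card_le
        · intro t ht; rw [hB, mem_filter] at ht; simp [ht.2.1]
        · rw [card_filter_tor hpn]; exact hle
      intro t ht
      have ht2 : t ∈ B := by rw [this]; simp [ht]
      rw [hB, mem_filter] at ht2
      exact (hY _).1 ht2.2.2
    have hzc := hx.of_r hz
    by_cases hpm : p ∣ m
    · obtain ⟨t, ht, ht0⟩ := exists_tor_ne (G := G) hp hpn
      obtain ⟨z', hz', he⟩ := hall t ht
      have hzz := S.trans' (S.symm' hz) hz'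
      obtain ⟨k, hk, rfl⟩ := hzc.unit hzz
      have ht' : (d' : ℤ) • (k • z - z) = t := by
        rw [natCast_zsmul, smul_sub, he]; abel
      have h2 : ((p * d' : ℕ) : ℤ) • (k • z - z) = 0 := by
        push_cast
        rw [mul_smul, ht', natCast_zsmul]; exact ht
      rw [smul_sub_one] at h2
      have h3 := gen_zsmul hzc.1 h2
      rw [hm, Nat.cast_mul] at h3
      have h4 : (m:ℤ) ∣ (k:ℤ) - 1 := (mul_dvd_mul_iff_left (by exact_mod_cast hd0)).1 h3
      have h5 := PA hodd hzc.1 hzc.2 hk hzz (fun q hq hqn => by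
        have : q ∣ m := by
          rw [hm] at hqn
          rcases (Nat.Prime.dvd_mul hq).1 hqn with h | h
          · exact hcase hpm q hq h
          · exact h
        exact (Nat.modEq_iff_dvd.2 ((Int.natCast_dvd_natCast.2 this).trans (by exact_mod_cast h4))).symm)
      apply ht0
      have h6 : k • z = z := by
        rw [nsmul_congr (h5.of_dvd (ord_dvd z)), one_smul]
      rw [← ht', h6]; simp
    · obtain ⟨j, hj1, hj2⟩ := Nat.chineseRemainder ((Nat.Prime.coprime_iff_not_dvd hp).2 hpm) 0 1
      have hjp : p ∣ j := (Nat.modEq_zero_iff_dvd).1 hj1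
      have ht : j • (d' • z) - d' • z ∈ tor G p := by
        rw [mem_tor, ← natCast_zsmul, smul_sub_one, ← natCast_zsmul _ d', ← mul_smul]
        apply zsmul_eq_zero_of_card
        rw [hm]
        obtain ⟨c, hc⟩ := Nat.modEq_iff_dvd.1 hj2.symm
        refine ⟨c, ?_⟩
        push_cast at hc ⊢
        rw [hc]; ring
      obtain ⟨z', hz', he⟩ := hall _ ht
      have h2 : m • d' • z' = 0 := by
        rw [he]
        have : d' • z + (j • (d' • z) - d' • z) = j • (d' • z) := by abel
        rw [this, ← mul_smul, ← mul_smul]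
        obtain ⟨c, rfl⟩ := hjp
        have : m * (p * c) * d' = c * Nat.card G := by rw [hm]; ring
        rw [this, mul_smul, card_nsmul_eq_zero', smul_zero]
      rw [← mul_smul] at h2
      have h3 := gen_nsmul (hx.gen hz') h2
      have h4 := Nat.le_of_dvd (Nat.pos_of_ne_zero (mul_ne_zero hm0 hd'0)) h3
      rw [hm] at h4
      nlinarith [hp.two_le, Nat.pos_of_ne_zero (mul_ne_zero hm0 hd'0)]
  · intro h
    have : ({z : G | z ∈ Y ∧ p • z = y} : Finset G).Nonempty := by
      rw [Finset.nonempty_iff_ne_empty]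
      intro h'; apply h; rw [h']; simp
    obtain ⟨w, hw⟩ := this
    rw [mem_filter] at hw
    obtain ⟨-, hw1, rfl⟩ := hw
    obtain ⟨z, hz, rfl⟩ := (hY _).1 hw1
    exact ⟨z, hz, by rw [mul_smul]⟩

theorem Cyc.sat_mul (hodd : Odd (Nat.card G)) {x : G} (hx : S.Cyc x) (m : ℕ) :
    S.Sat {y | ∃ z, S.r x z ∧ m • z = y} := by
  have hg : Nat.gcd (Nat.card G) m ∣ Nat.card G := Nat.gcd_dvd_left _ _
  have h1 := hx.sat_dvd hodd _ hg
  have ho : addOrderOf (Nat.gcd (Nat.card G) m • x) = addOrderOf (m • x) := by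
    rw [addOrderOf_nsmul, addOrderOf_nsmul, hx.1]
    congr 1
    rw [Nat.gcd_eq_right hg]
  obtain ⟨k, hk, he⟩ := exists_unit_of_ord_eq ho
  convert sat_unit_smul hk h1 using 1
  ext y
  have key : ∀ z : G, m • z = k • (Nat.gcd (Nat.card G) m • z) := by
    intro z
    obtain ⟨j, rfl⟩ := hx.1.exists_nsmul z
    rw [smul_comm, he, smul_comm _ j x, smul_comm k j]
  simp only [Set.mem_ofPred_eq]
  constructor
  · rintro ⟨z, hz, rfl⟩; exact ⟨_, ⟨z, hz, rfl⟩, (key z).symm⟩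
  · rintro ⟨_, ⟨z, hz, rfl⟩, rfl⟩; exact ⟨z, hz, key z⟩

theorem Cyc.r_unit (hodd : Odd (Nat.card G)) {x : G} (hx : S.Cyc x) {c c' : G} (h : S.r c c') :
    ∃ k : ℕ, k.Coprime (Nat.card G) ∧ S.r x (k • x) ∧ c' = k • c := by
  obtain ⟨m, rfl⟩ := hx.1.exists_nsmul c
  obtain ⟨z, hz, rfl⟩ := hx.sat_mul hodd m _ _ h ⟨x, S.rfl' x, rfl⟩
  obtain ⟨k, hk, rfl⟩ := hx.unit hz
  exact ⟨k, hk, hz, smul_comm _ _ _⟩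

theorem Cyc.sat_sub (hodd : Odd (Nat.card G)) {x : G} (hx : S.Cyc x) (H : AddSubgroup G) : S.Sat (H : Set G) := by
  intro c c' h hc
  obtain ⟨k, -, -, rfl⟩ := hx.r_unit hodd h
  exact H.nsmul_mem hc k

theorem Cyc.fib_meas (hodd : Odd (Nat.card G)) {x : G} (hx : S.Cyc x) (m : ℕ) :
    S.Meas (fun c => (#{y : G | S.r x y ∧ m • y = c} : ℕ)) := by
  have key : ∀ c c', S.r c c' → #{y : G | S.r x y ∧ m • y = c} ≤ #{y : G | S.r x y ∧ m • y = c'} := by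
    intro c c' h
    obtain ⟨k, hk, hr, rfl⟩ := hx.r_unit hodd h
    apply Finset.card_le_card_of_injOn (fun y => k • y)
    · intro y hy
      simp only [coe_filter, mem_univ, true_and, Set.mem_ofPred_eq] at hy ⊢
      exact ⟨stab_mul hk hr hy.1, by rw [smul_comm, hy.2]⟩
    · intro a _ b _ hab; exact unit_inj hk hab
  intro c c' h
  exact le_antisymm (key _ _ h) (key _ _ (S.symm' h))

noncomputable def KK (S : SR G) (x : G) : Finset ℕ := (range (Nat.card G)).filter (fun k => S.r x (k • x))

theorem Cyc.sum_zero (hodd : Odd (Nat.card G)) {x : G} (hx : S.Cyc x) {w : G → ℚ} {u : G}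
    (h : ∀ g : G → ℚ, S.Meas g → ∑ b, w b * g (u - b) = 0) (b : G) : ∑ k ∈ S.KK x, w (u - k • b) = 0 := by
  obtain ⟨m, rfl⟩ := hx.1.exists_nsmul b
  have h1 := h _ ((hx.fib_meas hodd m).comp (fun c : ℕ => (c : ℚ)))
  have h2 : ∑ y with S.r x y, w (u - m • y) = 0 := by
    rw [← h1]
    have : ∀ b, w b * ((#{y : G | S.r x y ∧ m • y = u - b} : ℕ) : ℚ) = ∑ y with S.r x y, if m • y = u - b then w b else 0 := by
      intro b
      rw [← Finset.sum_filter, Finset.filter_filter, Finset.sum_const, nsmul_eq_mul, mul_comm]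
    rw [Finset.sum_congr rfl (fun b _ => this b), Finset.sum_comm]
    refine Finset.sum_congr rfl (fun y _ => ?_)
    rw [Finset.sum_eq_single (u - m • y)]
    · rw [if_pos (by abel)]
    · intro b _ hb
      rw [if_neg]
      intro h; apply hb; rw [h]; abel
    · simp
  rw [← h2]
  apply Finset.sum_nbij (fun k => k • x)
  · intro k hk
    simp only [KK, mem_filter, mem_range] at hk
    simp [hk.2]
  · intro a ha b hb hab
    simp only [KK, coe_filter, mem_range, Set.mem_ofPred_eq] at ha hb
    simp only at hab
    rw [nsmul_eq_nsmul_iff_modEq, hx.1] at hab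
    exact Nat.ModEq.eq_of_lt_of_lt hab ha.1 hb.1
  · intro y hy
    simp only [coe_filter, mem_univ, true_and, Set.mem_ofPred_eq] at hy
    obtain ⟨k, rfl⟩ := hx.1.exists_nsmul y
    have he : (k % Nat.card G) • x = k • x := nsmul_congr ((Nat.mod_modEq k _).of_dvd (ord_dvd x))
    refine ⟨k % Nat.card G, ?_, he⟩
    simp only [KK, coe_filter, mem_range, Set.mem_ofPred_eq]
    exact ⟨Nat.mod_lt _ (Nat.pos_of_ne_zero ncard_ne), by rw [he]; exact hy⟩
  · intro k _
    rw [smul_comm]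

end SR
end SRP

namespace SRP
open Classical Finset
open scoped Pointwise
universe u
set_option linter.all false
set_option linter.deprecated false

theorem line_lemma {q : ℕ} [hq : Fact q.Prime] (hq3 : 3 ≤ q) (f : ZMod q → ZMod q → ℚ) (h0 : ∀ c, f 0 c = 0) (h1 : ∀ r, f r 0 = 0)
    (h : ∀ i j, i ≠ 0 → ∑ r, f r (i - r * j) = 0) (r c : ZMod q) : f r c = 0 := by
  set Psi : ZMod q → ℚ := fun b => ∑ r, f r (- (r * b)) with hPsi
  set s : ZMod q → ℚ := fun r => ∑ c, f r c with hs
  have hcardq : (Fintype.card (ZMod q) : ℚ) = q := by rw [ZMod.card]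
  have hq' : (3:ℚ) ≤ q := by exact_mod_cast hq3
  have key : ∀ r c, r ≠ 0 → q * f r c + (∑ r', s r' - s r) = Psi (-(c / r)) := by
    intro r c hr
    have e1 : ∑ j, ∑ r', f r' (c + r * j - r' * j) = Psi (-(c/r)) := by
      rw [Finset.sum_eq_single (-(c/r))]
      · apply Finset.sum_congr rfl
        intro r' _
        congr 1
        field_simp
        ring
      · intro j _ hj
        apply h
        intro h'
        apply hj
        field_simp
        linear_combination h'
      · simp
    have e4 := Finset.add_sum_erase univ s (mem_univ r)
    have e5 := Finset.add_sum_erase univ (fun r' => ∑ j, f r' (c + r * j - r' * j)) (mem_univ r)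
    rw [Finset.sum_comm, ← e5] at e1
    rw [← e1, ← e4]
    have e2 : ∑ j, f r (c + r * j - r * j) = q * f r c := by
      simp [hcardq]
    rw [e2]
    have e3 : ∀ r' ∈ univ.erase r, ∑ j, f r' (c + r * j - r' * j) = s r' := by
      intro r' hr'
      have hne : r - r' ≠ 0 := sub_ne_zero.2 (ne_of_mem_erase hr').symm
      rw [hs]
      apply Fintype.sum_bijective (fun j => c + r * j - r' * j)
      · apply Function.Injective.bijective_of_finite
        intro a b hab
        simp only at hab
        apply mul_left_cancel₀ hne
        linear_combination hab
      · intro j; rfl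
    rw [Finset.sum_congr rfl e3]
    ring
  have hT : ∀ r, r ≠ 0 → s r = ∑ r', s r' := by
    intro r hr
    have := key r 0 hr
    rw [h1, zero_div, neg_zero] at this
    have h2 : Psi 0 = 0 := by simp [hPsi, h1]
    rw [h2] at this
    linarith
  have hs0 : s 0 = 0 := by simp [hs, h0]
  have cerase : ((univ.erase (0 : ZMod q)).card : ℚ) = q - 1 := by
    rw [card_erase_of_mem (mem_univ _), card_univ, ZMod.card, Nat.cast_sub (by omega)]; simp
  have hT0 : ∑ r', s r' = 0 := by
    have e : ∑ r', s r' = (q - 1) * ∑ r', s r' := by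
      conv_lhs => rw [← Finset.add_sum_erase _ _ (mem_univ (0 : ZMod q)), hs0, zero_add]
      rw [Finset.sum_congr rfl (fun r hr => hT r (ne_of_mem_erase hr)), Finset.sum_const, nsmul_eq_mul, cerase]
    have : ((q:ℚ) - 2) * ∑ r', s r' = 0 := by linarith
    rcases mul_eq_zero.1 this with h | h
    · linarith
    · exact h
  have k2 : ∀ r b, r ≠ 0 → q * f r (-(r * b)) = Psi b := by
    intro r b hr
    have := key r (-(r*b)) hr
    rw [hT r hr, sub_self, add_zero] at this
    rw [this]
    congr 1
    field_simp
  have hP0 : ∀ b, Psi b = 0 := by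
    intro b
    have e : q * Psi b = (q - 1) * Psi b := by
      conv_lhs => rw [hPsi]
      simp only
      rw [← Finset.add_sum_erase _ _ (mem_univ (0 : ZMod q)), h0, zero_add, Finset.mul_sum,
        Finset.sum_congr rfl (fun r hr => k2 r b (ne_of_mem_erase hr)), Finset.sum_const, nsmul_eq_mul, cerase]
    linarith
  by_cases hr : r = 0
  · rw [hr, h0]
  · have := k2 r (-(c/r)) hr
    rw [hP0] at this
    have e : -(r * -(c/r)) = c := by field_simp
    rw [e] at this
    rcases mul_eq_zero.1 this with h | h
    · linarith
    · exact h

section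
variable {G : Type u} [AddCommGroup G] [Fintype G] [IsAddCyclic G]

/-- hypothesis and conclusion for SEP -/
def SepH (q : ℕ) (K : Finset ℕ) (D : G → G → Prop) (w : G → ℚ) : Prop :=
  ∀ u b, D u b → u ∉ mul G q → ∑ k ∈ K, w (u - k • b) = 0

theorem sep_base {q : ℕ} (hq : q.Prime) (hq3 : 3 ≤ q) {a n' : ℕ} (ha : 1 ≤ a) (hn : Nat.card G = q ^ a * n') (hn' : ¬ q ∣ n')
    (K : Finset ℕ) (hK : ∀ k ∈ K, ¬ q ∣ k) (D : G → G → Prop)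
    (hDu : ∀ u b t, t ∈ tor G (q ^ a) → D u b → D (u + t) b) (hDb : ∀ u b t, t ∈ tor G (q ^ a) → D u b → D u (b + t))
    (w : G → ℚ) (hw : ∀ y ∈ mul G q, w y = 0) (hinv : ∀ t ∈ tor G (q ^ (a - 1)), ∀ y, w (y + t) = w y)
    (h : SepH q K D w) (rho : ℕ) : SepH q (K.filter (fun k => k ≡ rho [MOD q])) D w := by
  haveI : Fact q.Prime := ⟨hq⟩
  obtain ⟨x, hx⟩ := exists_gen (G := G)
  set g : G := n' • x with hg
  have hqn : q ∣ Nat.card G := by rw [hn]; exact (dvd_pow_self q (by omega)).mul_right _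
  have hgt : g ∈ tor G (q ^ a) := by
    rw [mem_tor, hg, ← mul_smul, ← hn, card_nsmul_eq_zero']
  have hgq : q • g ∈ tor G (q ^ (a-1)) := by
    rw [mem_tor, ← mul_smul, ← pow_succ, Nat.sub_add_cancel ha]; exact hgt
  have hmulq : ∀ j : ℤ, (q:ℤ) ∣ j → j • x ∈ mul G q := by
    rintro _ ⟨c, rfl⟩
    rw [mul_smul, natCast_zsmul]; exact nsmul_mem_mul _ _
  have hmulq' : ∀ j : ℤ, j • x ∈ mul G q → (q:ℤ) ∣ j := by
    rintro j ⟨y, hy⟩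
    obtain ⟨c, rfl⟩ := hx.exists_nsmul y
    simp only [nsmulAddMonoidHom_apply] at hy
    have : (j - q * c) • x = 0 := by
      rw [sub_smul, ← hy, mul_smul, natCast_zsmul, natCast_zsmul, sub_self]
    have h2 := (Int.natCast_dvd_natCast.2 hqn).trans (SR.gen_zsmul hx this)
    have := dvd_add h2 (dvd_mul_right (q:ℤ) c)
    simpa using this
  have hdec : ∀ u : G, ∃ i : ℤ, u - i • g ∈ mul G q := by
    intro u
    obtain ⟨j, rfl⟩ := hx.exists_nsmul u
    have hc : IsCoprime (n':ℤ) (q:ℤ) := by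
      rw [Nat.isCoprime_iff_coprime]
      exact ((Nat.Prime.coprime_iff_not_dvd hq).2 hn').symm
    obtain ⟨c, d, hcd⟩ := hc
    refine ⟨j * c, ?_⟩
    have : j • x - ((j:ℤ) * c) • g = ((j:ℤ) * (d * q)) • x := by
      rw [hg, ← natCast_zsmul, ← natCast_zsmul x n', ← mul_smul, ← sub_smul]
      congr 1
      linear_combination (-(j:ℤ)) * hcd
    rw [this]
    exact hmulq _ ⟨j * d, by ring⟩
  have hgi : ∀ i : ℤ, ∀ u0 ∈ mul G q, u0 + i • g ∈ mul G q → (q:ℤ) ∣ i := by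
    intro i u0 hu0 h1
    have h2 := (mul G q).sub_mem h1 hu0
    rw [add_sub_cancel_left, hg, ← natCast_zsmul, ← mul_smul] at h2
    have h3 := hmulq' _ h2
    rcases Int.Prime.dvd_mul' hq h3 with h | h
    · exact h
    · exact absurd (Int.natCast_dvd_natCast.1 h) hn'
  have hper : ∀ (e e' : ℤ) (y : G), (e : ZMod q) = (e' : ZMod q) → w (y + e • g) = w (y + e' • g) := by
    intro e e' y he
    rw [ZMod.intCast_eq_intCast_iff_dvd_sub] at he
    obtain ⟨c, hc⟩ := he
    have : y + e' • g = (y + e • g) + c • q • g := by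
      rw [show e' = e + q * c by linarith, add_smul, mul_comm, mul_smul, natCast_zsmul]; abel
    rw [this, hinv _ (AddSubgroup.zsmul_mem _ hgq c)]
  intro u b hD hu
  obtain ⟨i0, hi0⟩ := hdec u
  obtain ⟨j0, hj0⟩ := hdec b
  set u0 := u - i0 • g with hu0
  set b0 := b - j0 • g with hb0
  set f : ZMod q → ZMod q → ℚ := fun r c => ∑ k ∈ K.filter (fun k : ℕ => (k : ZMod q) = r), w (u0 - k • b0 + (c.val : ℤ) • g) with hf
  have hfe : ∀ (r : ZMod q) (i j : ℤ), ∑ k ∈ K.filter (fun k : ℕ => (k : ZMod q) = r), w ((u0 + i • g) - k • (b0 + j • g)) = f r (i - r * j) := by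
    intro r i j
    rw [hf]
    apply Finset.sum_congr rfl
    intro k hk
    rw [mem_filter] at hk
    have : (u0 + i • g) - k • (b0 + j • g) = (u0 - k • b0) + (i - k * j) • g := by
      rw [smul_add, sub_smul, mul_smul, natCast_zsmul]; abel
    rw [this]
    apply hper
    rw [← hk.2]
    push_cast
    simp
  have hzero : ∀ r c, f r c = 0 := by
    intro r c
    apply line_lemma hq3 f
    · intro c
      rw [hf]
      simp only
      rw [Finset.filter_false_of_mem, Finset.sum_empty]
      intro k hk hc
      rw [ZMod.natCast_eq_zero_iff] at hc
      exact hK k hk hc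
    · intro r
      apply Finset.sum_eq_zero
      intro k _
      apply hw
      simp only [ZMod.val_zero, Nat.cast_zero, zero_smul, add_zero]
      exact (mul G q).sub_mem hi0 ((mul G q).nsmul_mem hj0 k)
    · intro i j hi
      have e : ∀ r, f r (i - r * j) = ∑ k ∈ K.filter (fun k : ℕ => (k : ZMod q) = r), w ((u0 + (i.val : ℤ) • g) - k • (b0 + (j.val : ℤ) • g)) := by
        intro r
        rw [hfe]; simp
      rw [Finset.sum_congr rfl (fun r _ => e r), Finset.sum_fiberwise]
      apply h
      · have e1 : u0 + (i.val : ℤ) • g = u + ((i.val : ℤ) - i0) • g := by rw [hu0, sub_smul]; abel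
        have e2 : b0 + (j.val : ℤ) • g = b + ((j.val : ℤ) - j0) • g := by rw [hb0, sub_smul]; abel
        rw [e1, e2]
        exact hDb _ _ _ (AddSubgroup.zsmul_mem _ hgt _) (hDu _ _ _ (AddSubgroup.zsmul_mem _ hgt _) hD)
      · intro hc
        have := hgi _ _ hi0 hc
        rw [← ZMod.intCast_zmod_eq_zero_iff_dvd] at this
        simp at this
        exact hi this
  have := hfe rho i0 j0
  rw [hzero] at this
  rw [← this]
  have e1 : u0 + i0 • g = u := by rw [hu0]; abel
  have e2 : b0 + j0 • g = b := by rw [hb0]; abel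
  rw [e1, e2]
  congr 1
  ext k
  simp only [mem_filter, ZMod.natCast_eq_natCast_iff]

theorem sep {q : ℕ} (hq : q.Prime) (hq3 : 3 ≤ q) {a n' : ℕ} (ha : 1 ≤ a) (hn : Nat.card G = q ^ a * n') (hn' : ¬ q ∣ n')
    (K : Finset ℕ) (hK : ∀ k ∈ K, ¬ q ∣ k) (D : G → G → Prop)
    (hDu : ∀ u b t, t ∈ tor G (q ^ a) → D u b → D (u + t) b) (hDb : ∀ u b t, t ∈ tor G (q ^ a) → D u b → D u (b + t))
    (rho : ℕ) (j : ℕ) (hj : j ≤ a - 1)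
    (w : G → ℚ) (hw : ∀ y ∈ mul G q, w y = 0) (hinv : ∀ t ∈ tor G (q ^ (a - 1 - j)), ∀ y, w (y + t) = w y)
    (h : SepH q K D w) : SepH q (K.filter (fun k => k ≡ rho [MOD q])) D w := by
  induction j generalizing w with
  | zero => exact sep_base hq hq3 ha hn hn' K hK D hDu hDb w hw hinv h rho
  | succ j ih =>
  set m := a - 1 - (j + 1) with hm
  have hm1 : a - 1 - j = m + 1 := by omega
  rw [hm1] at ih
  set A : Finset G := univ.filter (fun t => t ∈ tor G (q ^ (m+1))) with hA
  have hmem : ∀ t, t ∈ A ↔ t ∈ tor G (q ^ (m+1)) := by intro t; simp [hA]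
  have hApos : (0:ℚ) < #A := by
    rw [Nat.cast_pos, Finset.card_pos]
    exact ⟨0, (hmem 0).2 (zero_mem _)⟩
  have hAa : ∀ t ∈ tor G (q ^ (m+1)), t ∈ tor G (q ^ a) := by
    intro t ht
    rw [mem_tor_ord] at ht ⊢
    exact ht.trans (pow_dvd_pow q (by omega))
  have hqa : q * q ^ (a-1) = q ^ a := by rw [← pow_succ', Nat.sub_add_cancel ha]
  have hqn : q ∣ Nat.card G := by rw [hn]; exact (dvd_pow_self q (by omega)).mul_right _
  have hcq : Nat.card G / q = q ^ (a-1) * n' := by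
    rw [hn, ← hqa, mul_assoc, Nat.mul_div_cancel_left _ hq.pos]
  have hAq : ∀ t ∈ tor G (q ^ (m+1)), t ∈ mul G q := by
    intro t ht
    rw [mem_mul_iff hqn, hcq]
    rw [mem_tor_ord] at ht
    exact (ht.trans (pow_dvd_pow q (by omega))).mul_right _
  have hshift : ∀ t ∈ tor G (q ^ (m+1)), ∀ f : G → ℚ, ∑ s ∈ A, f (s + t) = ∑ s ∈ A, f s := by
    intro t ht f
    apply Finset.sum_nbij (fun s => s + t)
    · intro s hs; rw [hmem] at hs ⊢; exact add_mem hs ht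
    · intro a _ b _ hab; simpa using hab
    · intro s hs
      refine ⟨s - t, ?_, by simp⟩
      have hs' := (hmem s).1 hs
      exact (hmem _).2 (sub_mem hs' ht)
    · intro s _; rfl
  set w1 : G → ℚ := fun y => ∑ s ∈ A, w (y + s) with hw1
  have hw1z : ∀ y ∈ mul G q, w1 y = 0 := by
    intro y hy
    apply Finset.sum_eq_zero
    intro s hs
    exact hw _ (add_mem hy (hAq s ((hmem s).1 hs)))
  have hH1 : SepH q K D w1 := by
    intro u b hD hu
    simp only [hw1]
    rw [Finset.sum_comm]
    apply Finset.sum_eq_zero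
    intro s hs
    have hs' := (hmem s).1 hs
    have := h (u + s) b (hDu _ _ _ (hAa s hs') hD) (fun hc => hu (by have := sub_mem hc (hAq s hs'); simpa using this))
    rw [← this]
    apply Finset.sum_congr rfl
    intro k _
    congr 1; abel
  have hinv1 : ∀ t ∈ tor G (q ^ (m+1)), ∀ y, w1 (y + t) = w1 y := by
    intro t ht y
    rw [hw1]
    simp only
    rw [← hshift t ht (fun s => w (y + s))]
    apply Finset.sum_congr rfl
    intro s _
    congr 1; abel
  have hc1 := ih (by omega) w1 hw1z hinv1 hH1
  set w2 : G → ℚ := fun y => #A * w y - w1 y with hw2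
  have hH2 : SepH q K D w2 := by
    intro u b hD hu
    simp only [hw2]
    rw [Finset.sum_sub_distrib, ← Finset.mul_sum, h u b hD hu, hH1 u b hD hu]; simp
  have hinv2 : ∀ t ∈ tor G (q ^ m), ∀ y, w2 (y + t) = w2 y := by
    intro t ht y
    have : t ∈ tor G (q ^ (m+1)) := by
      rw [mem_tor_ord] at ht ⊢
      exact ht.trans (pow_dvd_pow q (by omega))
    simp only [hw2]
    rw [hinv t ht, hinv1 t this]
  have hz2 : ∀ y, ∑ s ∈ A, w2 (y + s) = 0 := by
    intro y
    simp only [hw2]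
    rw [Finset.sum_sub_distrib, ← Finset.mul_sum, Finset.sum_congr rfl (fun s hs => hinv1 s ((hmem s).1 hs) y), Finset.sum_const, nsmul_eq_mul]
    simp [hw1]
  intro u b hD hu
  have hc2 : ∑ k ∈ K.filter (fun k => k ≡ rho [MOD q]), w2 (u - k • b) = 0 := by
    have e1 : ∑ s ∈ A, ∑ k ∈ K, w2 ((u + rho • s) - k • (b + s)) = 0 := by
      apply Finset.sum_eq_zero
      intro s hs
      have hs' := (hmem s).1 hs
      have hrs : rho • s ∈ tor G (q ^ (m+1)) := AddSubgroup.nsmul_mem _ hs' _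
      apply hH2
      · exact hDb _ _ _ (hAa _ hs') (hDu _ _ _ (hAa _ hrs) hD)
      · intro hc; exact hu (by have := sub_mem hc (hAq _ hrs); simpa using this)
    rw [Finset.sum_comm] at e1
    have e2 : ∀ k ∈ K, ∑ s ∈ A, w2 ((u + rho • s) - k • (b + s)) = if k ≡ rho [MOD q] then #A * w2 (u - k • b) else 0 := by
      intro k _
      have e3 : ∀ s : G, (u + rho • s) - k • (b + s) = (u - k • b) + ((rho : ℤ) - k) • s := by
        intro s
        rw [smul_add, sub_smul, natCast_zsmul, natCast_zsmul]; abel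
      simp only [e3]
      split_ifs with hk
      · have : ∀ s ∈ A, w2 ((u - k • b) + ((rho : ℤ) - k) • s) = w2 (u - k • b) := by
          intro s hs
          apply hinv2
          obtain ⟨c, hc⟩ := Nat.modEq_iff_dvd.1 hk
          rw [hc, mul_comm, mul_smul, natCast_zsmul]
          apply AddSubgroup.zsmul_mem
          rw [mem_tor, ← mul_smul, ← pow_succ]
          exact (hmem s).1 hs
        rw [Finset.sum_congr rfl this, Finset.sum_const, nsmul_eq_mul]
      · rw [← hz2 (u - k • b)]
        have hcop : IsCoprime ((rho:ℤ) - k) ((q ^ (m+1) : ℕ) : ℤ) := by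
          push_cast
          apply IsCoprime.pow_right
          apply IsCoprime.symm
          rw [Prime.coprime_iff_not_dvd (Nat.prime_iff_prime_int.1 hq)]
          intro hd; exact hk (Nat.modEq_iff_dvd.2 hd)
        obtain ⟨c, d, hcd⟩ := hcop
        have hinvs : ∀ s ∈ tor G (q ^ (m+1)), c • ((rho:ℤ) - k) • s = s := by
          intro s hs
          rw [← mul_smul]
          have : c * ((rho:ℤ) - k) = 1 - d * ((q ^ (m+1) : ℕ) : ℤ) := by linarith
          rw [this, sub_smul, one_zsmul, mul_smul, natCast_zsmul, mem_tor.1 hs]; simp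
        apply Finset.sum_nbij (fun s => ((rho:ℤ) - k) • s)
        · intro s hs; rw [hmem] at hs ⊢; exact AddSubgroup.zsmul_mem _ hs _
        · intro s hs t ht hst
          simp only at hst
          have := congrArg (fun y => c • y) hst
          rwa [hinvs s ((hmem s).1 hs), hinvs t ((hmem t).1 ht)] at this
        · intro s hs
          have hs' := (hmem s).1 hs
          refine ⟨c • s, (hmem _).2 (AddSubgroup.zsmul_mem _ hs' _), ?_⟩
          simp only
          rw [smul_comm, hinvs s hs']
        · intro s _; rfl
    rw [Finset.sum_congr rfl e2, ← Finset.sum_filter, ← Finset.mul_sum] at e1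
    rcases mul_eq_zero.1 e1 with h | h
    · exact absurd h hApos.ne'
    · exact h
  have := hc1 u b hD hu
  simp only [hw2] at hc2
  rw [Finset.sum_sub_distrib, this, sub_zero, ← Finset.mul_sum] at hc2
  rcases mul_eq_zero.1 hc2 with h | h
  · exact absurd h hApos.ne'
  · exact h

theorem sep' {q : ℕ} (hq : q.Prime) (hq3 : 3 ≤ q) (hqn : q ∣ Nat.card G)
    (K : Finset ℕ) (hK : ∀ k ∈ K, ¬ q ∣ k) (D : G → G → Prop)
    (hDu : ∀ u b t a, t ∈ tor G (q ^ a) → D u b → D (u + t) b) (hDb : ∀ u b t a, t ∈ tor G (q ^ a) → D u b → D u (b + t))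
    (w : G → ℚ) (hw : ∀ y ∈ mul G q, w y = 0) (h : SepH q K D w) (rho : ℕ) :
    SepH q (K.filter (fun k => k ≡ rho [MOD q])) D w := by
  obtain ⟨a, n', hn', hn⟩ := Nat.exists_eq_pow_mul_and_not_dvd (ncard_ne (G := G)) q hq.ne_one
  have ha : 1 ≤ a := by
    rcases Nat.eq_zero_or_pos a with h | h
    · subst h; rw [pow_zero, one_mul] at hn; rw [hn] at hqn; exact absurd hqn hn'
    · exact h
  apply sep hq hq3 ha hn hn' K hK D (fun u b t ht => hDu u b t a ht) (fun u b t ht => hDb u b t a ht) rho (a-1) le_rfl w hw ?_ h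
  intro t ht y
  rw [Nat.sub_self, pow_zero, mem_tor, one_smul] at ht
  rw [ht, add_zero]

end
end SRP

namespace SRP
open Classical Finset
open scoped Pointwise
universe u
set_option linter.all false
set_option linter.deprecated false

section
variable {G : Type u} [AddCommGroup G] [Fintype G] [IsAddCyclic G]

theorem coprime_of_gen {x : G} {k : ℕ} (h : IsGen (k • x)) (hx : IsGen x) : k.Coprime (Nat.card G) := by
  have h1 : addOrderOf (k • x) = Nat.card G := h
  rw [addOrderOf_nsmul, hx] at h1
  have h2 := Nat.div_mul_cancel (Nat.gcd_dvd_left (Nat.card G) k)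
  rw [h1] at h2
  have h3 := Nat.pos_of_ne_zero (ncard_ne (G := G))
  have : Nat.gcd (Nat.card G) k = 1 := by
    apply Nat.eq_of_mul_eq_mul_left h3
    rw [h2, mul_one]
  exact (Nat.coprime_comm).1 this

theorem gen_mul_iff {p : ℕ} (hpn : p ∣ Nat.card G) {x : G} (hx : IsGen x) (j : ℤ) : j • x ∈ mul G p ↔ (p:ℤ) ∣ j := by
  constructor
  · rintro ⟨y, hy⟩
    obtain ⟨c, rfl⟩ := hx.exists_nsmul y
    simp only [nsmulAddMonoidHom_apply] at hy
    have : (j - p * c) • x = 0 := by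
      rw [sub_smul, ← hy, mul_smul, natCast_zsmul, natCast_zsmul, sub_self]
    have h2 := (Int.natCast_dvd_natCast.2 hpn).trans (SR.gen_zsmul hx this)
    have := dvd_add h2 (dvd_mul_right (p:ℤ) c)
    simpa using this
  · rintro ⟨c, rfl⟩
    rw [mul_smul, natCast_zsmul]; exact nsmul_mem_mul _ _

theorem gen_mul_iff' {p : ℕ} (hpn : p ∣ Nat.card G) {x : G} (hx : IsGen x) (j : ℕ) : j • x ∈ mul G p ↔ p ∣ j := by
  rw [← natCast_zsmul, gen_mul_iff hpn hx, Int.natCast_dvd_natCast]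

theorem tor_pow_le_mul {p q a : ℕ} (hp : p.Prime) (hq : q.Prime) (hpq : p ≠ q) (hpn : p ∣ Nat.card G) {t : G} (ht : t ∈ tor G (q ^ a)) :
    t ∈ mul G p := by
  rw [mem_mul_iff hpn]
  rw [mem_tor_ord] at ht
  have hc : (addOrderOf t).Coprime p := by
    apply Nat.Coprime.of_dvd_left ht
    exact Nat.Coprime.pow_left _ ((Nat.coprime_primes hq hp).2 hpq.symm)
  apply hc.dvd_of_dvd_mul_left
  rw [Nat.mul_div_cancel' hpn]
  exact ord_dvd t

theorem prime_zsmul_mem {p : ℕ} (hp : p.Prime) (hpn : p ∣ Nat.card G) {b : G} (hb : b ∉ mul G p) {j : ℤ} (h : j • b ∈ mul G p) : (p:ℤ) ∣ j := by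
  obtain ⟨x, hx⟩ := exists_gen (G := G)
  obtain ⟨m, rfl⟩ := hx.exists_nsmul b
  rw [gen_mul_iff' hpn hx] at hb
  rw [← natCast_zsmul, ← mul_smul, gen_mul_iff hpn hx] at h
  rcases Int.Prime.dvd_mul' hp h with h | h
  · exact h
  · exact absurd (Int.natCast_dvd_natCast.1 h) hb
end

namespace SR
variable {G : Type u} [AddCommGroup G] [Fintype G] {S : SR G}

/-- the zero principle -/
def ZP (S : SR G) : Prop := ∀ w : G → ℚ,
  (∀ D : AddSubgroup G, S.Sat (D : Set G) → ∀ x y, w x ≠ 0 → w y ≠ 0 → x ∈ D → y ∈ D) →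
  (∀ g : G → ℚ, S.Meas g → ∀ u, (∃ v, IsGen v ∧ S.r v u) → ∑ b, w b * g (u - b) = 0) → ∀ b, w b = 0

variable [IsAddCyclic G]

theorem Cyc.zp (hodd : Odd (Nat.card G)) {x : G} (hx : S.Cyc x) : S.ZP := by
  intro w hw1 hw2 y0
  by_contra hy0
  have hw1' : ∀ D : AddSubgroup G, ∀ x y, w x ≠ 0 → w y ≠ 0 → x ∈ D → y ∈ D := fun D => hw1 D (hx.sat_sub hodd D)
  set Pi : Finset ℕ := (Nat.card G).primeFactors.filter (fun q => y0 ∉ mul G q) with hPi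
  have hPim : ∀ q, q ∈ Pi ↔ (q.Prime ∧ q ∣ Nat.card G) ∧ y0 ∉ mul G q := by
    intro q
    rw [hPi, mem_filter, Nat.mem_primeFactors]
    have := ncard_ne (G := G)
    tauto
  have hwPi : ∀ q ∈ Pi, ∀ y ∈ mul G q, w y = 0 := by
    intro q hq y hy
    by_contra hc
    exact ((hPim q).1 hq).2 (hw1' _ y y0 hc hy0 hy)
  set Del : G → G → Prop := fun u b => ∀ p : ℕ, p.Prime → p ∣ Nat.card G → y0 ∈ mul G p → b ∉ mul G p ∧ u - b ∈ mul G p with hDel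
  have hKc : ∀ k ∈ S.KK x, k.Coprime (Nat.card G) := by
    intro k hk
    simp only [KK, mem_filter] at hk
    exact coprime_of_gen (hx.gen hk.2) hx.1
  have main : ∀ E : Finset ℕ, E ⊆ Pi → ∀ u b, Del u b → (∀ q ∈ Pi, u ∉ mul G q) →
      ∑ k ∈ (S.KK x).filter (fun k => ∀ q ∈ E, k ≡ 1 [MOD q]), w (u - k • b) = 0 := by
    intro E
    induction E using Finset.induction_on with
    | empty =>
      intro _ u b hD hu
      have hug : IsGen u := by
        rw [isGen_iff_prime]
        intro p hp hpn hup
        by_cases h : y0 ∈ mul G p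
        · obtain ⟨h1, h2⟩ := hD p hp hpn h
          apply h1
          have := sub_mem hup h2
          simpa using this
        · exact hu p ((hPim p).2 ⟨⟨hp, hpn⟩, h⟩) hup
      have := hx.sum_zero hodd (w := w) (u := u) (fun g hg => hw2 g hg u ⟨u, hug, S.rfl' u⟩) b
      simpa using this
    | insert q E hqE ih =>
      intro hE u b hD hu
      have hqPi : q ∈ Pi := hE (mem_insert_self _ _)
      obtain ⟨⟨hq, hqn⟩, hyq⟩ := (hPim q).1 hqPi
      have hq3 : 3 ≤ q := by
        have h2 := hq.two_le
        rcases (hodd.of_dvd_nat hqn) with ⟨c, hc⟩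
        omega
      have h1 := ih (fun a ha => hE (mem_insert_of_mem ha))
      have h2 := sep' hq hq3 hqn ((S.KK x).filter (fun k => ∀ q ∈ E, k ≡ 1 [MOD q]))
        (fun k hk hd => by
          have := hKc k (mem_filter.1 hk).1
          exact hq.one_lt.ne' (Nat.eq_one_of_dvd_coprimes this hd hqn))
        (fun u b => Del u b ∧ ∀ q' ∈ Pi, q' ≠ q → u ∉ mul G q')
        (by
          rintro u b t a ht ⟨hd, hq'⟩
          constructor
          · intro p hp hpn hyp
            have hpq : p ≠ q := by rintro rfl; exact hyq hyp
            obtain ⟨e1, e2⟩ := hd p hp hpn hyp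
            refine ⟨e1, ?_⟩
            have := add_mem e2 (tor_pow_le_mul hp hq hpq hpn ht)
            have e : u + t - b = u - b + t := by abel
            rw [e]; exact this
          · intro q' hq'Pi hne hc
            apply hq' q' hq'Pi hne
            obtain ⟨⟨hp, hpn⟩, -⟩ := (hPim q').1 hq'Pi
            have := sub_mem hc (tor_pow_le_mul hp hq hne hpn ht)
            simpa using this)
        (by
          rintro u b t a ht ⟨hd, hq'⟩
          refine ⟨?_, hq'⟩
          intro p hp hpn hyp
          have hpq : p ≠ q := by rintro rfl; exact hyq hyp
          obtain ⟨e1, e2⟩ := hd p hp hpn hyp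
          have e3 := tor_pow_le_mul hp hq hpq hpn ht
          constructor
          · intro hc; apply e1; have := sub_mem hc e3; simpa using this
          · have := sub_mem e2 e3
            have e : u - (b + t) = u - b - t := by abel
            rw [e]; exact this)
        w (hwPi q hqPi)
        (by
          rintro u b ⟨hd, hq'⟩ huq
          apply h1 u b hd
          intro q' hq'Pi
          by_cases h : q' = q
          · rw [h]; exact huq
          · exact hq' q' hq'Pi h) 1
      have h3 := h2 u b ⟨hD, fun q' h _ => hu q' h⟩ (hu q hqPi)
      rw [Finset.filter_filter] at h3
      rw [← h3]
      apply Finset.sum_congr _ (fun _ _ => rfl)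
      ext k
      simp only [mem_filter, mem_insert, forall_eq_or_imp]
      tauto
  set b : G := (∏ q ∈ Pi, q) • x with hb
  have hbP : ∀ q ∈ Pi, b ∈ mul G q := by
    intro q hq
    rw [hb, gen_mul_iff' ((hPim q).1 hq).1.2 hx.1]
    exact Finset.dvd_prod_of_mem _ hq
  have hDb : Del (y0 + b) b := by
    intro p hp hpn hyp
    constructor
    · rw [hb, gen_mul_iff' hpn hx.1]
      intro hd
      obtain ⟨q, hq, hpq⟩ := (Prime.dvd_finset_prod_iff (Nat.prime_iff.1 hp) _).1 hd
      have := (Nat.prime_dvd_prime_iff_eq hp ((hPim q).1 hq).1.1).1 hpq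
      subst this
      exact ((hPim p).1 hq).2 hyp
    · simpa using hyp
  have hfin := main Pi subset_rfl (y0 + b) b hDb (by
    intro q hq hc
    apply ((hPim q).1 hq).2
    have := sub_mem hc (hbP q hq)
    simpa using this)
  have hn0 := Nat.pos_of_ne_zero (ncard_ne (G := G))
  have h1b : ∀ y : G, (1 % Nat.card G) • y = y := by
    intro y
    rw [nsmul_congr ((Nat.mod_modEq 1 _).of_dvd (ord_dvd y)), one_smul]
  rw [Finset.sum_eq_single (1 % Nat.card G)] at hfin
  · rw [h1b] at hfin
    simp at hfin
    exact hy0 hfin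
  · intro k hk hne
    by_contra hc
    rw [mem_filter] at hk
    obtain ⟨hk1, hk2⟩ := hk
    have hkc := hKc k hk1
    simp only [KK, mem_filter, mem_range] at hk1
    have := PA hodd hx.1 hx.2 hkc hk1.2 (by
      intro p hp hpn
      by_cases h : y0 ∈ mul G p
      · have h2 := hw1' _ _ _ hy0 hc h
        have h3 : (1 - (k:ℤ)) • b ∈ mul G p := by
          rw [sub_smul, one_zsmul, natCast_zsmul]
          have := sub_mem h2 h
          have e : y0 + b - k • b - y0 = b - k • b := by abel
          rwa [e] at this
        have := prime_zsmul_mem hp hpn (hDb p hp hpn h).1 h3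
        exact Nat.modEq_iff_dvd.2 (by exact_mod_cast this)
      · exact hk2 p ((hPim p).2 ⟨⟨hp, hpn⟩, h⟩))
    apply hne
    exact (Nat.mod_eq_of_lt hk1.1).symm.trans this
  · intro hc
    exfalso
    apply hc
    rw [mem_filter]
    constructor
    · simp only [KK, mem_filter, mem_range]
      refine ⟨Nat.mod_lt _ hn0, ?_⟩
      rw [h1b]
    · intro q hq
      exact (Nat.mod_modEq 1 _).of_dvd ((hPim q).1 hq).1.2

/-- conclusion of the free theorem -/
structure FC (S : SR G) (x : G) : Prop where
  zp : S.ZP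
  c2 : ∀ p : ℕ, p.Prime → p * p ∣ Nat.card G → ¬ S.Full p x → ∀ t ∈ tor G p, t ≠ 0 →
    ∀ v : G, (∀ q : ℕ, q.Prime → q ∣ addOrderOf v → q < p) → ¬ S.r x (x + t + v)
  gp : ∀ p a : ℕ, p.Prime → p ∣ Nat.card G → p ^ a ∣ Nat.card G → ¬ p ^ (a + 1) ∣ Nat.card G → ¬ S.Full p x →
    S.Sat (tor G (p ^ a) : Set G)
  gp' : ∀ p a m : ℕ, p.Prime → p ∣ Nat.card G → Nat.card G = p ^ a * m → ¬ p ∣ m → ¬ S.Full p x → S.Sat (tor G m : Set G)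
  R : ∀ y, AddSubgroup.closure (S.cls y) = ⊤ → ∃ z, S.r y z ∧ IsGen z

theorem exists_split (p n : ℕ) (hn : n ≠ 0) : ∃ n1 n2, n = n1 * n2 ∧ (∀ q : ℕ, q.Prime → q ∣ n1 → q < p) ∧ (∀ q : ℕ, q.Prime → q ∣ n2 → p ≤ q) := by
  induction n using induction_on_primes with
  | zero => exact absurd rfl hn
  | one => exact ⟨1, 1, rfl, fun q hq h => absurd (Nat.dvd_one.1 h) hq.ne_one, fun q hq h => absurd (Nat.dvd_one.1 h) hq.ne_one⟩
  | prime_mul r a hr ih =>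
    obtain ⟨n1, n2, h, h1, h2⟩ := ih (right_ne_zero_of_mul hn)
    by_cases hrp : r < p
    · refine ⟨r * n1, n2, by rw [h]; ring, fun q hq hd => ?_, h2⟩
      rcases (Nat.Prime.dvd_mul hq).1 hd with h | h
      · rw [(Nat.prime_dvd_prime_iff_eq hq hr).1 h]; exact hrp
      · exact h1 q hq h
    · refine ⟨n1, r * n2, by rw [h]; ring, h1, fun q hq hd => ?_⟩
      rcases (Nat.Prime.dvd_mul hq).1 hd with h | h
      · rw [(Nat.prime_dvd_prime_iff_eq hq hr).1 h]; exact not_lt.1 hrp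
      · exact h2 q hq h

theorem not_dvd_totient {p n : ℕ} (hn : n ≠ 0) (hp : p.Prime) (h : ∀ q : ℕ, q.Prime → q ∣ n → q < p) : ¬ p ∣ Nat.totient n := by
  intro hd
  have h1 := Nat.totient_mul_prod_primeFactors n
  have h2 : p ∣ n * ∏ q ∈ n.primeFactors, (q - 1) := h1 ▸ hd.mul_right _
  rcases (Nat.Prime.dvd_mul hp).1 h2 with h3 | h3
  · exact lt_irrefl _ (h p hp h3)
  · obtain ⟨q, hq, hpq⟩ := (Prime.dvd_finset_prod_iff (Nat.prime_iff.1 hp) _).1 h3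
    have hq' := Nat.prime_of_mem_primeFactors hq
    have := Nat.le_of_dvd (by have := hq'.two_le; omega) hpq
    have := h q hq' (Nat.dvd_of_mem_primeFactors hq)
    omega

theorem Cyc.c2 (hodd : Odd (Nat.card G)) {x : G} (hx : S.Cyc x) {p : ℕ} (hp : p.Prime) (hpp : p * p ∣ Nat.card G) {t : G} (ht : t ∈ tor G p)
    (ht0 : t ≠ 0) {v : G} (hv : ∀ q : ℕ, q.Prime → q ∣ addOrderOf v → q < p) : ¬ S.r x (x + t + v) := by
  intro hr
  obtain ⟨k, hk, hkx⟩ := hx.unit hr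
  have hkr : S.r x (k • x) := hkx ▸ hr
  have hpn : p ∣ Nat.card G := (dvd_mul_right p p).trans hpp
  obtain ⟨n1, n2, hn, h1, h2⟩ := exists_split p (Nat.card G) ncard_ne
  have hn1 : n1 ≠ 0 := by rintro rfl; exact ncard_ne (G := G) (by simpa using hn)
  have hn2 : n2 ≠ 0 := by rintro rfl; exact ncard_ne (G := G) (by simpa using hn)
  have hcop : ∀ m : ℕ, (∀ q : ℕ, q.Prime → q ∣ m → q < p) → m.Coprime n2 := by
    intro m hm
    apply Nat.coprime_of_dvd
    intro q hq hqm hq2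
    exact absurd (hm q hq hqm) (not_lt.2 (h2 q hq hq2))
  have hvn1 : n1 • v = 0 := by
    rw [← addOrderOf_dvd_iff_nsmul_eq_zero]
    apply (hcop _ hv).dvd_of_dvd_mul_right
    rw [← hn]; exact ord_dvd v
  have hkx' : k • x - x = t + v := by rw [← hkx]; abel
  have e1 : (n2:ℤ) ∣ p * ((k:ℤ) - 1) := by
    have : ((p * n1 : ℕ) : ℤ) • (k • x - x) = 0 := by
      rw [hkx', natCast_zsmul, smul_add, mul_smul p n1 v, hvn1, mul_comm, mul_smul, mem_tor.1 ht]; simp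
    rw [smul_sub_one] at this
    have h3 := gen_zsmul hx.1 this
    rw [hn] at h3
    push_cast at h3
    rw [show (p:ℤ) * n1 * ((k:ℤ) - 1) = n1 * (p * ((k:ℤ) - 1)) by ring] at h3
    exact (mul_dvd_mul_iff_left (by exact_mod_cast hn1)).1 h3
  have hpc : (p * p).Coprime n1 := by
    have : p.Coprime n1 := by
      rw [Nat.Prime.coprime_iff_not_dvd hp]
      intro h; exact lt_irrefl _ (h1 p hp h)
    exact Nat.Coprime.mul_left this this
  have e2 : (p:ℤ) ∣ (k:ℤ) - 1 := by
    have : p * p ∣ n2 := by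
      apply hpc.dvd_of_dvd_mul_left
      rw [← hn]; exact hpp
    have h3 := (Int.natCast_dvd_natCast.2 this).trans e1
    push_cast at h3
    exact (mul_dvd_mul_iff_left (by exact_mod_cast hp.ne_zero)).1 h3
  set M := Nat.totient n1 with hM
  have hkM : k ^ M ≡ 1 [MOD n1] := by
    apply Nat.ModEq.pow_totient
    apply hk.of_dvd_right
    rw [hn]; exact dvd_mul_right _ _
  have hgs := geom_sum_mul (k:ℤ) M
  have e3 : ((Nat.card G : ℕ) : ℤ) ∣ p * (((k ^ M : ℕ) : ℤ) - 1) := by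
    rw [hn, Nat.cast_mul]
    apply IsCoprime.mul_dvd
    · rw [Nat.isCoprime_iff_coprime]; exact hcop n1 h1
    · exact (Nat.modEq_iff_dvd.1 hkM.symm).mul_left _
    · push_cast
      rw [← hgs, show (p:ℤ) * ((∑ i ∈ range M, (k:ℤ) ^ i) * (k - 1)) = (p * ((k:ℤ) - 1)) * (∑ i ∈ range M, (k:ℤ) ^ i) by ring]
      exact e1.mul_right _
  set t' := (k ^ M) • x - x with ht'
  have ht'P : t' ∈ tor G p := by
    rw [mem_tor, ← natCast_zsmul, ht', smul_sub_one]
    exact zsmul_eq_zero_of_card e3 x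
  have ht'0 : t' ≠ 0 := by
    intro h0
    have e4 : t' = (∑ i ∈ range M, (k:ℤ) ^ i) • (t + v) := by
      rw [← hkx', ht']
      have a1 : (k ^ M) • x - x = (((k:ℤ) ^ M) - 1) • x := by
        rw [sub_smul, one_zsmul, ← natCast_zsmul]; push_cast; rfl
      have a2 : k • x - x = ((k:ℤ) - 1) • x := by rw [sub_smul, one_zsmul, natCast_zsmul]
      rw [a1, a2, ← hgs, mul_smul]
    rw [h0] at e4
    have e5 : ((∑ i ∈ range M, (k:ℤ) ^ i) * n1) • t = 0 := by
      have := congrArg (fun y => (n1 : ℤ) • y) e4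
      simp only [smul_zero] at this
      rw [smul_comm, smul_add, natCast_zsmul, natCast_zsmul, hvn1, add_zero, ← natCast_zsmul, ← mul_smul] at this
      exact this.symm
    rw [← addOrderOf_dvd_iff_zsmul_eq_zero, ord_of_tor hp ht ht0] at e5
    rcases Int.Prime.dvd_mul' hp e5 with h | h
    · have := dvd_sub h (geom_mod e2 M)
      have h5 : (p:ℤ) ∣ M := by simpa using this
      exact not_dvd_totient hn1 hp h1 (Int.natCast_dvd_natCast.1 h5)
    · exact lt_irrefl _ (h1 p hp (Int.natCast_dvd_natCast.1 h))
  apply hx.2 p hp hpn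
  apply full_of_stab hp (hk.pow_left M) (stab_pow hk hkr M) ht'P ht'0 (by rw [ht']; abel)
  have : k ^ M ≡ 1 [MOD p] := by
    have : k ≡ 1 [MOD p] := (Nat.modEq_iff_dvd.2 (by exact_mod_cast e2)).symm
    simpa using this.pow M
  rw [nsmul_congr (this.of_dvd (mem_tor_ord.1 ht'P)), one_smul]

theorem Cyc.fc (hodd : Odd (Nat.card G)) {x : G} (hx : S.Cyc x) : S.FC x where
  zp := hx.zp hodd
  c2 p hp hpp _ t ht ht0 v hv := hx.c2 hodd hp hpp ht ht0 hv
  gp p a _ _ _ _ _ := hx.sat_sub hodd _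
  gp' p a m _ _ _ _ _ := hx.sat_sub hodd _
  R y hy := by
    refine ⟨y, S.rfl' y, ?_⟩
    rw [isGen_iff]
    have : AddSubgroup.closure (S.cls y) ≤ AddSubgroup.zmultiples y := by
      rw [AddSubgroup.closure_le]
      exact (hx.sat_sub hodd (AddSubgroup.zmultiples y)).cls_subset (AddSubgroup.mem_zmultiples y)
    rw [hy] at this
    exact fun z => this (AddSubgroup.mem_top z)

end SR
end SRP

namespace SRP
open Classical Finset
open scoped Pointwise
universe u
set_option linter.all false
set_option linter.deprecated false

section
variable {G : Type u} [AddCommGroup G] [Fintype G]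
theorem sum_coset (V : AddSubgroup G) (a0 : G) (F : G → ℚ) (h : ∀ y, y - a0 ∉ V → F y = 0) : ∑ y, F y = ∑ b : V, F (a0 + b) := by
  symm
  apply Fintype.sum_of_injective (fun b : V => a0 + (b : G))
  · intro a b hab
    simpa using hab
  · intro y hy
    apply h
    intro hc
    apply hy
    exact ⟨⟨y - a0, hc⟩, by simp⟩
  · intro i; rfl
end

namespace SR
variable {G : Type u} [AddCommGroup G] [Fintype G] {S : SR G}
variable [IsAddCyclic G]

structure Tens (S : SR G) (x s w0 : G) (W V : AddSubgroup G) : Prop where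
  hW : S.Sat (W : Set G)
  hV : S.Sat (V : Set G)
  inf : W ⊓ V = ⊥
  sup : W ⊔ V = ⊤
  hs : s ∈ V
  hw0 : w0 ∈ W
  ne : w0 ≠ 0
  hx : IsGen x
  hxs : x = w0 + s
  hr : ∀ y, S.r x y ↔ ∃ w ∈ W, w ≠ 0 ∧ ∃ s', S.r s s' ∧ y = w + s'
  minW : ∀ D : AddSubgroup G, S.Sat (D : Set G) → D ≤ W → D = ⊥ ∨ D = W

theorem direct {W V : AddSubgroup G} (inf : W ⊓ V = ⊥) {w w' v v' : G} (hw : w ∈ W) (hw' : w' ∈ W) (hv : v ∈ V) (hv' : v' ∈ V)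
    (h : w + v = w' + v') : w = w' ∧ v = v' := by
  have h1 : w - w' ∈ W ⊓ V := by
    refine ⟨W.sub_mem hw hw', ?_⟩
    have : w - w' = v' - v := by
      rw [sub_eq_sub_iff_add_eq_add, h]; abel
    rw [this]; exact V.sub_mem hv' hv
  rw [inf, AddSubgroup.mem_bot, sub_eq_zero] at h1
  subst h1
  exact ⟨rfl, by simpa using h⟩

theorem decomp {W V : AddSubgroup G} (sup : W ⊔ V = ⊤) (y : G) : ∃ a ∈ W, ∃ b ∈ V, y = a + b := by
  have : y ∈ W ⊔ V := by rw [sup]; trivial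
  rw [AddSubgroup.mem_sup] at this
  obtain ⟨a, ha, b, hb, h⟩ := this
  exact ⟨a, ha, b, hb, h.symm⟩

theorem exists_tens {p : ℕ} (hp : p.Prime) (hpn : p ∣ Nat.card G) (hodd : Odd (Nat.card G)) {x : G}
    (hx : IsGen x) (hfull : S.Full p x) (hrad : rad (S.cls x) = ⊥) : ∃ s w0 W, S.Tens x s w0 W (S.core (mul G p)) ∧ tor G p ≤ W := by
  have hnp : ¬ S.PInv p x := by
    intro h
    obtain ⟨t, ht, ht0⟩ := exists_tor_ne (G := G) hp hpn
    have := h ht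
    rw [hrad, AddSubgroup.mem_bot] at this
    exact ht0 this
  obtain ⟨z0, hz, hnf⟩ := exists_not_full hnp
  obtain ⟨-, hmax, W, hW, htW, hsup, hinf, X2, hX2, hne, hsub, hr⟩ := L2 hp hpn hodd hx hfull hz hnf
  set V := S.core (mul G p) with hVdef
  have hV : S.Sat (V : Set G) := S.core_sat _
  have inf : W ⊓ V = ⊥ := by rw [hrad] at hinf; exact le_bot_iff.1 hinf
  have hnV : ∀ w ∈ W, (w ∉ V ↔ w ≠ 0) := by
    intro w hw
    constructor
    · rintro h rfl; exact h V.zero_mem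
    · intro h hv
      apply h
      have : w ∈ W ⊓ V := ⟨hw, hv⟩
      rwa [inf, AddSubgroup.mem_bot] at this
  obtain ⟨w0, hw0, hw0V, s, hs, hxs⟩ := (hr x).1 (S.rfl' x)
  have hsV : s ∈ V := hsub hs
  have hcls : ∀ s', s' ∈ X2 ↔ S.r s s' := by
    intro s'
    constructor
    · intro hs'
      have hsat : S.Sat (((W : Set G) \ {0}) + S.cls s) := (hW.diff S.sat_zero).add (S.cls_sat s)
      have h1 : S.r x (w0 + s') := (hr _).2 ⟨w0, hw0, hw0V, s', hs', rfl⟩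
      have h2 := hsat _ _ h1 ⟨w0, ⟨hw0, by simpa using (hnV w0 hw0).1 hw0V⟩, s, S.self_mem_cls s, hxs.symm⟩
      obtain ⟨a, ⟨ha, -⟩, b, hb, hab⟩ := h2
      have hbV : b ∈ V := hV _ _ hb hsV
      have := (direct inf ha hw0 hbV (hsub hs') hab).2
      rw [← this]; exact hb
    · intro h; exact hX2 _ _ h hs
  refine ⟨s, w0, W, ⟨hW, hV, inf, hsup, hsV, hw0, (hnV _ hw0).1 hw0V, hx, hxs, ?_, ?_⟩, htW⟩
  · intro y
    rw [hr]
    constructor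
    · rintro ⟨w, hw, hwV, s', hs', rfl⟩; exact ⟨w, hw, (hnV w hw).1 hwV, s', (hcls s').1 hs', rfl⟩
    · rintro ⟨w, hw, hwV, s', hs', rfl⟩; exact ⟨w, hw, (hnV w hw).2 hwV, s', (hcls s').2 hs', rfl⟩
  · intro D hD hDW
    rcases hmax (D ⊔ V) (sat_sup hD hV) le_sup_right with h | h
    · left
      rw [eq_bot_iff, ← inf]
      exact le_inf hDW (h ▸ le_sup_left)
    · right
      apply le_antisymm hDW
      intro w hw
      obtain ⟨a, ha, b, hb, hab⟩ := decomp h w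
      have := (direct inf hw (hDW ha) V.zero_mem hb (by simpa using hab)).1
      rw [this]; exact ha

namespace Tens
variable {x s w0 : G} {W V : AddSubgroup G}

theorem cop (T : S.Tens x s w0 W V) : (Nat.card W).Coprime (Nat.card V) := by
  apply Nat.coprime_of_dvd
  intro q hq h1 h2
  have hqn : q ∣ Nat.card G := h1.trans (sub_dvd W)
  obtain ⟨t, ht, ht0⟩ := exists_tor_ne (G := G) hq hqn
  have : t ∈ W ⊓ V := ⟨(tor_le_iff hq hqn).2 h1 ht, (tor_le_iff hq hqn).2 h2 ht⟩
  rw [T.inf, AddSubgroup.mem_bot] at this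
  exact ht0 this

theorem card (T : S.Tens x s w0 W V) : Nat.card G = Nat.card W * Nat.card V := by
  apply Nat.dvd_antisymm
  · obtain ⟨x, hx⟩ := exists_gen (G := G)
    apply gen_nsmul hx
    obtain ⟨a, ha, b, hb, rfl⟩ := decomp T.sup x
    rw [smul_add, mul_comm, mul_smul, mem_iff_nsmul.1 ha, mul_comm, mul_smul, mem_iff_nsmul.1 hb]; simp
  · exact T.cop.mul_dvd_of_dvd_of_dvd (sub_dvd W) (sub_dvd V)

theorem exists_proj (T : S.Tens x s w0 W V) : ∃ c : ℕ, ∀ a ∈ W, ∀ b ∈ V, c • (a + b) = b := by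
  obtain ⟨c, h1, h2⟩ := Nat.chineseRemainder T.cop 0 1
  refine ⟨c, fun a ha b hb => ?_⟩
  rw [smul_add, smul_one_mod ha h1, smul_one_mod hb h2]; simp

theorem proj_r (T : S.Tens x s w0 W V) {a a' b b' : G} (ha : a ∈ W) (ha' : a' ∈ W) (hb : b ∈ V) (hb' : b' ∈ V)
    (h : S.r (a + b) (a' + b')) : S.r b b' := by
  obtain ⟨a1, b1, h1, h2, h3⟩ := S.split h
  have := (direct T.inf ha' (T.hW _ _ h1 ha) hb' (T.hV _ _ h2 hb) h3).2
  rw [this]; exact h2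

theorem proj_lift (T : S.Tens x s w0 W V) {a b b' : G} (ha : a ∈ W) (h : S.r b b') : ∃ a' ∈ W, S.r (a + b) (a' + b') := by
  have hsat : S.Sat (S.cls (a + b) + (W : Set G)) := (S.cls_sat _).add T.hW
  obtain ⟨y, hy, w, hw, he⟩ := hsat _ _ h ⟨a + b, S.self_mem_cls _, -a, W.neg_mem ha, by abel⟩
  refine ⟨-w, W.neg_mem hw, ?_⟩
  have he' : y + w = b' := he
  have : -w + b' = y := by rw [← he', add_comm y w, neg_add_cancel_left]
  rw [this]; exact hy

theorem gen_s (T : S.Tens x s w0 W V) : IsGen (⟨s, T.hs⟩ : V) := by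
  rw [isGen_iff]
  rintro ⟨v, hv⟩
  obtain ⟨c, hc⟩ := T.exists_proj
  obtain ⟨k, hk⟩ := T.hx.exists_nsmul v
  refine ⟨k, ?_⟩
  apply Subtype.ext
  simp only [natCast_zsmul, AddSubgroup.coe_nsmul]
  have h1 := hc 0 W.zero_mem v hv
  rw [zero_add, hk, smul_comm, T.hxs, hc w0 T.hw0 s T.hs] at h1
  rw [h1, hk, T.hxs]

theorem rad_bot (T : S.Tens x s w0 W V) (hrad : rad (S.cls x) = ⊥) : rad ((S.sub V T.hV).cls ⟨s, T.hs⟩) = ⊥ := by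
  rw [eq_bot_iff]
  rintro ⟨v, hv⟩ h
  rw [AddSubgroup.mem_bot]
  apply Subtype.ext
  have : v ∈ rad (S.cls x) := by
    apply mem_rad'
    intro y hy
    obtain ⟨w, hw, hw0, s', hs', rfl⟩ := (T.hr y).1 hy
    refine (T.hr _).2 ⟨w, hw, hw0, v + s', ?_, by abel⟩
    have hs'V := T.hV _ _ hs' T.hs
    have h2 := (mem_rad.1 h ⟨s', hs'V⟩).1 (show (S.sub V T.hV).r ⟨s, T.hs⟩ ⟨s', hs'V⟩ from sub_r.2 hs')
    exact (sub_r (hH := T.hV) (x := ⟨s, T.hs⟩) (y := ⟨v, hv⟩ + ⟨s', hs'V⟩)).1 h2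
  rw [hrad, AddSubgroup.mem_bot] at this
  exact this

/-- highest lift -/
theorem lift (T : S.Tens x s w0 W V) {a : G} (ha : a ∈ W) (ha0 : a ≠ 0) {v u : V} (hv : IsGen v) (hu : (S.sub V T.hV).r v u) :
    ∃ y, IsGen y ∧ S.r y (a + u) := by
  obtain ⟨k, hk⟩ := T.gen_s.exists_nsmul v
  have hkc : k.Coprime (Nat.card V) := coprime_of_gen (hk ▸ hv) T.gen_s
  obtain ⟨k', hk', hk'n⟩ := lift_coprime (ncard_ne (G := G)) (sub_dvd V) hkc
  obtain ⟨j, hj, -, hj2⟩ := unit_inverse (G := G) hk'n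
  refine ⟨k' • x, (ord_unit hk'n).trans T.hx, ?_⟩
  have hks : k' • s = (v : G) := by
    rw [smul_one_mod T.hs hk', hk]; rfl
  have h1 : S.r s (j • (u : G)) := by
    rw [← schur_iff hk'n, hj2, hks]; exact sub_r.1 hu
  have h2 : S.r x (j • a + j • (u : G)) := by
    refine (T.hr _).2 ⟨j • a, W.nsmul_mem ha j, ?_, _, h1, rfl⟩
    intro h0
    apply ha0
    rw [← hj2 a, h0, smul_zero]
  have h3 := schur hk'n h2
  rwa [smul_add, hj2, hj2] at h3

theorem V_ne (T : S.Tens x s w0 W V) : V ≠ ⊤ := by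
  intro h
  apply T.ne
  have : w0 ∈ W ⊓ V := ⟨T.hw0, by rw [h]; trivial⟩
  rwa [T.inf, AddSubgroup.mem_bot] at this

theorem zp (T : S.Tens x s w0 W V) (h : (S.sub V T.hV).ZP) : S.ZP := by
  intro w hw1 hw2 y0
  by_contra hy0
  obtain ⟨a0, ha0, b0, hb0, rfl⟩ := decomp T.sup y0
  have key := h (fun v => w (a0 + v)) ?_ ?_ ⟨b0, hb0⟩
  · exact hy0 key
  · intro D hD v v' hv hv' hvD
    have h1 := hw1 (W ⊔ D.map V.subtype) (sat_sup T.hW (sat_map_sub hD)) _ _ hv hv' (by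
      apply add_mem (le_sup_left (a := W) ha0)
      exact le_sup_right (a := W) ⟨v, hvD, rfl⟩)
    rw [AddSubgroup.mem_sup] at h1
    obtain ⟨a, ha, _, ⟨d, hd, rfl⟩, he⟩ := h1
    have := (direct T.inf ha ha0 d.2 v'.2 he).2
    have h3 : d = v' := Subtype.ext this
    rw [← h3]; exact hd
  · rintro g hg u ⟨v, hv, hvu⟩
    by_cases h0 : a0 = 0
    · subst h0
      obtain ⟨c, hc⟩ := T.exists_proj
      have hcV : ∀ y, c • y ∈ V := by
        intro y
        obtain ⟨a, ha, b, hb, rfl⟩ := decomp T.sup y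
        rw [hc a ha b hb]; exact hb
      have hsupp : ∀ y, w y ≠ 0 → y ∈ V := fun y hy => hw1 V T.hV _ _ hy0 hy (by rw [zero_add]; exact hb0)
      have h1 := hw2 (fun y => g ⟨c • y, hcV y⟩) (by
        intro y y' hyy
        apply hg
        rw [sub_r]
        obtain ⟨a, ha, b, hb, rfl⟩ := decomp T.sup y
        obtain ⟨a', ha', b', hb', rfl⟩ := decomp T.sup y'
        simp only [hc a ha b hb, hc a' ha' b' hb']
        exact T.proj_r ha ha' hb hb' hyy) (w0 + u) (T.lift T.hw0 T.ne hv hvu)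
      rw [sum_coset V 0] at h1
      · rw [← h1]
        apply Finset.sum_congr rfl
        intro b _
        congr 2
        apply Subtype.ext
        simp only [AddSubgroup.coe_sub, zero_add]
        rw [add_sub_assoc, hc w0 T.hw0 _ (sub_mem u.2 b.2)]
      · intro y hy
        rw [sub_zero] at hy
        by_cases hwy : w y = 0
        · rw [hwy, zero_mul]
        · exact absurd (hsupp y hwy) hy
    · have h1 := hw2 (fun y => if hy : y ∈ V then g ⟨y, hy⟩ else 0) (by
        intro y y' hyy
        by_cases hy : y ∈ V
        · have hy' := T.hV _ _ hyy hy
          refine (dif_pos hy).trans (Eq.trans ?_ (dif_pos hy').symm)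
          exact hg _ _ (show (S.sub V T.hV).r ⟨y, hy⟩ ⟨y', hy'⟩ from sub_r.2 hyy)
        · have hy' : y' ∉ V := fun h => hy (T.hV _ _ (S.symm' hyy) h)
          simp [hy, hy']) (a0 + u) (T.lift ha0 h0 hv hvu)
      rw [sum_coset V a0] at h1
      · rw [← h1]
        apply Finset.sum_congr rfl
        intro b _
        have : (a0 + (u:G) - (a0 + b)) = ((u - b : V) : G) := by
          rw [AddSubgroup.coe_sub]; abel
        simp only [this, SetLike.coe_mem, dif_pos]
      · intro y hy
        rw [dif_neg, mul_zero]
        intro hc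
        apply hy
        have := sub_mem u.2 hc
        have e : (u:G) - (a0 + u - y) = y - a0 := by abel
        rwa [e] at this

theorem full_V (T : S.Tens x s w0 W V) {p : ℕ} (hp : p.Prime) (hpV : p ∣ Nat.card V) : S.Full p x ↔ (S.sub V T.hV).Full p ⟨s, T.hs⟩ := by
  have hle : tor G p ≤ V := (tor_le_iff hp (hpV.trans (sub_dvd V))).2 hpV
  constructor
  · rintro h ⟨t, htV⟩ ht
    have htG : t ∈ tor G p := by rw [mem_tor] at ht ⊢; exact congrArg Subtype.val ht
    have h1 := h t htG
    rw [T.hxs, add_assoc] at h1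
    exact sub_r.2 (T.proj_r T.hw0 T.hw0 T.hs (add_mem T.hs htV) h1)
  · intro h t ht
    have htV : (⟨t, hle ht⟩ : V) ∈ tor V p := by rw [mem_tor] at ht ⊢; exact Subtype.ext ht
    have h1 := h _ htV
    rw [T.hr]
    exact ⟨w0, T.hw0, T.ne, s + t, sub_r.1 h1, by rw [T.hxs, add_assoc]⟩

theorem W_nonfull (T : S.Tens x s w0 W V) {p : ℕ} (hp : p.Prime) (hpW : p ∣ Nat.card W) (h : ¬ S.Full p x) : Nat.card W = p := by
  have hle : tor G p ≤ W := (tor_le_iff hp (hpW.trans (sub_dvd W))).2 hpW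
  unfold Full at h
  push Not at h
  obtain ⟨t, ht, hn⟩ := h
  have h0 : w0 + t = 0 := by
    by_contra hc
    apply hn
    rw [T.hr]
    exact ⟨w0 + t, add_mem T.hw0 (hle ht), hc, s, S.rfl' s, by rw [T.hxs]; abel⟩
  have hw0p : p • w0 = 0 := by
    have : w0 = -t := eq_neg_of_add_eq_zero_left h0
    rw [this, smul_neg, mem_tor.1 ht, neg_zero]
  apply Nat.dvd_antisymm _ hpW
  have h1 : (p * Nat.card V) • x = 0 := by
    rw [T.hxs, smul_add, mul_comm, mul_smul, hw0p, mul_comm, mul_smul, mem_iff_nsmul.1 T.hs]; simp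
  have h2 := gen_nsmul T.hx h1
  rw [T.card] at h2
  exact Nat.dvd_of_mul_dvd_mul_right (Nat.pos_of_ne_zero (sub_ne V)) h2

theorem fc (T : S.Tens x s w0 W V) (h : (S.sub V T.hV).FC ⟨s, T.hs⟩) : S.FC x where
  zp := T.zp h.zp
  c2 := by
    intro p hp hpp hnf t ht ht0 v hv hr
    have hpn : p ∣ Nat.card G := (dvd_mul_right p p).trans hpp
    rw [T.card] at hpp
    by_cases hpW : p ∣ Nat.card W
    · have h1 := T.W_nonfull hp hpW hnf
      have hc := T.cop
      rw [h1] at hpp hc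
      have h2 := Nat.dvd_of_mul_dvd_mul_left hp.pos hpp
      exact hp.one_lt.ne' (Nat.eq_one_of_dvd_coprimes hc dvd_rfl h2)
    · have hppV : p * p ∣ Nat.card V := by
        have : p.Coprime (Nat.card W) := (Nat.Prime.coprime_iff_not_dvd hp).2 hpW
        exact (Nat.Coprime.mul_left this this).dvd_of_dvd_mul_left hpp
      have hpV : p ∣ Nat.card V := (dvd_mul_right p p).trans hppV
      have hle : tor G p ≤ V := (tor_le_iff hp hpn).2 hpV
      obtain ⟨c, hc⟩ := T.exists_proj
      obtain ⟨a, ha, b, hb, hab⟩ := decomp T.sup v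
      have hcv : c • v = b := by rw [hab, hc a ha b hb]
      have h1 := h.c2 p hp hppV (fun hf => hnf ((T.full_V hp hpV).2 hf)) ⟨t, hle ht⟩
        (by rw [mem_tor] at ht ⊢; exact Subtype.ext ht) (fun h0 => ht0 (congrArg Subtype.val h0)) ⟨b, hb⟩ (by
          intro q hq hqd
          apply hv q hq
          rw [AddSubgroup.addOrderOf_mk, ← hcv] at hqd
          exact hqd.trans (addOrderOf_smul_dvd c))
      apply h1
      rw [sub_r]
      have e : x + t + v = (w0 + a) + (s + t + b) := by rw [T.hxs, hab]; abel
      rw [e, T.hxs] at hr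
      exact T.proj_r T.hw0 (add_mem T.hw0 ha) T.hs (add_mem (add_mem T.hs (hle ht)) hb) hr
  gp := by
    intro p a hp hpn h1 h2 hnf
    by_cases hpW : p ∣ Nat.card W
    · have h3 := T.W_nonfull hp hpW hnf
      have hc := T.cop
      rw [h3] at hc
      have : tor G (p ^ a) = W := by
        apply sub_eq_of_card
        rw [card_tor h1, h3]
        apply Nat.dvd_antisymm
        · apply (Nat.Coprime.pow_left a hc).dvd_of_dvd_mul_right
          rw [← h3, ← T.card, h3]; exact h1
        · apply dvd_pow_self
          rintro rfl
          rw [zero_add, pow_one] at h2; exact h2 hpn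
      rw [this]; exact T.hW
    · have hcp : p.Coprime (Nat.card W) := (Nat.Prime.coprime_iff_not_dvd hp).2 hpW
      have hdv : ∀ j, p ^ j ∣ Nat.card G → p ^ j ∣ Nat.card V := by
        intro j hj
        rw [T.card] at hj
        exact (hcp.pow_left j).dvd_of_dvd_mul_left hj
      have hpV : p ∣ Nat.card V := by simpa using hdv 1 (by simpa using hpn)
      have h3 := h.gp p a hp hpV (hdv a h1) (fun hc => h2 (hc.trans (sub_dvd V))) (fun hf => hnf ((T.full_V hp hpV).2 hf))
      have h4 := sat_map_sub h3
      convert h4 using 2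
      have hle : tor G (p ^ a) ≤ V := by
        rw [le_iff_card, card_tor h1]; exact hdv a h1
      ext y
      constructor
      · intro hy
        exact ⟨⟨y, hle hy⟩, by rw [mem_tor] at hy; exact Subtype.ext hy, rfl⟩
      · rintro ⟨⟨y, hy⟩, hy', rfl⟩
        exact congrArg Subtype.val (mem_tor.1 hy')
  gp' := by
    intro p a m hp hpn hn hpm hnf
    by_cases hpW : p ∣ Nat.card W
    · have h3 := T.W_nonfull hp hpW hnf
      have hc := T.cop
      rw [h3] at hc
      have hV : ¬ p ∣ Nat.card V := fun h => hp.one_lt.ne' (Nat.eq_one_of_dvd_coprimes hc dvd_rfl h)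
      have : tor G m = V := by
        apply sub_eq_of_card
        rw [card_tor (hn ▸ dvd_mul_left m _)]
        have e : p * Nat.card V = p ^ a * m := by rw [← hn, T.card, h3]
        have hmp : m.Coprime p := ((Nat.Prime.coprime_iff_not_dvd hp).2 hpm).symm
        apply Nat.dvd_antisymm
        · exact hmp.dvd_of_dvd_mul_left (e ▸ dvd_mul_left m _)
        · have : (Nat.card V).Coprime (p ^ a) := (Nat.Coprime.pow_left a hc).symm
          exact this.dvd_of_dvd_mul_left (e ▸ dvd_mul_left _ p)
      rw [this]; exact T.hV
    · have hcp : p.Coprime (Nat.card W) := (Nat.Prime.coprime_iff_not_dvd hp).2 hpW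
      have e : Nat.card W * Nat.card V = p ^ a * m := by rw [← hn, T.card]
      obtain ⟨m', hm'⟩ : p ^ a ∣ Nat.card V := (hcp.pow_left a).dvd_of_dvd_mul_left (e ▸ dvd_mul_right _ m)
      have hmm : m = Nat.card W * m' := by
        apply Nat.eq_of_mul_eq_mul_left (Nat.pow_pos (n := a) hp.pos)
        rw [← e, hm']; ring
      have hpV : p ∣ Nat.card V := hcp.dvd_of_dvd_mul_left (T.card ▸ hpn)
      have h3 := h.gp' p a m' hp hpV hm' (fun hc => hpm (hmm ▸ hc.mul_left _)) (fun hf => hnf ((T.full_V hp hpV).2 hf))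
      have h4 := sat_sup T.hW (sat_map_sub h3)
      have hcD : Nat.card ((tor V m').map V.subtype) = m' := by
        rw [AddSubgroup.card_map_of_injective (AddSubgroup.subtype_injective V), card_tor (hm' ▸ dvd_mul_left m' _)]
      have hmn : m ∣ Nat.card G := hn ▸ dvd_mul_left m _
      have : tor G m = W ⊔ (tor V m').map V.subtype := by
        apply le_antisymm
        · rw [le_iff_card, card_tor hmn, hmm]
          apply Nat.Coprime.mul_dvd_of_dvd_of_dvd
          · exact T.cop.coprime_dvd_right (hm' ▸ dvd_mul_left m' _)
          · exact le_iff_card.1 le_sup_left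
          · conv_lhs => rw [← hcD]
            exact le_iff_card.1 le_sup_right
        · apply sup_le
          · rw [le_iff_card, card_tor hmn, hmm]; exact dvd_mul_right _ _
          · rw [le_iff_card, card_tor hmn, hcD, hmm]; exact dvd_mul_left _ _
      rw [this]; exact h4
  R := by
    intro y hy
    obtain ⟨a, ha, b, hb, rfl⟩ := decomp T.sup y
    have ha0 : a ≠ 0 := by
      rintro rfl
      apply T.V_ne
      rw [eq_top_iff, ← hy, AddSubgroup.closure_le]
      exact T.hV.cls_subset (by rw [zero_add]; exact hb)
    have h1 : AddSubgroup.closure ((S.sub V T.hV).cls ⟨b, hb⟩) = ⊤ := by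
      set D := AddSubgroup.closure ((S.sub V T.hV).cls ⟨b, hb⟩) with hD
      have hWD : W ⊔ D.map V.subtype = ⊤ := by
        rw [eq_top_iff, ← hy, AddSubgroup.closure_le]
        intro z hz
        obtain ⟨a', b', hA, hB, rfl⟩ := S.split hz
        apply add_mem (le_sup_left (a := W) (T.hW _ _ hA ha))
        apply le_sup_right (a := W)
        exact ⟨⟨b', T.hV _ _ hB hb⟩, AddSubgroup.subset_closure (show (S.sub V T.hV).r ⟨b, hb⟩ ⟨b', T.hV _ _ hB hb⟩ from sub_r.2 hB), rfl⟩
      rw [eq_top_iff]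
      intro v _
      obtain ⟨a', ha', _, ⟨d, hd, rfl⟩, he⟩ := decomp hWD (v : G)
      have := (direct T.inf W.zero_mem ha' v.2 d.2 (by simpa using he)).2
      have h3 : v = d := Subtype.ext this
      rw [h3]; exact hd
    obtain ⟨v, hv1, hv2⟩ := h.R _ h1
    obtain ⟨a', ha', hl⟩ := T.proj_lift ha (sub_r.1 hv1)
    have ha'0 : a' ≠ 0 := by
      rintro rfl
      have := T.hV _ _ (S.symm' hl) (by rw [zero_add]; exact v.2)
      have h5 : a ∈ W ⊓ V := ⟨ha, by have := sub_mem this hb; simpa using this⟩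
      rw [T.inf, AddSubgroup.mem_bot] at h5
      exact ha0 h5
    obtain ⟨z, hz, hzr⟩ := T.lift ha' ha'0 hv2 ((S.sub V T.hV).rfl' v)
    exact ⟨z, S.trans' hl (S.symm' hzr), hz⟩

end Tens

theorem free_aux (n : ℕ) : ∀ (G : Type u) [AddCommGroup G] [Fintype G] [IsAddCyclic G] (S : SR G) (x : G),
    Nat.card G = n → Odd n → IsGen x → rad (S.cls x) = ⊥ → S.FC x := by
  induction n using Nat.strong_induction_on with
  | _ n ih =>
  intro G _ _ _ S x hn hodd hx hrad
  subst hn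
  by_cases hc : ∃ p : ℕ, p.Prime ∧ p ∣ Nat.card G ∧ S.Full p x
  · obtain ⟨p, hp, hpn, hf⟩ := hc
    obtain ⟨s, w0, W, T, -⟩ := exists_tens hp hpn hodd hx hf hrad
    apply T.fc
    refine ih (Nat.card (S.core (mul G p))) ?_ _ _ _ rfl (hodd.of_dvd_nat (sub_dvd _)) T.gen_s (T.rad_bot hrad)
    apply lt_of_le_of_ne (Nat.le_of_dvd (Nat.pos_of_ne_zero ncard_ne) (sub_dvd _))
    intro h
    exact T.V_ne (AddSubgroup.card_eq_iff_eq_top _ |>.1 h)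
  · push Not at hc
    exact Cyc.fc hodd ⟨hx, hc⟩

theorem free (hodd : Odd (Nat.card G)) {x : G} (hx : IsGen x) (hrad : rad (S.cls x) = ⊥) : S.FC x :=
  free_aux _ G S x rfl hodd hx hrad

end SR
end SRP

namespace SRP
open Classical Finset
open scoped Pointwise
universe u
set_option linter.all false
set_option linter.deprecated false

namespace SR
variable {G : Type u} [AddCommGroup G] [Fintype G] {S : SR G}

theorem rad_cls_r {x y l : G} (hl : l ∈ rad (S.cls x)) : S.r x (y + l) ↔ S.r x y := by
  have := mem_rad.1 hl y
  rw [add_comm y l]; exact this.symm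

theorem quot_rad_r {x y : G} : (S.quot (rad (S.cls x)) (sat_rad (S.cls_sat x))).r x y ↔ S.r x y := by
  rw [quot_r_iff]
  constructor
  · rintro ⟨l, hl, h⟩; exact (rad_cls_r hl).1 h
  · intro h; exact ⟨0, zero_mem _, by rwa [add_zero]⟩

variable [IsAddCyclic G]

theorem rad_quot (x : G) : rad ((S.quot (rad (S.cls x)) (sat_rad (S.cls_sat x))).cls x) = ⊥ := by
  rw [eq_bot_iff]
  intro a
  induction a using QuotientAddGroup.induction_on with
  | H l =>
  intro ha
  rw [AddSubgroup.mem_bot, mk_zero]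
  apply mem_rad'
  intro y hy
  have := (mem_rad.1 ha (y : G ⧸ _)).1 (quot_rad_r.2 hy)
  exact quot_rad_r.1 this

theorem nonfull_rad {p : ℕ} (hp : p.Prime) (hpn : p ∣ Nat.card G) {x : G} (h : ¬ S.Full p x) : ¬ p ∣ Nat.card (rad (S.cls x)) := by
  intro hd
  apply h
  intro t ht
  have := (tor_le_iff hp hpn).2 hd ht
  exact (rad_cls_r this).2 (S.rfl' x)

theorem nonfull_quot {p : ℕ} (hp : p.Prime) (hpn : p ∣ Nat.card G) {x : G} (h : ¬ S.Full p x) :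
    ¬ (S.quot (rad (S.cls x)) (sat_rad (S.cls_sat x))).Full p x := by
  intro hf
  apply h
  intro t ht
  have := hf (t : G ⧸ _) (by rw [mem_tor] at ht ⊢; rw [← QuotientAddGroup.mk_nsmul, ht]; rfl)
  exact quot_rad_r.1 this

theorem quot_card_pow {p a m : ℕ} (hp : p.Prime) (hn : Nat.card G = p ^ a * m) {L : AddSubgroup G} (hL : ¬ p ∣ Nat.card L) :
    ∃ m', m = m' * Nat.card L ∧ Nat.card (G ⧸ L) = p ^ a * m' := by
  have e := card_quot L
  have hc : (p ^ a).Coprime (Nat.card L) := Nat.Coprime.pow_left a ((Nat.Prime.coprime_iff_not_dvd hp).2 hL)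
  obtain ⟨m', hm'⟩ : p ^ a ∣ Nat.card (G ⧸ L) := hc.dvd_of_dvd_mul_right (by rw [← e, hn]; exact dvd_mul_right _ _)
  refine ⟨m', ?_, hm'⟩
  apply Nat.eq_of_mul_eq_mul_left (Nat.pow_pos (n := a) hp.pos)
  rw [← hn, e, hm']; ring

theorem C1 (hodd : Odd (Nat.card G)) {p a m : ℕ} (hp : p.Prime) (hpn : p ∣ Nat.card G) (hn : Nat.card G = p ^ a * m) (hpm : ¬ p ∣ m)
    {x : G} (hx : IsGen x) (h : ¬ S.Full p x) : S.Sat (tor G m : Set G) := by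
  have hr := nonfull_rad hp hpn h
  obtain ⟨m', hm, hq⟩ := quot_card_pow hp hn hr
  have hpq : p ∣ Nat.card (G ⧸ rad (S.cls x)) := by
    have e := card_quot (rad (S.cls x))
    rw [e] at hpn
    exact ((Nat.Prime.dvd_mul hp).1 hpn).resolve_right hr
  have hoq : Odd (Nat.card (G ⧸ rad (S.cls x))) := hodd.of_dvd_nat (card_quot (rad (S.cls x)) ▸ dvd_mul_right _ _)
  have hfc := free hoq (gen_quot hx _) (rad_quot (S := S) x)
  have h1 := hfc.gp' p a m' hp hpq hq (fun hc => hpm (hm ▸ hc.mul_right _)) (nonfull_quot hp hpn h)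
  have h2 := sat_comap_mk h1
  convert h2 using 2
  ext y
  rw [AddSubgroup.mem_comap, QuotientAddGroup.mk'_apply, mk_mem_tor, mem_tor, hm, mul_comm, mul_smul]
  exact mem_iff_nsmul.symm

theorem C2 (hodd : Odd (Nat.card G)) {p : ℕ} (hp : p.Prime) (hpp : p * p ∣ Nat.card G)
    {x : G} (hx : IsGen x) (h : ¬ S.Full p x) {t : G} (ht : t ∈ tor G p) (ht0 : t ≠ 0) {v : G}
    (hv : ∀ q : ℕ, q.Prime → q ∣ addOrderOf v → q < p) : ¬ S.r x (x + t + v) := by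
  have hpn : p ∣ Nat.card G := (dvd_mul_right p p).trans hpp
  have hr := nonfull_rad hp hpn h
  have hc : p.Coprime (Nat.card (rad (S.cls x))) := (Nat.Prime.coprime_iff_not_dvd hp).2 hr
  have hpq : p * p ∣ Nat.card (G ⧸ rad (S.cls x)) :=
    (Nat.Coprime.mul_left hc hc).dvd_of_dvd_mul_right (by rw [← card_quot]; exact hpp)
  have hoq : Odd (Nat.card (G ⧸ rad (S.cls x))) := hodd.of_dvd_nat (card_quot (rad (S.cls x)) ▸ dvd_mul_right _ _)
  have hfc := free hoq (gen_quot hx _) (rad_quot (S := S) x)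
  have h1 := hfc.c2 p hp hpq (nonfull_quot hp hpn h) (t : G ⧸ _)
    (by rw [mem_tor] at ht ⊢; rw [← QuotientAddGroup.mk_nsmul, ht]; rfl)
    (fun h0 => ht0 (tor_inf hp hr ht (mk_zero.1 h0))) (v : G ⧸ _) (by
      intro q hq hd
      exact hv q hq (hd.trans (addOrderOf_map_dvd (QuotientAddGroup.mk' _) v)))
  intro hc
  exact h1 (quot_rad_r.2 hc)

end SR
end SRP

namespace SRP
open Classical Finset
open scoped Pointwise
universe u
set_option linter.all false
set_option linter.deprecated false

section
variable {G : Type u} [AddCommGroup G] [Fintype G] [IsAddCyclic G]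

theorem le_tor_of {p a m : ℕ} (hp : p.Prime) (hn : Nat.card G = p ^ a * m) {H : AddSubgroup G} (h : ¬ p ∣ Nat.card H) : H ≤ tor G m := by
  have hmn : m ∣ Nat.card G := hn ▸ dvd_mul_left m _
  rw [le_iff_card, card_tor hmn]
  have hc : (Nat.card H).Coprime (p ^ a) := (Nat.Coprime.pow_left a ((Nat.Prime.coprime_iff_not_dvd hp).2 h)).symm
  exact hc.dvd_of_dvd_mul_left (hn ▸ sub_dvd H)

theorem split_pp {p a m : ℕ} (hp : p.Prime) (hn : Nat.card G = p ^ a * m) (hpm : ¬ p ∣ m) : tor G (p ^ a) ⊔ tor G m = ⊤ := by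
  have hc : (p ^ a).Coprime m := Nat.Coprime.pow_left a ((Nat.Prime.coprime_iff_not_dvd hp).2 hpm)
  rw [← AddSubgroup.card_eq_iff_eq_top]
  apply Nat.dvd_antisymm (sub_dvd _)
  rw [hn]
  have h1 : Nat.card (tor G (p ^ a)) = p ^ a := card_tor (hn ▸ dvd_mul_right _ m)
  have h2 : Nat.card (tor G m) = m := card_tor (hn ▸ dvd_mul_left m _)
  apply hc.mul_dvd_of_dvd_of_dvd
  · conv_lhs => rw [← h1]
    exact le_iff_card.1 le_sup_left
  · conv_lhs => rw [← h2]
    exact le_iff_card.1 le_sup_right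

theorem inf_pp {p a m : ℕ} (hp : p.Prime) (hpm : ¬ p ∣ m) : tor G (p ^ a) ⊓ tor G m = ⊥ := by
  have hc : (p ^ a).Coprime m := Nat.Coprime.pow_left a ((Nat.Prime.coprime_iff_not_dvd hp).2 hpm)
  rw [eq_bot_iff]
  rintro y ⟨h1, h2⟩
  rw [AddSubgroup.mem_bot, ← AddMonoid.addOrderOf_eq_one_iff]
  exact Nat.eq_one_of_dvd_coprimes hc (mem_tor_ord.1 h1) (mem_tor_ord.1 h2)

/-- multiplier extracting the p-part -/
theorem exists_pp {p a m : ℕ} (hp : p.Prime) (hpm : ¬ p ∣ m) : ∃ c : ℕ, ∀ g ∈ tor G (p ^ a), ∀ v ∈ tor G m, c • (g + v) = g := by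
  have hc : (p ^ a).Coprime m := Nat.Coprime.pow_left a ((Nat.Prime.coprime_iff_not_dvd hp).2 hpm)
  obtain ⟨c, h1, h2⟩ := Nat.chineseRemainder hc 1 0
  refine ⟨c, fun g hg v hv => ?_⟩
  have e1 : c • g = 1 • g := nsmul_congr (h1.of_dvd (mem_tor_ord.1 hg))
  have e2 : c • v = 0 • v := nsmul_congr (h2.of_dvd (mem_tor_ord.1 hv))
  rw [smul_add, e1, e2]; simp
end

namespace SR
variable {G : Type u} [AddCommGroup G] [Fintype G] {S : SR G}

def RP (G : Type u) [AddCommGroup G] [Fintype G] : Prop :=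
  ∀ S : SR G, ∀ y, AddSubgroup.closure (S.cls y) = ⊤ → ∃ z, S.r y z ∧ IsGen z

theorem PInv.of_r {p : ℕ} {y z : G} (h : S.PInv p y) (hr : S.r y z) : S.PInv p z := by
  unfold PInv; rw [← cls_eq hr]; exact h

variable [IsAddCyclic G]

theorem closure_quot {L : AddSubgroup G} {hL : S.Sat (L : Set G)} {y : G} (h : AddSubgroup.closure (S.cls y) = ⊤) :
    AddSubgroup.closure ((S.quot L hL).cls y) = ⊤ := by
  rw [eq_top_iff]
  intro z _
  induction z using QuotientAddGroup.induction_on with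
  | H z =>
  have h1 : AddSubgroup.closure (S.cls y) ≤ (AddSubgroup.closure ((S.quot L hL).cls (y : G ⧸ L))).comap (QuotientAddGroup.mk' L) := by
    rw [AddSubgroup.closure_le]
    intro w hw
    exact AddSubgroup.subset_closure (quot_mk (hL := hL) hw)
  rw [h] at h1
  exact h1 (AddSubgroup.mem_top z)

theorem b_top {p : ℕ} {x y : G} (hx : IsGen x) (hR : RP (G ⧸ rad (S.cls x))) (hp : tor G p ≤ rad (S.cls x))
    (hy : AddSubgroup.closure (S.cls y) = ⊤) : S.PInv p y := by
  obtain ⟨z, hz, hzg⟩ := hR (S.quot _ (sat_rad (S.cls_sat x))) y (closure_quot hy)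
  induction z using QuotientAddGroup.induction_on with
  | H z =>
  obtain ⟨k, hk⟩ := (gen_quot hx (rad (S.cls x))).exists_nsmul (z : G ⧸ _)
  have hkc := coprime_of_gen (hk ▸ hzg) (gen_quot hx _)
  obtain ⟨k', hk', hk'n⟩ := lift_coprime (ncard_ne (G := G)) (card_quot (rad (S.cls x)) ▸ dvd_mul_right _ _) hkc
  have hk2 : (z : G ⧸ rad (S.cls x)) = ((k' • x : G) : G ⧸ rad (S.cls x)) := by
    rw [hk, QuotientAddGroup.mk_nsmul]
    exact nsmul_congr (hk'.symm.of_dvd (addOrderOf_dvd_natCard _))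
  rw [hk2] at hz
  obtain ⟨l, hl, hr⟩ := quot_r_out hz
  obtain ⟨j, hj, hj1, hj2⟩ := unit_inverse (G := G) hk'n
  have h1 : S.r (k' • x) (k' • x + l) := by
    have := (rad_cls_r (S := S) ((mem_unit hj).2 hl)).2 (S.rfl' x)
    have := schur hk'n this
    rwa [smul_add, hj2] at this
  have h2 : S.r y (k' • x) := S.trans' hr (S.symm' h1)
  apply PInv.of_r _ (S.symm' h2)
  intro t ht
  apply mem_rad'
  intro w hw
  have h3 : S.r x (j • w) := by
    have := schur hj (mem_cls.1 hw)
    rwa [hj1] at this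
  have h4 := schur hk'n ((rad_cls_r ((mem_unit hj).2 (hp ht))).2 h3)
  rw [smul_add, hj2, hj2, add_comm] at h4
  exact h4

theorem sub_full {p : ℕ} {H : AddSubgroup G} {hH : S.Sat (H : Set G)} (hle : tor G p ≤ H) {h : G} (hh : h ∈ H) :
    (S.sub H hH).Full p ⟨h, hh⟩ ↔ S.Full p h := by
  constructor
  · intro hf t ht
    exact (sub_r (hH := hH)).1 (hf ⟨t, hle ht⟩ (by rw [mem_tor] at ht ⊢; exact Subtype.ext ht))
  · rintro hf ⟨t, htH⟩ ht
    exact (sub_r (hH := hH)).2 (hf t (by rw [mem_tor] at ht ⊢; exact congrArg Subtype.val ht))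

theorem gen_sub {y : G} (hR : RP (AddSubgroup.closure (S.cls y))) :
    ∃ h, ∃ hh : h ∈ AddSubgroup.closure (S.cls y), S.r y h ∧ IsGen (⟨h, hh⟩ : AddSubgroup.closure (S.cls y)) := by
  have hyH : y ∈ AddSubgroup.closure (S.cls y) := AddSubgroup.subset_closure (S.self_mem_cls y)
  obtain ⟨⟨h, hh⟩, h1, h2⟩ := hR (S.sub _ (sat_closure (S.cls_sat y))) ⟨y, hyH⟩ (by
    have := AddSubgroup.closure_closure_coe_preimage (k := S.cls y)
    rw [← this]
    rfl)
  exact ⟨h, hh, (sub_r (hH := sat_closure (S.cls_sat y))).1 h1, h2⟩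

theorem bad_struct (hodd : Odd (Nat.card G)) {p a m : ℕ} (hp : p.Prime) (hpn : p ∣ Nat.card G) (hn : Nat.card G = p ^ a * m)
    (hpm : ¬ p ∣ m) {y t : G} (hR : RP (AddSubgroup.closure (S.cls y))) (hbad : ¬ S.PInv p y) (ht : t ∈ tor G p) (ht0 : t ≠ 0) :
    AddSubgroup.closure (S.cls y) ≤ AddSubgroup.closure (S.cls t) ⊔ S.core (tor G m) ∨
    (∃ h, ∃ hh : h ∈ AddSubgroup.closure (S.cls y), S.r y h ∧ IsGen (⟨h, hh⟩ : AddSubgroup.closure (S.cls y)) ∧ ¬ S.Full p h ∧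
      p ∣ Nat.card (AddSubgroup.closure (S.cls y)) ∧ AddSubgroup.closure (S.cls t) ≤ AddSubgroup.closure (S.cls y) ∧
      AddSubgroup.closure (S.cls y) ≤ tor G (p ^ a) ⊔ S.core (tor G m)) := by
  obtain ⟨h, hh, hyh, hgen⟩ := gen_sub hR
  have hH : S.Sat (AddSubgroup.closure (S.cls y) : Set G) := sat_closure (S.cls_sat y)
  obtain ⟨z0, hz0, hz0f⟩ := exists_not_full hbad
  have hz0H : z0 ∈ AddSubgroup.closure (S.cls y) := AddSubgroup.subset_closure hz0
  generalize AddSubgroup.closure (S.cls y) = H at *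
  by_cases hpH : p ∣ Nat.card H
  swap
  · left
    exact (le_core hH (le_tor_of hp hn hpH)).trans le_sup_right
  have hle : tor G p ≤ H := (tor_le_iff hp hpn).2 hpH
  have hoH : Odd (Nat.card H) := hodd.of_dvd_nat (sub_dvd H)
  have hLH : AddSubgroup.closure (S.cls t) ≤ H := by
    rw [AddSubgroup.closure_le]
    exact hH.cls_subset (hle ht)
  by_cases hf : S.Full p h
  · left
    obtain ⟨hpV, hmax, -⟩ := L2 (S := S.sub H hH) (x := ⟨h, hh⟩) (z0 := ⟨z0, hz0H⟩) hp hpH hoH hgen ((sub_full hle hh).2 hf)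
      (sub_r.2 (S.trans' (S.symm' hyh) hz0)) (fun hc => hz0f ((sub_full hle hz0H).1 hc))
    have hVs0 := (S.sub H hH).core_sat (mul H p)
    have hVs := sat_map_sub hVs0
    generalize (S.sub H hH).core (mul H p) = VH at *
    have hVle : VH.map H.subtype ≤ S.core (tor G m) := by
      apply le_core hVs
      apply le_tor_of hp hn
      rwa [AddSubgroup.card_map_of_injective (AddSubgroup.subtype_injective H)]
    rcases hmax ((AddSubgroup.closure (S.cls t)).comap H.subtype ⊔ VH) (sat_sup (sat_comap_sub (sat_closure (S.cls_sat t))) hVs0) le_sup_right with h1 | h1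
    · exfalso
      have h2 : (⟨t, hle ht⟩ : H) ∈ VH := by
        rw [← h1]
        apply le_sup_left (a := (AddSubgroup.closure (S.cls t)).comap H.subtype)
        exact AddSubgroup.subset_closure (S.self_mem_cls t)
      have := tor_inf hp hpV (by rw [mem_tor] at ht ⊢; exact Subtype.ext ht) h2
      exact ht0 (congrArg Subtype.val this)
    · intro z hz
      obtain ⟨l, hl, v, hv, he⟩ := decomp h1 (⟨z, hz⟩ : H)
      have he' : z = (l : G) + v := congrArg Subtype.val he
      rw [he']
      apply add_mem
      · exact le_sup_left (a := AddSubgroup.closure (S.cls t)) hl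
      · exact le_sup_right (a := AddSubgroup.closure (S.cls t)) (hVle ⟨v, hv, rfl⟩)
  · right
    refine ⟨h, hh, hyh, hgen, hf, hpH, hLH, ?_⟩
    obtain ⟨b, m1, hm1, hb⟩ := Nat.exists_eq_pow_mul_and_not_dvd (sub_ne H) p hp.ne_one
    have h1 := C1 (S := S.sub H hH) hoH hp hpH hb hm1 hgen (fun hc => hf ((sub_full hle hh).1 hc))
    have h2 : (tor H m1).map H.subtype ≤ S.core (tor G m) := by
      apply le_core (sat_map_sub h1)
      apply le_tor_of hp hn
      rw [AddSubgroup.card_map_of_injective (AddSubgroup.subtype_injective H), card_tor (hb ▸ dvd_mul_left m1 _)]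
      exact hm1
    intro z hz
    obtain ⟨l, hl, v, hv, he⟩ := decomp (split_pp hp hb hm1) (⟨z, hz⟩ : H)
    have he' : z = (l : G) + v := congrArg Subtype.val he
    rw [he']
    apply add_mem
    · apply le_sup_left (a := tor G (p ^ a))
      have hba : b ≤ a := by
        have : p ^ b ∣ p ^ a := by
          have hc : (p ^ b).Coprime m := Nat.Coprime.pow_left b ((Nat.Prime.coprime_iff_not_dvd hp).2 hpm)
          apply hc.dvd_of_dvd_mul_right
          rw [← hn]
          exact (hb ▸ dvd_mul_right _ m1 : p ^ b ∣ Nat.card H).trans (sub_dvd H)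
        exact (Nat.pow_dvd_pow_iff_le_right hp.one_lt).1 this
      rw [mem_tor]
      have : p ^ b • (l : G) = 0 := congrArg Subtype.val (mem_tor.1 hl)
      rw [← Nat.sub_add_cancel hba, pow_add, mul_smul, this, smul_zero]
    · exact le_sup_right (a := tor G (p ^ a)) (h2 ⟨v, hv, rfl⟩)

theorem exists_A (hodd : Odd (Nat.card G)) {p a m : ℕ} (hp : p.Prime) (hpn : p ∣ Nat.card G) (hn : Nat.card G = p ^ a * m)
    (hpm : ¬ p ∣ m) (hV : S.Sat (tor G m : Set G)) {x : G} (hx : IsGen x) :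
    ∃ A : AddSubgroup G, S.Sat (A : Set G) ∧ tor G (p ^ a) ≤ A ∧ A ⊓ tor G m ≤ rad (S.cls x) := by
  have hΛ : S.Sat (rad (S.cls x) : Set G) := sat_rad (S.cls_sat x)
  by_cases hpq : p ∣ Nat.card (G ⧸ rad (S.cls x))
  swap
  · refine ⟨rad (S.cls x), hΛ, ?_, inf_le_left⟩
    rw [le_iff_card, card_tor (hn ▸ dvd_mul_right _ m)]
    have hc : (p ^ a).Coprime (Nat.card (G ⧸ rad (S.cls x))) := Nat.Coprime.pow_left a ((Nat.Prime.coprime_iff_not_dvd hp).2 hpq)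
    apply hc.dvd_of_dvd_mul_left
    rw [← card_quot, hn]; exact dvd_mul_right _ _
  have hoq : Odd (Nat.card (G ⧸ rad (S.cls x))) := hodd.of_dvd_nat (card_quot (rad (S.cls x)) ▸ dvd_mul_right _ _)
  have hqn : Nat.card (G ⧸ rad (S.cls x)) ∣ p ^ a * m := by rw [← hn, card_quot (rad (S.cls x))]; exact dvd_mul_right _ _
  have hordq : ∀ z : G, addOrderOf (z : G ⧸ rad (S.cls x)) ∣ addOrderOf z := fun z => addOrderOf_map_dvd (QuotientAddGroup.mk' _) z
  have hcpm : (p ^ a).Coprime m := Nat.Coprime.pow_left a ((Nat.Prime.coprime_iff_not_dvd hp).2 hpm)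
  by_cases hf : (S.quot (rad (S.cls x)) hΛ).Full p x
  · obtain ⟨s, w0, W, T, hpW⟩ := exists_tens hp hpq hoq (gen_quot hx _) hf (rad_quot (S := S) x)
    refine ⟨W.comap (QuotientAddGroup.mk' _), sat_comap_mk T.hW, ?_, ?_⟩
    · intro g hg
      obtain ⟨c, hc⟩ := T.exists_proj
      obtain ⟨w, hw, v, hv, he⟩ := decomp T.sup (g : G ⧸ rad (S.cls x))
      have h1 : c • (g : G ⧸ rad (S.cls x)) = v := by rw [he, hc w hw v hv]
      have hpV : (p ^ a).Coprime (Nat.card ((S.quot (rad (S.cls x)) hΛ).core (mul _ p))) :=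
        Nat.Coprime.pow_left a (T.cop.coprime_dvd_left ((tor_le_iff hp hpq).1 hpW))
      have h2 : v = 0 := by
        rw [← AddMonoid.addOrderOf_eq_one_iff]
        apply Nat.eq_one_of_dvd_coprimes hpV _ (mem_iff_ord.1 hv)
        rw [← h1]
        exact (addOrderOf_smul_dvd c).trans ((hordq g).trans (mem_tor_ord.1 hg))
      rw [AddSubgroup.mem_comap, QuotientAddGroup.mk'_apply, he, h2, add_zero]; exact hw
    · rintro v ⟨hvW, hv⟩
      have h1 : (tor G m).map (QuotientAddGroup.mk' (rad (S.cls x))) ≤ (S.quot (rad (S.cls x)) hΛ).core (mul _ p) := by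
        apply le_core (sat_map_mk hV)
        rintro _ ⟨w, hw, rfl⟩
        have hw' : w ∈ tor G m := hw
        rw [QuotientAddGroup.mk'_apply, mem_mul_iff hpq]
        have hc1 : (addOrderOf (w : G ⧸ rad (S.cls x))).Coprime p :=
          ((Nat.Prime.coprime_iff_not_dvd hp).2 (fun h => hpm (h.trans ((hordq w).trans (mem_tor_ord.1 hw'))))).symm
        apply hc1.dvd_of_dvd_mul_left
        rw [Nat.mul_div_cancel' hpq]
        exact ord_dvd _
      have h2 : (v : G ⧸ rad (S.cls x)) ∈ W ⊓ (S.quot (rad (S.cls x)) hΛ).core (mul _ p) := ⟨hvW, h1 ⟨v, hv, rfl⟩⟩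
      rw [T.inf, AddSubgroup.mem_bot, mk_zero] at h2
      exact h2
  · have hfc := free hoq (gen_quot hx _) (rad_quot (S := S) x)
    obtain ⟨b, m1, hm1, hb⟩ := Nat.exists_eq_pow_mul_and_not_dvd (ncard_ne (G := G ⧸ rad (S.cls x))) p hp.ne_one
    have h1 := hfc.gp p b hp hpq (hb ▸ dvd_mul_right _ _) (by
      intro hc
      rw [hb, pow_succ] at hc
      exact hm1 (Nat.dvd_of_mul_dvd_mul_left (Nat.pow_pos hp.pos) hc)) hf
    refine ⟨_, sat_comap_mk h1, ?_, ?_⟩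
    · intro g hg
      rw [AddSubgroup.mem_comap, QuotientAddGroup.mk'_apply, mem_tor_ord]
      have hc1 : (addOrderOf (g : G ⧸ rad (S.cls x))).Coprime m1 := by
        have : (p ^ a).Coprime m1 := Nat.Coprime.pow_left a ((Nat.Prime.coprime_iff_not_dvd hp).2 hm1)
        exact this.coprime_dvd_left ((hordq g).trans (mem_tor_ord.1 hg))
      apply hc1.dvd_of_dvd_mul_right
      rw [← hb]; exact ord_dvd _
    · rintro v ⟨hvW, hv⟩
      have hvW' : (v : G ⧸ rad (S.cls x)) ∈ tor _ (p ^ b) := hvW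
      rw [← mk_zero, ← AddMonoid.addOrderOf_eq_one_iff]
      have : (p ^ b).Coprime m := Nat.Coprime.pow_left b ((Nat.Prime.coprime_iff_not_dvd hp).2 hpm)
      exact Nat.eq_one_of_dvd_coprimes this (mem_tor_ord.1 hvW') ((hordq v).trans (mem_tor_ord.1 hv))

end SR
end SRP

namespace SRP
open Classical Finset
open scoped Pointwise
universe u
set_option linter.all false
set_option linter.deprecated false

namespace SR
variable {G : Type u} [AddCommGroup G] [Fintype G] {S : SR G}

def ZS (S : SR G) (x : G) (A V : AddSubgroup G) : Set G := {v | v ∈ V ∧ ∃ g ∈ A, S.r x (g + v)}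

theorem mem_ZS {x v : G} {A V : AddSubgroup G} : v ∈ S.ZS x A V ↔ v ∈ V ∧ ∃ g ∈ A, S.r x (g + v) := Iff.rfl

variable {x : G} {A V : AddSubgroup G}

theorem ZS_sat (hA : S.Sat (A : Set G)) (hV : S.Sat (V : Set G)) : S.Sat (S.ZS x A V) := by
  intro v v' hr hv
  obtain ⟨h1, g, hg, h2⟩ := hv
  refine ⟨hV _ _ hr h1, ?_⟩
  have hsat : S.Sat (S.cls x + (A : Set G)) := (S.cls_sat x).add hA
  obtain ⟨y, hy, b, hb, he⟩ := hsat _ _ hr ⟨g + v, h2, -g, A.neg_mem hg, by abel⟩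
  have he' : y + b = v' := he
  refine ⟨-b, A.neg_mem hb, ?_⟩
  rw [← he', add_comm y b, neg_add_cancel_left]; exact hy

theorem ZS_rad_le {v0 : G} (h0 : v0 ∈ S.ZS x A V) : rad (S.ZS x A V) ≤ V := by
  intro l hl
  have := ((mem_rad.1 hl v0).1 h0).1
  have := V.sub_mem this h0.1
  simpa using this

theorem ZS_le_rad : rad (S.cls x) ⊓ V ≤ rad (S.ZS x A V) := by
  rintro l ⟨h1, h2⟩
  apply mem_rad'
  rintro v ⟨hv, g, hg, hr⟩
  refine ⟨V.add_mem h2 hv, g, hg, ?_⟩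
  have := (rad_cls_r (S := S) h1).2 hr
  have e : g + v + l = g + (l + v) := by abel
  rwa [e] at this

theorem ZS_r {g0 v0 v : G} (hA : S.Sat (A : Set G)) (hV : S.Sat (V : Set G)) (hAV : A ⊓ V ≤ rad (S.cls x))
    (hg0 : g0 ∈ A) (hv0 : v0 ∈ V) (hx : x = g0 + v0) (hv : v ∈ S.ZS x A V) : ∃ l ∈ rad (S.ZS x A V), S.r v0 (v + l) := by
  obtain ⟨h1, g, hg, hr⟩ := hv
  rw [hx] at hr
  obtain ⟨g', v', h2, h3, h4⟩ := S.split hr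
  refine ⟨v' - v, ?_, by simpa using h3⟩
  apply ZS_le_rad
  have e : v' - v = g - g' := by
    rw [sub_eq_sub_iff_add_eq_add, h4]; abel
  have hm : v' - v ∈ V := V.sub_mem (hV _ _ h3 hv0) h1
  refine ⟨hAV ⟨?_, hm⟩, hm⟩
  rw [e]; exact A.sub_mem hg (hA _ _ h2 hg0)

variable [IsAddCyclic G]

theorem N1 (hodd : Odd (Nat.card G)) {p a m : ℕ} (hp : p.Prime) (hn : Nat.card G = p ^ a * m) (hpm : ¬ p ∣ m)
    (hx : IsGen x) (hV : S.Sat (tor G m : Set G)) (hA : S.Sat (A : Set G)) (hGA : tor G (p ^ a) ≤ A)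
    (hAV : A ⊓ tor G m ≤ rad (S.cls x)) (hmax : ∀ q : ℕ, q.Prime → q ∣ Nat.card (rad (S.cls x)) → q ≤ p)
    {g0 v0 : G} (hg0 : g0 ∈ tor G (p ^ a)) (hv0 : v0 ∈ tor G m) (hx0 : x = g0 + v0)
    {r : ℕ} (hr : r.Prime) (hrN : r ∣ Nat.card (rad (S.ZS x A (tor G m)))) : r < p := by
  have hz0 : v0 ∈ S.ZS x A (tor G m) := ⟨hv0, g0, hGA hg0, by rw [← hx0]⟩
  have hNV := ZS_rad_le hz0
  have hcV : Nat.card (tor G m) = m := card_tor (hn ▸ dvd_mul_left m _)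
  have hrm : r ∣ m := by
    have := hrN.trans (le_iff_card.1 hNV)
    rwa [hcV] at this
  have hrp : r ≠ p := by rintro rfl; exact hpm hrm
  by_contra hlt
  have hpr : p < r := lt_of_le_of_ne (not_lt.1 hlt) hrp.symm
  have hrn : r ∣ Nat.card G := hn ▸ hrm.mul_left _
  have hRN : tor G r ≤ rad (S.ZS x A (tor G m)) := (tor_le_iff hr hrn).2 hrN
  have hAp : ∀ q : ℕ, q.Prime → q ∣ Nat.card A → q ≤ p := by
    intro q hq hqA
    by_cases hqp : q = p
    · exact hqp.le
    have hqn := hqA.trans (sub_dvd A)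
    have hqm : q ∣ m := by
      rw [hn] at hqn
      rcases (Nat.Prime.dvd_mul hq).1 hqn with h | h
      · exact absurd ((Nat.prime_dvd_prime_iff_eq hq hp).1 (hq.dvd_of_dvd_pow h)) hqp
      · exact h
    apply hmax q hq
    rw [← tor_le_iff hq hqn]
    refine le_trans (le_inf ((tor_le_iff hq hqn).2 hqA) ((tor_le_iff hq hqn).2 (hcV.symm ▸ hqm))) hAV
  have hrA : ¬ r ∣ Nat.card A := fun h => absurd (hAp r hr h) (not_le.2 hpr)
  have hrL : ¬ r ∣ Nat.card (rad (S.cls x)) := fun h => absurd (hmax r hr h) (not_le.2 hpr)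
  by_cases hf : S.Full r x
  · have hnp : ¬ S.PInv r x := fun h => hrL ((tor_le_iff hr hrn).1 h)
    obtain ⟨z0, hz, hnf⟩ := exists_not_full hnp
    obtain ⟨hrV, hmx, W, hW, htW, hsup, hinf, X2, hX2, ⟨s, hs⟩, hsub, hX⟩ := L2 hr hrn hodd hx hf hz hnf
    have hVs := S.core_sat (mul G r)
    have hVr := S.core_le (mul G r)
    have hVne : S.core (mul G r) ≠ ⊤ := by
      intro h
      rw [h] at hrV
      apply hrV
      rw [AddSubgroup.card_top]; exact hrn
    generalize S.core (mul G r) = Vr at *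
    have hAVr : A ≤ Vr := by
      rcases hmx (A ⊔ Vr) (sat_sup hA hVs) le_sup_right with h | h
      · rw [← h]; exact le_sup_left
      · exfalso
        obtain ⟨t, ht, ht0⟩ := exists_tor_ne (G := G) hr hrn
        obtain ⟨b, hb, v, hv, he⟩ := decomp h t
        have h1 : (Nat.card A * Nat.card Vr) • t = 0 := by
          rw [he, smul_add, mul_comm, mul_smul, mem_iff_nsmul.1 hb, mul_comm, mul_smul, mem_iff_nsmul.1 hv]; simp
        have h2 := addOrderOf_dvd_of_nsmul_eq_zero h1
        rw [ord_of_tor hr ht ht0] at h2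
        rcases (Nat.Prime.dvd_mul hr).1 h2 with h | h
        · exact hrA h
        · exact hrV h
    obtain ⟨w0, hw0, hw00⟩ := exists_tor_ne (G := G) hr hrn
    have hw0V : w0 ∉ Vr := fun h => hw00 (tor_inf hr hrV hw0 h)
    obtain ⟨g1, hg1, v1, hv1, he⟩ := decomp (split_pp hp hn hpm) s
    have h1 : S.r x (w0 + s) := (hX _).2 ⟨w0, htW hw0, hw0V, s, hs, rfl⟩
    have h2 : w0 + v1 ∈ S.ZS x A (tor G m) := by
      refine ⟨add_mem (hNV (hRN hw0)) hv1, g1, hGA hg1, ?_⟩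
      have e : g1 + (w0 + v1) = w0 + s := by rw [he]; abel
      rw [e]; exact h1
    obtain ⟨-, g, hg, h3⟩ := (mem_rad.1 (hRN hw0) v1).2 h2
    have hv1V : v1 ∈ Vr := by
      have : v1 = s - g1 := by rw [he]; abel
      rw [this]; exact Vr.sub_mem (hsub hs) (hAVr (hGA hg1))
    obtain ⟨w, hw, hwV, s', hs', he'⟩ := (hX _).1 h3
    apply hwV
    have : w = (g + v1) - s' := by rw [he']; abel
    rw [this]
    exact Vr.sub_mem (Vr.add_mem (hAVr hg) hv1V) (hsub hs')
  · by_cases hrr : r * r ∣ Nat.card G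
    · obtain ⟨l, hl, hl0⟩ := exists_tor_ne (G := G) hr hrn
      obtain ⟨-, g, hg, h3⟩ := (mem_rad.1 (hRN hl) v0).1 hz0
      have e : g + (l + v0) = x + l + (g - g0) := by rw [hx0]; abel
      rw [e] at h3
      refine C2 hodd hr hrr hx hf hl hl0 ?_ h3
      intro q hq hqd
      exact (hAp q hq (hqd.trans (mem_iff_ord.1 (A.sub_mem hg (hGA hg0))))).trans_lt hpr
    · have h1 : ¬ r ∣ Nat.card G / r := by
        intro h
        apply hrr
        obtain ⟨k, hk⟩ := hrn
        rw [hk] at h ⊢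
        rw [Nat.mul_div_cancel_left _ hr.pos] at h
        exact Nat.mul_dvd_mul_left r h
      obtain ⟨l, hl, hlm⟩ := exists_tor_add hr hrn h1 v0
      obtain ⟨-, g, hg, h3⟩ := (mem_rad.1 (hRN hl) v0).1 hz0
      have hgm : g ∈ mul G r := by
        rw [mem_mul_iff hrn]
        have hc : (addOrderOf g).Coprime r := ((Nat.Prime.coprime_iff_not_dvd hr).2 (fun h => hrA (h.trans (mem_iff_ord.1 hg)))).symm
        apply hc.dvd_of_dvd_mul_left
        rw [Nat.mul_div_cancel' hrn]; exact ord_dvd _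
      have h4 : g + (l + v0) ∈ mul G r := add_mem hgm (by rwa [add_comm])
      exact hx.not_mem_mul hr hrn ((L1 hr hrn hx hf) _ _ (S.symm' h3) h4)

theorem ZS_zp (hoV : Odd (Nat.card V)) {g0 v0 : G} (hA : S.Sat (A : Set G)) (hV : S.Sat (V : Set G)) (hAV : A ⊓ V ≤ rad (S.cls x))
    (hg0 : g0 ∈ A) (hv0 : v0 ∈ V) (hx : x = g0 + v0) (hgen : IsGen (⟨v0, hv0⟩ : V))
    (hN : (S.sub V hV).Sat (((rad (S.ZS x A V)).comap V.subtype : AddSubgroup V) : Set V)) :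
    ((S.sub V hV).quot ((rad (S.ZS x A V)).comap V.subtype) hN).ZP := by
  have hz0 : v0 ∈ S.ZS x A V := ⟨hv0, g0, hg0, by rw [← hx]⟩
  have hNV := ZS_rad_le hz0
  have key : ∀ v : V, ((S.sub V hV).quot ((rad (S.ZS x A V)).comap V.subtype) hN).r ((⟨v0, hv0⟩ : V) : V ⧸ _) (v : V ⧸ _) ↔ (v : G) ∈ S.ZS x A V := by
    intro v
    rw [quot_r_iff]
    constructor
    · rintro ⟨l, hl, h⟩
      have h1 := ZS_sat hA hV _ _ ((sub_r (hH := hV)).1 h) hz0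
      have h2 : (l : G) ∈ rad (S.ZS x A V) := hl
      rw [AddSubgroup.coe_add, add_comm] at h1
      exact (mem_rad.1 h2 _).2 h1
    · intro hv
      obtain ⟨l, hl, h⟩ := ZS_r hA hV hAV hg0 hv0 hx hv
      exact ⟨⟨l, hNV hl⟩, hl, (sub_r (hH := hV)).2 h⟩
  refine (free (hoV.of_dvd_nat ?_) (gen_quot hgen _) ?_).zp
  · rw [card_quot ((rad (S.ZS x A V)).comap V.subtype)]; exact dvd_mul_right _ _
  · rw [eq_bot_iff]
    intro b
    induction b using QuotientAddGroup.induction_on with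
    | H b =>
    intro hb
    rw [AddSubgroup.mem_bot, mk_zero]
    show (b : G) ∈ rad (S.ZS x A V)
    apply mem_rad'
    intro z hz
    have h1 := (mem_rad.1 hb (((⟨z, hz.1⟩ : V)) : V ⧸ _)).1 ((key _).2 hz)
    have h2 := (key (b + ⟨z, hz.1⟩)).1 (by rw [QuotientAddGroup.mk_add]; exact h1)
    exact h2

end SR
end SRP

namespace SRP
open Classical Finset
open scoped Pointwise
universe u
set_option linter.all false
set_option linter.deprecated false

namespace SR
variable {G : Type u} [AddCommGroup G] [Fintype G] {S : SR G}

theorem conv_coset {V : AddSubgroup G} (f : G → ℚ) (γ : V → ℚ) (a0 : G) (u : V) :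
    ∑ y, f y * (if hy : a0 + (u : G) - y ∈ V then γ ⟨a0 + u - y, hy⟩ else 0) = ∑ b : V, f (a0 + b) * γ (u - b) := by
  rw [sum_coset V a0]
  · apply Finset.sum_congr rfl
    intro b _
    have e : a0 + (u : G) - (a0 + b) = ((u - b : V) : G) := by
      rw [AddSubgroup.coe_sub]; abel
    have h : a0 + (u : G) - (a0 + b) ∈ V := by rw [e]; exact (u - b).2
    rw [dif_pos h]
    congr 2
    exact Subtype.ext e
  · intro y hy
    rw [dif_neg, mul_zero]
    intro hc
    apply hy
    have := V.sub_mem u.2 hc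
    have e : (u:G) - (a0 + u - y) = y - a0 := by abel
    rwa [e] at this

theorem ext_meas {V : AddSubgroup G} {hV : S.Sat (V : Set G)} {γ : V → ℚ} (hγ : (S.sub V hV).Meas γ) :
    S.Meas (fun y : G => if hy : y ∈ V then γ ⟨y, hy⟩ else 0) := by
  intro y y' hyy
  by_cases hy : y ∈ V
  · have hy' : y' ∈ V := hV _ _ hyy hy
    refine (dif_pos hy).trans (Eq.trans ?_ (dif_pos hy').symm)
    exact hγ _ _ (show (S.sub V hV).r ⟨y, hy⟩ ⟨y', hy'⟩ from sub_r.2 hyy)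
  · have hy' : y' ∉ V := fun h => hy (hV _ _ (S.symm' hyy) h)
    refine (dif_neg hy).trans (Eq.trans ?_ (dif_neg hy').symm)
    rfl

theorem conv_eq {V : AddSubgroup G} {hV : S.Sat (V : Set G)} {γ : V → ℚ} (hγ : (S.sub V hV).Meas γ) {f : G → ℚ} (hf : S.Meas f)
    {a0 a1 : G} {u : V} (h : S.r (a0 + u) (a1 + u)) : ∑ b : V, f (a0 + b) * γ (u - b) = ∑ b : V, f (a1 + b) * γ (u - b) := by
  rw [← conv_coset, ← conv_coset]
  exact hf.conv (ext_meas hγ) _ _ h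

theorem push_sum {V : Type u} [AddCommGroup V] [Fintype V] (N : AddSubgroup V) (F : V → ℚ) (g : V ⧸ N → ℚ) (u : V ⧸ N) :
    ∑ b : V ⧸ N, (∑ v : V, if (v : V ⧸ N) = b then F v else 0) * g (u - b) = ∑ v : V, F v * g (u - v) := by
  simp_rw [Finset.sum_mul]
  rw [Finset.sum_comm]
  apply Finset.sum_congr rfl
  intro v _
  simp [ite_mul]

variable [IsAddCyclic G]

theorem gen_pp {p a m : ℕ} (hp : p.Prime) (hn : Nat.card G = p ^ a * m) (hpm : ¬ p ∣ m) {x g0 v0 : G} (hx : IsGen x)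
    (hg0 : g0 ∈ tor G (p ^ a)) (hv0 : v0 ∈ tor G m) (hx0 : x = g0 + v0) : IsGen (⟨v0, hv0⟩ : tor G m) := by
  unfold IsGen
  rw [AddSubgroup.addOrderOf_mk, card_tor (hn ▸ dvd_mul_left m _)]
  apply Nat.dvd_antisymm (mem_tor_ord.1 hv0)
  have h1 : (p ^ a * addOrderOf v0) • x = 0 := by
    rw [hx0, smul_add, mul_comm, mul_smul, mem_tor.1 hg0, mul_comm, mul_smul, addOrderOf_nsmul_eq_zero]; simp
  have h2 := gen_nsmul hx h1
  rw [hn] at h2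
  exact Nat.dvd_of_mul_dvd_mul_left (Nat.pow_pos hp.pos) h2

theorem gen_lift {V : Type u} [AddCommGroup V] [Fintype V] [IsAddCyclic V] {N : AddSubgroup V} {v : V ⧸ N} (hv : IsGen v) : ∃ w : V, IsGen w ∧ (w : V ⧸ N) = v := by
  obtain ⟨x, hx⟩ := exists_gen (G := V)
  obtain ⟨k, hk⟩ := (gen_quot hx N).exists_nsmul v
  have hkc := coprime_of_gen (hk ▸ hv) (gen_quot hx _)
  obtain ⟨k', hk', hk'n⟩ := lift_coprime (ncard_ne (G := V)) (card_quot N ▸ dvd_mul_right _ _) hkc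
  refine ⟨k' • x, (ord_unit hk'n).trans hx, ?_⟩
  rw [hk, QuotientAddGroup.mk_nsmul]
  exact nsmul_congr (hk'.of_dvd (addOrderOf_dvd_natCard _))

theorem partI_core (hodd : Odd (Nat.card G)) {p a m : ℕ} (hp : p.Prime) (hpn : p ∣ Nat.card G) (hn : Nat.card G = p ^ a * m) (hpm : ¬ p ∣ m)
    {x : G} (hx : IsGen x) (hV : S.Sat (tor G m : Set G))
    (hmax : ∀ q : ℕ, q.Prime → q ∣ Nat.card (rad (S.cls x)) → q ≤ p)
    (htop : ∀ y, AddSubgroup.closure (S.cls y) = ⊤ → S.PInv p y)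
    {h : G} {H : AddSubgroup G} (hH : S.Sat (H : Set G)) (hh : h ∈ H) (hgen : IsGen (⟨h, hh⟩ : H)) (hnf : ¬ S.Full p h)
    (hpp : p * p ∣ Nat.card H) (hhp : h ∉ mul G p) : False := by
  have hpH : p ∣ Nat.card H := (dvd_mul_right p p).trans hpp
  have hle : tor G p ≤ H := (tor_le_iff hp hpn).2 hpH
  obtain ⟨t, ht, ht0⟩ := exists_tor_ne (G := G) hp hpn
  have hC2 : ∀ v : G, (∀ q : ℕ, q.Prime → q ∣ addOrderOf v → q < p) → ¬ S.r h (h + t + v) := by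
    intro v hv hr
    have hvH : v ∈ H := by
      have h1 := H.sub_mem (hH _ _ hr hh) (H.add_mem hh (hle ht))
      rwa [add_sub_cancel_left] at h1
    refine C2 (S := S.sub H hH) (hodd.of_dvd_nat (sub_dvd H)) hp hpp hgen (fun hc => hnf ((sub_full hle hh).1 hc)) (t := ⟨t, hle ht⟩)
      (by rw [mem_tor] at ht ⊢; exact Subtype.ext ht) (fun h0 => ht0 (congrArg Subtype.val h0)) (v := ⟨v, hvH⟩) ?_ ((sub_r (hH := hH)).2 hr)
    intro q hq hd
    rw [AddSubgroup.addOrderOf_mk] at hd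
    exact hv q hq hd
  obtain ⟨A, hA, hGA, hAV⟩ := exists_A hodd hp hpn hn hpm hV hx
  obtain ⟨g0, hg0, v0, hv0, hx0⟩ := decomp (split_pp hp hn hpm) x
  have hz0 : v0 ∈ S.ZS x A (tor G m) := ⟨hv0, g0, hGA hg0, by rw [← hx0]⟩
  have hNV := ZS_rad_le hz0
  have hN1 : ∀ l ∈ rad (S.ZS x A (tor G m)), ∀ q : ℕ, q.Prime → q ∣ addOrderOf l → q < p := by
    intro l hl q hq hd
    exact N1 hodd hp hn hpm hx hV hA hGA hAV hmax hg0 hv0 hx0 hq (hd.trans (mem_iff_ord.1 hl))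
  have hNs : S.Sat (rad (S.ZS x A (tor G m)) : Set G) := sat_rad (ZS_sat hA hV)
  have hN := sat_comap_sub (hH := hV) hNs
  have hzp := ZS_zp (hodd.of_dvd_nat (sub_dvd _)) hA hV hAV (hGA hg0) hv0 hx0 (gen_pp hp hn hpm hx hg0 hv0 hx0) hN
  have hLN := ZS_le_rad (S := S) (x := x) (A := A) (V := tor G m)
  generalize rad (S.ZS x A (tor G m)) = N at *
  obtain ⟨g, hg, s, hs, hgs⟩ := decomp (split_pp hp hn hpm) h
  set F : tor G m → ℚ := fun b => (if g + (b:G) ∈ S.cls h then 1 else 0) - (if (g + t) + (b:G) ∈ S.cls h then 1 else 0) with hF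
  set N' := N.comap (tor G m).subtype with hN'
  have htp : t ∈ tor G (p ^ a) := by
    have ha : p ∣ p ^ a := by
      apply dvd_pow_self
      rintro rfl
      apply hpm
      rwa [hn, pow_zero, one_mul] at hpn
    rw [mem_tor_ord] at ht ⊢
    exact ht.trans ha
  have hzero := hzp (fun b => ∑ v : tor G m, if (v : tor G m ⧸ N') = b then F v else 0) ?_ ?_ ((⟨s, hs⟩ : tor G m) : tor G m ⧸ N')
  · -- positivity
    have hpos : ∀ v : tor G m, 0 ≤ (if (v : tor G m ⧸ N') = ((⟨s, hs⟩ : tor G m) : tor G m ⧸ N') then F v else 0) := by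
      intro v
      split_ifs with hv
      · have hl0 := (mk_eq (L := N')).1 hv
        have hl : s - (v : G) ∈ N := hl0
        have h1 : (g + t) + (v : G) ∉ S.cls h := by
          intro hc
          refine hC2 ((v : G) - s) ?_ ?_
          · apply hN1
            have := N.neg_mem hl
            rwa [neg_sub] at this
          · have e : h + t + ((v : G) - s) = g + t + v := by rw [hgs]; abel
            rw [e]; exact hc
        simp only [hF, if_neg h1, sub_zero]
        split_ifs <;> norm_num
      · exact le_rfl
    have h1 := (Finset.sum_eq_zero_iff_of_nonneg (fun v _ => hpos v)).1 hzero ⟨s, hs⟩ (Finset.mem_univ _)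
    rw [if_pos rfl] at h1
    have h2 : g + s ∈ S.cls h := by rw [← hgs]; exact S.self_mem_cls h
    have h3 : (g + t) + s ∉ S.cls h := by
      intro hc
      refine hC2 0 ?_ ?_
      · intro q hq hd
        rw [addOrderOf_zero] at hd
        exact absurd (Nat.dvd_one.1 hd) hq.ne_one
      · have e : h + t + 0 = g + t + s := by rw [hgs]; abel
        rw [e]; exact hc
    simp only [hF, if_pos h2, if_neg h3] at h1
    norm_num at h1
  · -- same type
    intro D hD y y' hy hy' hyD
    have hD1 := sat_map_sub (sat_comap_mk hD)
    set D1 := (D.comap (QuotientAddGroup.mk' N')).map (tor G m).subtype with hD1d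
    have hAD := sat_sup hA hD1
    have key : ∀ z : tor G m ⧸ N', (∑ v : tor G m, if (v : tor G m ⧸ N') = z then F v else 0) ≠ 0 →
        ∃ v : tor G m, (v : tor G m ⧸ N') = z ∧ ∃ e ∈ tor G (p ^ a), e + (v : G) ∈ S.cls h := by
      intro z hz
      obtain ⟨v, -, hv⟩ := Finset.exists_ne_zero_of_sum_ne_zero hz
      rw [ne_eq, ite_eq_right_iff, Classical.not_imp] at hv
      refine ⟨v, hv.1, ?_⟩
      by_contra hc
      push Not at hc
      apply hv.2
      simp only [hF, if_neg (hc g hg), if_neg (hc (g + t) (add_mem hg htp)), sub_self]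
    obtain ⟨v, rfl, e, he, hve⟩ := key y hy
    obtain ⟨v', rfl, e', he', hve'⟩ := key y' hy'
    have h1 : e + (v : G) ∈ A ⊔ D1 := by
      apply add_mem (le_sup_left (a := A) (hGA he))
      exact le_sup_right (a := A) ⟨v, hyD, rfl⟩
    have h2 : e' + (v' : G) ∈ A ⊔ D1 := hAD _ _ (S.trans' (S.symm' hve) hve') h1
    have h3 : (v' : G) ∈ A ⊔ D1 := by
      have := (A ⊔ D1).sub_mem h2 (le_sup_left (a := A) (hGA he'))
      rwa [add_sub_cancel_left] at this
    rw [AddSubgroup.mem_sup] at h3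
    obtain ⟨α, hα, _, ⟨d, hd, rfl⟩, hαd⟩ := h3
    have hαV : α ∈ tor G m := by
      have : α = v' - (d : G) := by rw [← hαd]; simp
      rw [this]; exact (v' - d).2
    have hαN : α ∈ N := hLN ⟨hAV ⟨hα, hαV⟩, hαV⟩
    have h4 : (v' : tor G m ⧸ N') = (d : tor G m ⧸ N') := by
      rw [eq_comm, mk_eq]
      show ((v' : G) - (d : G)) ∈ N
      have : α = v' - (d : G) := by rw [← hαd]; simp
      rw [← this]; exact hαN
    rw [h4]; exact hd
  · -- vanishing
    rintro γ hγ u ⟨v, hv, hvu⟩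
    rw [push_sum]
    obtain ⟨w, hw, rfl⟩ := gen_lift hv
    induction u using QuotientAddGroup.induction_on with
    | H u =>
    obtain ⟨l, hl, hr⟩ := quot_r_out hvu
    have hul : ((u + l : tor G m) : tor G m ⧸ N') = (u : tor G m ⧸ N') := by
      rw [eq_comm, mk_eq, add_sub_cancel_left]; exact hl
    rw [← hul]
    have hr' := (sub_r (hH := hV)).1 hr
    generalize u + l = u' at *
    have hγ' := quot_meas.1 hγ
    have hfull : S.r (g + u') ((g + t) + u') := by
      have hP : S.PInv p (g + u') := by
        by_contra hbad
        apply hbad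
        apply htop
        have hQ : S.Sat (AddSubgroup.closure (S.cls (g + u')) : Set G) := sat_closure (S.cls_sat _)
        have hQm : g + (u' : G) ∈ AddSubgroup.closure (S.cls (g + u')) := AddSubgroup.subset_closure (S.self_mem_cls _)
        generalize AddSubgroup.closure (S.cls (g + (u' : G))) = Q at *
        obtain ⟨c, hc⟩ := exists_pp (G := G) (a := a) (m := m) hp hpm
        have hgQ : g ∈ Q := by
          have := Q.nsmul_mem hQm c
          rwa [hc g hg u' u'.2] at this
        have huQ : (u' : G) ∈ Q := by
          have := Q.sub_mem hQm hgQ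
          rwa [add_sub_cancel_left] at this
        have hwQ : (w : G) ∈ Q := hQ _ _ (S.symm' hr') huQ
        have hVQ : tor G m ≤ Q := by
          intro z hz
          obtain ⟨k, hk⟩ := hw.exists_nsmul ⟨z, hz⟩
          have : z = k • (w : G) := congrArg Subtype.val hk
          rw [this]; exact Q.nsmul_mem hwQ k
        by_contra hQt
        obtain ⟨q, hq, hqn, hQq⟩ := exists_prime_of_ne_top hQt
        by_cases hqp : q = p
        · subst hqp
          apply hhp
          rw [hgs]
          exact add_mem (hQq hgQ) (hQq (hVQ hs))
        · have hqm : q ∣ m := by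
            have h1 := hqn
            rw [hn] at h1
            rcases (Nat.Prime.dvd_mul hq).1 h1 with h | h
            · exact absurd ((Nat.prime_dvd_prime_iff_eq hq hp).1 (hq.dvd_of_dvd_pow h)) hqp
            · exact h
          have h1 := le_iff_card.1 (hVQ.trans hQq)
          rw [card_tor (hn ▸ dvd_mul_left m _), card_mul hqn, hn] at h1
          obtain ⟨k, rfl⟩ := hqm
          have e : p ^ a * (q * k) / q = p ^ a * k := by
            rw [show p ^ a * (q * k) = q * (p ^ a * k) by ring, Nat.mul_div_cancel_left _ hq.pos]
          rw [e] at h1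
          have hk : 0 < k := by
            rcases Nat.eq_zero_or_pos k with h | h
            · subst h; exact absurd (dvd_zero p) (by simpa using hpm)
            · exact h
          have h2 := Nat.dvd_of_mul_dvd_mul_right hk h1
          exact hqp ((Nat.prime_dvd_prime_iff_eq hq hp).1 (hq.dvd_of_dvd_pow h2))
      have := hP.full (S.rfl' _) t ht
      rwa [add_right_comm] at this
    have hc := conv_eq (hV := hV) hγ' ((S.cls_sat h).meas (1:ℚ) 0) (u := u') hfull
    have e : ∀ v : tor G m, F v * γ ((u' : tor G m ⧸ N') - v) = (if g + (v : G) ∈ S.cls h then (1:ℚ) else 0) * γ ((u' - v : tor G m) : tor G m ⧸ N')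
        - (if g + t + (v : G) ∈ S.cls h then (1:ℚ) else 0) * γ ((u' - v : tor G m) : tor G m ⧸ N') := by
      intro v
      rw [hF, ← sub_mul]; rfl
    rw [Finset.sum_congr rfl (fun v _ => e v), Finset.sum_sub_distrib, sub_eq_zero]
    exact hc

end SR
end SRP


namespace SRP
open Classical Finset
open scoped Pointwise
universe u
set_option linter.all false
set_option linter.deprecated false

theorem pow_dvd_of {p c m d : ℕ} (hp : p.Prime) (h1 : d ∣ p ^ (c + 1) * m) (h2 : ¬ d ∣ p ^ c * m) (hm : m ≠ 0) : p ^ (c + 1) ∣ d := by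
  have hd : d ≠ 0 := by
    rintro rfl
    rw [zero_dvd_iff] at h1
    exact mul_ne_zero (pow_ne_zero _ hp.ne_zero) hm h1
  obtain ⟨b, d', hd', hb⟩ := Nat.exists_eq_pow_mul_and_not_dvd hd p hp.ne_one
  by_cases hbc : b ≤ c
  · exfalso
    apply h2
    rw [hb]
    apply mul_dvd_mul (pow_dvd_pow _ hbc)
    have hc : d'.Coprime (p ^ (c + 1)) := (Nat.Coprime.pow_left _ ((Nat.Prime.coprime_iff_not_dvd hp).2 hd')).symm
    apply hc.dvd_of_dvd_mul_left
    exact (hb ▸ dvd_mul_left d' (p ^ b)).trans h1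
  · rw [hb]
    exact Dvd.dvd.mul_right (pow_dvd_pow _ (by omega)) _

namespace SR
variable {G : Type u} [AddCommGroup G] [Fintype G] {S : SR G}
variable [IsAddCyclic G]

theorem card_lt_of_ne_top {H : AddSubgroup G} (h : H ≠ ⊤) : Nat.card H < Nat.card G := by
  rcases lt_or_eq_of_le (Nat.le_of_dvd (Nat.pos_of_ne_zero ncard_ne) (sub_dvd H)) with h1 | h1
  · exact h1
  · exact absurd ((AddSubgroup.card_eq_iff_eq_top H).1 h1) h

theorem card_quot_lt {L : AddSubgroup G} (h : L ≠ ⊥) : Nat.card (G ⧸ L) < Nat.card G := by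
  have h1 : 1 < Nat.card L := (AddSubgroup.one_lt_card_iff_ne_bot L).2 h
  have h2 := card_quot L
  have h3 : Nat.card (G ⧸ L) ≠ 0 := ncard_ne
  rw [h2]
  exact lt_mul_of_one_lt_right (Nat.pos_of_ne_zero h3) h1

theorem partI (hodd : Odd (Nat.card G))
    (hR : ∀ (K : Type u) [AddCommGroup K] [Fintype K] [IsAddCyclic K], Nat.card K ∣ Nat.card G → Nat.card K < Nat.card G → RP K)
    {x : G} (hx : IsGen x) (hrad : rad (S.cls x) ≠ ⊥) :
    ∃ p : ℕ, p.Prime ∧ p ∣ Nat.card G ∧ AddSubgroup.closure {y | ¬ S.PInv p y} ≠ ⊤ := by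
  have hΛ : S.Sat (rad (S.cls x) : Set G) := sat_rad (S.cls_sat x)
  have hΛ1 : Nat.card (rad (S.cls x)) ≠ 1 := fun h => hrad (AddSubgroup.card_eq_one.1 h)
  have hne : (Nat.card (rad (S.cls x))).primeFactors.Nonempty := by
    rw [Nat.nonempty_primeFactors]
    have := sub_ne (rad (S.cls x))
    omega
  set p := (Nat.card (rad (S.cls x))).primeFactors.max' hne with hpdef
  have hpmem := Finset.max'_mem _ hne
  rw [← hpdef] at hpmem
  have hp : p.Prime := Nat.prime_of_mem_primeFactors hpmem
  have hpΛ : p ∣ Nat.card (rad (S.cls x)) := Nat.dvd_of_mem_primeFactors hpmem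
  have hpn : p ∣ Nat.card G := hpΛ.trans (sub_dvd _)
  have hmax : ∀ q : ℕ, q.Prime → q ∣ Nat.card (rad (S.cls x)) → q ≤ p := fun q hq hd =>
    Finset.le_max' _ _ (Nat.mem_primeFactors.2 ⟨hq, hd, sub_ne _⟩)
  clear_value p
  have hpΛ' : tor G p ≤ rad (S.cls x) := by rw [le_iff_card, card_tor hpn]; exact hpΛ
  refine ⟨p, hp, hpn, fun hbad => ?_⟩
  obtain ⟨a, m, hpm, hn⟩ := Nat.exists_eq_pow_mul_and_not_dvd (ncard_ne (G := G)) p hp.ne_one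
  have hm0 : m ≠ 0 := fun h => ncard_ne (G := G) (by rw [hn, h, mul_zero])
  have hRΛ : RP (G ⧸ rad (S.cls x)) := hR _ (card_quot (rad (S.cls x)) ▸ dvd_mul_right _ _) (card_quot_lt hrad)
  have htop : ∀ y, AddSubgroup.closure (S.cls y) = ⊤ → S.PInv p y := fun y hy => b_top hx hRΛ hpΛ' hy
  obtain ⟨t, ht, ht0⟩ : ∃ t ∈ tor G p, t ≠ 0 := by
    have h1 : tor G p ≠ ⊥ := by
      intro h
      have := card_tor hpn
      rw [h, AddSubgroup.card_bot] at this
      exact hp.ne_one this.symm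
    exact (AddSubgroup.ne_bot_iff_exists_ne_zero.1 h1).elim fun t ht => ⟨t.1, t.2, fun h => ht (Subtype.ext h)⟩
  have hLΛ : AddSubgroup.closure (S.cls t) ≤ rad (S.cls x) := by
    rw [AddSubgroup.closure_le]
    exact hΛ.cls_subset (hpΛ' ht)
  have hpL : tor G p ≤ AddSubgroup.closure (S.cls t) := by
    rw [le_iff_card, card_tor hpn, ← ord_of_tor hp ht ht0]
    exact mem_iff_ord.1 (AddSubgroup.subset_closure (S.self_mem_cls t))
  have hVsat := S.core_sat (tor G m)
  have hVle := S.core_le (tor G m)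
  have hmm : Nat.card (tor G m) = m := card_tor (hn ▸ dvd_mul_left m _)
  have hVtop : S.core (tor G m) ≠ ⊤ := by
    intro h
    rw [h, top_le_iff] at hVle
    rw [hVle, AddSubgroup.card_top] at hmm
    exact hpm (hmm ▸ hpn)
  -- (a)
  have hLV : AddSubgroup.closure (S.cls t) ⊔ S.core (tor G m) ≠ ⊤ := by
    intro h
    obtain ⟨l, hl, v, hv, he⟩ := decomp h x
    apply hVtop
    have h1 : S.r x v := by
      have e : v = x + -l := by rw [he]; abel
      rw [e, rad_cls_r ((rad (S.cls x)).neg_mem (hLΛ hl))]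
    exact hx.eq_top (hVsat _ _ (S.symm' h1) hv)
  have hbs : ∀ y, ¬ S.PInv p y → _ := fun y hy => by
    have h1 : AddSubgroup.closure (S.cls y) ≠ ⊤ := fun h => hy (htop y h)
    exact bad_struct hodd hp hpn hn hpm (hR (AddSubgroup.closure (S.cls y)) (sub_dvd _) (card_lt_of_ne_top h1)) hy ht ht0
  have hself : ∀ y, y ∈ AddSubgroup.closure (S.cls y) := fun y => AddSubgroup.subset_closure (S.self_mem_cls y)
  -- some bad class in the second case
  obtain ⟨y1, hy1, hc1⟩ : ∃ y, ¬ S.PInv p y ∧ ¬ AddSubgroup.closure (S.cls y) ≤ AddSubgroup.closure (S.cls t) ⊔ S.core (tor G m) := by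
    by_contra hcon
    push Not at hcon
    apply hLV
    rw [← top_le_iff, ← hbad, AddSubgroup.closure_le]
    intro y hy
    exact hcon y hy (hself y)
  obtain ⟨h1, hh1, hr1, hg1, hnf1, hpd1, hL1, hle1⟩ := (hbs y1 hy1).resolve_left hc1
  have hLW : AddSubgroup.closure (S.cls t) ≤ tor G (p ^ a) ⊔ S.core (tor G m) := hL1.trans hle1
  have hall : tor G (p ^ a) ⊔ S.core (tor G m) = ⊤ := by
    rw [← top_le_iff, ← hbad, AddSubgroup.closure_le]
    intro y hy
    rcases hbs y hy with h | ⟨_, _, _, _, _, _, _, h⟩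
    · exact (h.trans (sup_le hLW le_sup_right)) (hself y)
    · exact h (hself y)
  have hVm : S.core (tor G m) = tor G m := by
    apply le_antisymm hVle
    intro v hv
    obtain ⟨g, hg, w, hw, he⟩ := decomp hall v
    have h0 : g ∈ tor G (p ^ a) ⊓ tor G m := ⟨hg, by
      have e : g = v - w := by rw [he]; abel
      rw [e]; exact (tor G m).sub_mem hv (hVle hw)⟩
    rw [inf_pp hp hpm, AddSubgroup.mem_bot] at h0
    rw [he, h0, zero_add]; exact hw
  rw [hVm] at hVsat hLV hbs
  have hmp : tor G m ≤ mul G p := by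
    intro v hv
    rw [mem_mul_iff hpn]
    have hc : (addOrderOf v).Coprime p :=
      ((Nat.Prime.coprime_iff_not_dvd hp).2 (fun h => hpm (h.trans (mem_tor_ord.1 hv)))).symm
    apply hc.dvd_of_dvd_mul_left
    rw [Nat.mul_div_cancel' hpn]
    exact ord_dvd _
  have hmulne : mul G p ≠ ⊤ := by
    intro h
    exact hx.not_mem_mul hp hpn (h ▸ AddSubgroup.mem_top x)
  obtain ⟨y, hy, hyp⟩ : ∃ y, ¬ S.PInv p y ∧ ¬ AddSubgroup.closure (S.cls y) ≤ mul G p := by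
    by_contra hcon
    push Not at hcon
    apply hmulne
    rw [← top_le_iff, ← hbad, AddSubgroup.closure_le]
    intro y hy
    exact hcon y hy (hself y)
  obtain ⟨H, h, hh, hHs, hg, hnf, hHp⟩ : ∃ (H : AddSubgroup G) (h : G) (hh : h ∈ H), S.Sat (H : Set G) ∧ IsGen (⟨h, hh⟩ : H) ∧ ¬ S.Full p h ∧ ¬ H ≤ mul G p := by
    rcases hbs y hy with hc | ⟨h, hh, _, hg, hnf, _, _, _⟩
    · refine ⟨_, h1, hh1, sat_closure (S.cls_sat _), hg1, hnf1, fun hle => hyp (hc.trans (sup_le (hL1.trans hle) hmp))⟩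
    · exact ⟨_, h, hh, sat_closure (S.cls_sat _), hg, hnf, hyp⟩
  have hhp : h ∉ mul G p := by
    intro hc
    apply hHp
    intro z hz
    obtain ⟨k, hk⟩ := hg.exists_nsmul ⟨z, hz⟩
    have : z = k • h := congrArg Subtype.val hk
    rw [this]
    exact (mul G p).nsmul_mem hc k
  have ha2 : 2 ≤ a := by
    by_contra hc
    have : a = 0 ∨ a = 1 := by omega
    rcases this with rfl | rfl
    · rw [pow_zero, one_mul] at hn
      exact hpm (hn ▸ hpn)
    · apply hLV
      rw [← top_le_iff, ← split_pp (G := G) hp hn hpm, pow_one]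
      exact sup_le_sup_right hpL _
  obtain ⟨c, rfl⟩ : ∃ c, a = c + 1 := ⟨a - 1, by omega⟩
  have hpp : p ^ (c + 1) ∣ addOrderOf h := by
    apply pow_dvd_of hp (m := m) _ _ hm0
    · rw [← hn]; exact ord_dvd _
    · rw [mem_mul_iff hpn] at hhp
      have e : Nat.card G / p = p ^ c * m := by
        rw [hn]; apply Nat.div_eq_of_eq_mul_left hp.pos; ring
      rwa [e] at hhp
  refine partI_core hodd hp hpn hn hpm hx hVsat hmax htop hHs hh hg hnf ?_ hhp
  have h2 : p * p ∣ p ^ (c + 1) := by rw [← pow_two]; exact pow_dvd_pow _ ha2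
  exact h2.trans (hpp.trans (mem_iff_ord.1 hh))

theorem rp_aux (n : ℕ) : ∀ (G : Type u) [AddCommGroup G] [Fintype G] [IsAddCyclic G], Nat.card G = n → Odd n → RP G := by
  induction n using Nat.strong_induction_on with
  | _ n ih =>
  intro G _ _ _ hn hodd S y hy
  subst hn
  have hR : ∀ (K : Type u) [AddCommGroup K] [Fintype K] [IsAddCyclic K], Nat.card K ∣ Nat.card G → Nat.card K < Nat.card G → RP K :=
    fun K _ _ _ hd hlt => ih _ hlt K rfl (hodd.of_dvd_nat hd)
  obtain ⟨x, hx⟩ := exists_gen (G := G)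
  by_cases hrad : rad (S.cls x) = ⊥
  · exact (free hodd hx hrad).R y hy
  obtain ⟨p, hp, hpn, hb⟩ := partI hodd hR hx hrad
  have hP : S.PInv p y := by
    by_contra hc
    apply hb
    rw [← top_le_iff, ← hy, AddSubgroup.closure_le]
    intro z hz
    apply AddSubgroup.subset_closure
    exact fun h => hc (h.of_r (S.symm' hz))
  have hne : rad (S.cls y) ≠ ⊥ := by
    intro h
    unfold PInv at hP
    rw [h, le_bot_iff] at hP
    have := card_tor hpn
    rw [hP, AddSubgroup.card_bot] at this
    exact hp.ne_one this.symm
  have hRq : RP (G ⧸ rad (S.cls y)) := hR _ (card_quot (rad (S.cls y)) ▸ dvd_mul_right _ _) (card_quot_lt hne)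
  obtain ⟨z, hz, hzg⟩ := hRq (S.quot _ (sat_rad (S.cls_sat y))) y (closure_quot hy)
  obtain ⟨w, hw, rfl⟩ := gen_lift hzg
  exact ⟨w, quot_rad_r.1 hz, hw⟩

theorem rp (hodd : Odd (Nat.card G)) : RP G := rp_aux _ G rfl hodd

theorem exists_bad (hodd : Odd (Nat.card G)) {x : G} (hx : IsGen x) (hrad : rad (S.cls x) ≠ ⊥) :
    ∃ p : ℕ, p.Prime ∧ p ∣ Nat.card G ∧ AddSubgroup.closure {y | ¬ S.PInv p y} ≠ ⊤ :=
  partI hodd (fun K _ _ _ hd _ => rp (hodd.of_dvd_nat hd)) hx hrad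

end SR
end SRP


namespace SRP
open Classical Finset
open scoped Pointwise
universe u
set_option linter.all false
set_option linter.deprecated false

namespace SR
variable {G : Type u} [AddCommGroup G] [Fintype G] {S : SR G}
variable [IsAddCyclic G]

theorem rad_bot (hodd : Odd (Nat.card G))
    (hnorm : ∀ f : Equiv.Perm G, (∀ x y, S.r (y - x) (f y - f x)) → ∀ g, ∃ g', ∀ x, f (x + g) = f x + g')
    {x : G} (hx : IsGen x) : rad (S.cls x) = ⊥ := by
  by_contra hrad
  obtain ⟨p, hp, hpn, hU⟩ := exists_bad hodd hx hrad
  have hbadU : ∀ y, y ∉ AddSubgroup.closure {y | ¬ S.PInv p y} → S.PInv p y := by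
    intro y hy
    by_contra hc
    exact hy (AddSubgroup.subset_closure hc)
  obtain ⟨t, ht, ht0⟩ : ∃ t ∈ tor G p, t ≠ 0 := by
    have h1 : tor G p ≠ ⊥ := by
      intro h
      have := card_tor hpn
      rw [h, AddSubgroup.card_bot] at this
      exact hp.ne_one this.symm
    exact (AddSubgroup.ne_bot_iff_exists_ne_zero.1 h1).elim fun t ht => ⟨t.1, t.2, fun h => ht (Subtype.ext h)⟩
  have htU : t ∈ AddSubgroup.closure {y | ¬ S.PInv p y} := by
    by_contra hc
    have h1 := hbadU t hc
    have h2 := (rad_cls_r (S := S) (h1 ((tor G p).neg_mem ht))).2 (S.rfl' t)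
    rw [add_neg_cancel] at h2
    exact ht0 (r_zero_right.1 h2)
  generalize AddSubgroup.closure {y | ¬ S.PInv p y} = U at *
  obtain ⟨a, ha⟩ : ∃ a, a ∉ U := by
    by_contra hc
    push Not at hc
    exact hU ((AddSubgroup.eq_top_iff' U).2 hc)
  have hUt : ∀ y, y + t - a ∈ U ↔ y - a ∈ U := by
    intro y
    have e : y + t - a = (y - a) + t := by abel
    rw [e]
    exact U.add_mem_cancel_right htU
  have hUt' : ∀ y, y - t - a ∈ U ↔ y - a ∈ U := by
    intro y
    rw [← hUt (y - t), sub_add_cancel]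
  let f : Equiv.Perm G :=
    { toFun := fun y => if y - a ∈ U then y + t else y
      invFun := fun y => if y - a ∈ U then y - t else y
      left_inv := by
        intro y
        by_cases h : y - a ∈ U
        · simp [h, hUt]
        · simp [h]
      right_inv := by
        intro y
        by_cases h : y - a ∈ U
        · simp [h, hUt']
        · simp [h] }
  have hf1 : ∀ y, y - a ∈ U → f y = y + t := fun y h => if_pos h
  have hf2 : ∀ y, y - a ∉ U → f y = y := fun y h => if_neg h
  clear_value f
  have hfs : ∀ y, ∃ s ∈ tor G p, f y = y + s := by
    intro y
    by_cases h : y - a ∈ U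
    · exact ⟨t, ht, hf1 y h⟩
    · exact ⟨0, (tor G p).zero_mem, by rw [hf2 y h, add_zero]⟩
  have haut : ∀ x y, S.r (y - x) (f y - f x) := by
    intro x y
    by_cases hxy : y - x ∈ U
    · have e : f y - f x = y - x := by
        by_cases h : x - a ∈ U
        · have h' : y - a ∈ U := by
            have := U.add_mem hxy h
            rwa [sub_add_sub_cancel] at this
          rw [hf1 _ h, hf1 _ h']; abel
        · have h' : y - a ∉ U := by
            intro hc
            apply h
            have := U.sub_mem hc hxy
            rwa [sub_sub_sub_cancel_left] at this
          rw [hf2 _ h, hf2 _ h']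
      rw [e]
    · obtain ⟨s, hs, e⟩ := hfs x
      obtain ⟨s', hs', e'⟩ := hfs y
      have e2 : f y - f x = (y - x) + (s' - s) := by rw [e, e']; abel
      rw [e2, rad_cls_r (hbadU _ hxy ((tor G p).sub_mem hs' hs))]
  obtain ⟨g', hg'⟩ := hnorm f haut a
  have h0 : f 0 = 0 := hf2 0 (by rw [zero_sub]; exact fun h => ha (by simpa using U.neg_mem h))
  have h1 := hg' 0
  have h2 := hg' a
  have h3 : f a = a + t := hf1 a (by rw [sub_self]; exact U.zero_mem)
  have h4 : f (a + a) = a + a := hf2 _ (by rwa [add_sub_cancel_right])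
  rw [zero_add, h0, zero_add, h3] at h1
  rw [h4, h3, ← h1] at h2
  have h5 : 2 • t = 0 := by
    have e : 2 • t = (a + t + (a + t)) - (a + a) := by rw [two_nsmul]; abel
    rw [e, ← h2, sub_self]
  have h6 : p ∣ 2 := by
    rw [← ord_of_tor hp ht ht0]
    exact addOrderOf_dvd_of_nsmul_eq_zero h5
  have h7 : p = 2 := (Nat.prime_dvd_prime_iff_eq hp Nat.prime_two).1 h6
  rw [h7] at hpn
  exact (Nat.not_even_iff_odd.2 hodd) (even_iff_two_dvd.2 hpn)

theorem final {T : SR G} (hodd : Odd (Nat.card G)) {x : G} (hx : IsGen x) (hrad : rad (S.cls x) = ⊥)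
    (hT : T.Sat (S.cls x)) (y : G) : T.Sat (S.cls y) := by
  have hJx : (S.join T).cls x = S.cls x := by
    apply Set.Subset.antisymm
    · exact (join_sat (S.cls_sat x) hT).cls_subset (S.self_mem_cls x)
    · exact fun z hz => join_left hz
  have hzp := (free (S := S.join T) hodd hx (by rw [hJx]; exact hrad)).zp
  have hleft : ∀ {x y : G}, S.r x y → (S.join T).r x y := fun h => join_left h
  have hright : ∀ {x y : G}, T.r x y → (S.join T).r x y := fun h => join_right h
  generalize S.join T = J at *
  have hhigh : ∀ v u, IsGen v → J.r v u → S.r v u := by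
    intro v u hv h
    obtain ⟨k, hk, rfl⟩ := exists_unit_of_ord_eq (x := x) (y := v) (by rw [show addOrderOf x = Nat.card G from hx, show addOrderOf v = Nat.card G from hv])
    obtain ⟨j, hj, hj1, hj2⟩ := unit_inverse (G := G) hk
    have h1 := schur hj h
    rw [hj1] at h1
    have h2 : j • u ∈ S.cls x := by rw [← hJx]; exact h1
    have h3 := schur hk (mem_cls.1 h2)
    rwa [hj2] at h3
  have hmeas : ∀ {g : G → ℚ}, J.Meas g → S.Meas g := fun hg a b h => hg a b (hleft h)
  set IY : G → ℚ := fun z => if z ∈ S.cls y then 1 else 0 with hIY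
  set IJ : G → ℚ := fun z => if z ∈ J.cls y then 1 else 0 with hIJ
  have hIYm : S.Meas IY := (S.cls_sat y).meas 1 0
  have hIJm : J.Meas IJ := (J.cls_sat y).meas 1 0
  set w : G → ℚ := fun z => (∑ b, IJ b) * IY z - (∑ b, IY b) * IJ z with hw
  have hwm : S.Meas w := by
    intro a b h
    simp only [hw, hIYm a b h, hmeas hIJm a b h]
  have hwsum : ∑ b, w b = 0 := by
    simp only [hw, Finset.sum_sub_distrib, ← Finset.mul_sum]
    ring
  have hwsupp : ∀ z, w z ≠ 0 → J.r y z := by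
    intro z hz
    by_contra hc
    apply hz
    have h1 : z ∉ J.cls y := hc
    have h2 : z ∉ S.cls y := fun h => hc (hleft h)
    simp [hw, hIY, hIJ, h1, h2]
  have hw0 : ∀ b, w b = 0 := by
    apply hzp w
    · intro D hD a b ha hb haD
      exact hD _ _ (J.trans' (J.symm' (hwsupp a ha)) (hwsupp b hb)) haD
    · rintro g hg u ⟨v, hv, hvu⟩
      have hF : S.Meas (fun u => ∑ b, w b * g (u - b)) := hwm.conv (hmeas hg)
      set I : G → ℚ := fun z => if z ∈ J.cls v then 1 else 0 with hI
      have hh : J.Meas (fun b => ∑ c, I c * (fun z => g (-z)) (b - c)) := ((J.cls_sat v).meas (1:ℚ) 0).conv hg.neg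
      have h1 : ∑ c, I c * ∑ b, w b * g (c - b) = 0 := by
        have e : ∑ c, I c * ∑ b, w b * g (c - b) = ∑ b, w b * ∑ c, I c * (fun z => g (-z)) (b - c) := by
          simp_rw [Finset.mul_sum]
          rw [Finset.sum_comm]
          apply Finset.sum_congr rfl; intro b _
          apply Finset.sum_congr rfl; intro c _
          simp only [neg_sub]; ring
        rw [e]
        have e2 : ∀ b, w b * ∑ c, I c * (fun z => g (-z)) (b - c) = w b * ∑ c, I c * (fun z => g (-z)) (y - c) := by
          intro b
          by_cases hb : w b = 0
          · rw [hb, zero_mul, zero_mul]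
          · congr 1
            exact (hh _ _ (hwsupp b hb)).symm
        rw [Finset.sum_congr rfl (fun b _ => e2 b), ← Finset.sum_mul, hwsum, zero_mul]
      have h2 : ∑ c, I c * ∑ b, w b * g (c - b) = (∑ c, I c) * ∑ b, w b * g (u - b) := by
        rw [Finset.sum_mul]
        apply Finset.sum_congr rfl; intro c _
        by_cases hc : c ∈ J.cls v
        · congr 1
          exact hF c u (S.trans' (S.symm' (hhigh v c hv hc)) (hhigh v u hv hvu))
        · simp [hI, hc]
      rw [h1] at h2
      have h3 : 0 < ∑ c, I c := by
        apply Finset.sum_pos'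
        · intro c _; simp only [hI]; split_ifs <;> norm_num
        · refine ⟨v, Finset.mem_univ _, ?_⟩
          simp [hI, J.self_mem_cls v]
      exact (mul_eq_zero.1 h2.symm).resolve_left h3.ne'
  have hYpos : 0 < ∑ c, IY c := by
    apply Finset.sum_pos'
    · intro c _; simp only [hIY]; split_ifs <;> norm_num
    · refine ⟨y, Finset.mem_univ _, ?_⟩
      simp [hIY, S.self_mem_cls y]
  have hJS : ∀ z, J.r y z → S.r y z := by
    intro z hz
    by_contra hc
    have h1 := hw0 z
    have e1 : IY z = 0 := if_neg hc
    have e2 : IJ z = 1 := if_pos hz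
    simp only [hw, e1, e2, mul_zero, mul_one, zero_sub, neg_eq_zero] at h1
    exact hYpos.ne' h1
  intro a b hab ha
  exact hJS _ (J.trans' (hleft ha) (hright hab))

end SR
end SRP

theorem SRP.aux {G : Type*} [CommGroup G]
    [Fintype G] [IsCyclic G] (hodd : Odd (Fintype.card G))
    (S : Set (Set G)) (hS : IsSRing S) (hnorm : IsNormalSRing S)
    (X : Set G) (hX : X ∈ S) (hgen : ∃ x ∈ X, Subgroup.zpowers x = ⊤) :
    ∀ T : Set (Set G), IsSRing T → IsSSet T X → ∀ C ∈ S, IsSSet T C := by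
  classical
  -- uniqueness of classes
  have huniq : ∀ {S : Set (Set G)}, IsSRing S → ∀ {X Y : Set G} {x : G}, X ∈ S → Y ∈ S → x ∈ X → x ∈ Y → X = Y := by
    intro S hS X Y x hX hY hx hy
    obtain ⟨Z, _, hu⟩ := hS.1.2 x
    rw [hu X ⟨hX, hx⟩, hu Y ⟨hY, hy⟩]
  have hbuild : ∀ S : Set (Set G), IsSRing S → ∃ A : SRP.SR (Additive G), ∀ x y : G,
      A.r (Additive.ofMul x) (Additive.ofMul y) ↔ ∃ X ∈ S, x ∈ X ∧ y ∈ X := by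
    intro S hS
    have hcl : ∀ x : G, ∃ X ∈ S, x ∈ X := fun x => by
      obtain ⟨Z, hZ, _⟩ := hS.1.2 x
      exact ⟨Z, hZ.1, hZ.2⟩
    choose cl hclS hclm using hcl
    have hcl' : ∀ {x : G} {X : Set G}, X ∈ S → x ∈ X → X = cl x := fun hX hx => huniq hS hX (hclS _) hx (hclm _)
    let R : Setoid (Additive G) :=
      { r := fun x y => cl x.toMul = cl y.toMul
        iseqv := ⟨fun x => rfl, fun h => h.symm, fun h h' => h.trans h'⟩ }
    have hR : ∀ x y : Additive G, R x y ↔ cl x.toMul = cl y.toMul := fun x y => Iff.rfl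
    have h1 : cl (1 : G) = {1} := (hcl' hS.2.1 rfl).symm
    have hmem : ∀ x y : G, y ∈ cl x ↔ cl x = cl y := fun x y => ⟨fun h => hcl' (hclS x) h, fun h => h ▸ hclm y⟩
    refine ⟨⟨R, ?_, ?_, ?_⟩, ?_⟩
    · intro x h
      have h2 : x.toMul ∈ cl (1 : G) := (hmem _ _).2 h
      rw [h1] at h2
      exact h2
    · intro x y h
      have h2 : y.toMul ∈ cl x.toMul := (hmem _ _).2 h
      have h3 := hS.2.2.1 _ (hclS x.toMul)
      have h4 : (x.toMul)⁻¹ ∈ (fun x : G => x⁻¹) '' cl x.toMul := ⟨_, hclm _, rfl⟩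
      have h5 : (y.toMul)⁻¹ ∈ (fun x : G => x⁻¹) '' cl x.toMul := ⟨_, h2, rfl⟩
      exact (hcl' h3 h4).symm.trans (hcl' h3 h5)
    · intro f g hf hg z z' hz
      have hext : ∀ f : Additive G → ℤ, (∀ x y, R x y → f x = f y) → ∃ F : Set G → ℤ, ∀ x : Additive G, f x = F (cl x.toMul) := by
        intro f hf
        refine ⟨fun X => if h : X.Nonempty then f (Additive.ofMul h.some) else 0, fun x => ?_⟩
        have hne : (cl x.toMul).Nonempty := ⟨_, hclm _⟩
        refine Eq.trans ?_ (dif_pos hne).symm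
        apply hf
        exact (hmem _ _).1 hne.some_mem
      obtain ⟨F, hF⟩ := hext f hf
      obtain ⟨K, hK⟩ := hext g hg
      have key : ∀ z : Additive G, ∑ x, f x * g (z - x) = ∑ c : Set G × Set G,
          ((Finset.univ.filter (fun x : Additive G => (cl x.toMul, cl (z - x).toMul) = c)).card : ℤ) * (F c.1 * K c.2) := by
        intro z
        rw [← Finset.sum_fiberwise (s := Finset.univ) (g := fun x : Additive G => (cl x.toMul, cl (z - x).toMul))]
        apply Finset.sum_congr rfl
        intro c _
        rw [Finset.sum_congr rfl (g := fun _ => F c.1 * K c.2)]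
        · simp
        · intro x hx
          simp only [Finset.mem_filter, Finset.mem_univ, true_and] at hx
          rw [hF, hK, ← hx]
      rw [key, key]
      apply Finset.sum_congr rfl
      rintro ⟨X, Y⟩ _
      congr 2
      by_cases hXY : X ∈ S ∧ Y ∈ S
      · obtain ⟨hX, hY⟩ := hXY
        have cnt : ∀ z : Additive G, (Finset.univ.filter (fun x : Additive G => (cl x.toMul, cl (z - x).toMul) = (X, Y))).card =
            {p : G × G | p.1 ∈ X ∧ p.2 ∈ Y ∧ p.1 * p.2 = z.toMul}.ncard := by
          intro z
          rw [← Set.ncard_coe_finset]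
          refine Set.ncard_congr (fun x _ => (x.toMul, (z - x).toMul)) ?_ ?_ ?_
          · intro x hx
            simp only [Finset.coe_filter, Finset.mem_univ, true_and, Set.mem_ofPred_eq, Prod.mk.injEq] at hx
            refine ⟨?_, ?_, ?_⟩
            · exact hx.1 ▸ hclm _
            · exact hx.2 ▸ hclm _
            · show x.toMul * (z.toMul / x.toMul) = z.toMul
              exact mul_div_cancel _ _
          · intro a b _ _ h
            exact (Prod.mk.inj h).1
          · rintro ⟨a, b⟩ ⟨ha, hb, hab⟩
            have e : (z - Additive.ofMul a).toMul = b := by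
              show z.toMul / a = b
              rw [← hab]; exact mul_div_cancel_left a b
            refine ⟨Additive.ofMul a, ?_, ?_⟩
            · simp only [Finset.coe_filter, Finset.mem_univ, true_and, Set.mem_ofPred_eq, Prod.mk.injEq]
              exact ⟨(hcl' hX ha).symm, by rw [e]; exact (hcl' hY hb).symm⟩
            · exact Prod.ext rfl e
        rw [cnt, cnt]
        exact hS.2.2.2 X hX Y hY _ (hclS z.toMul) _ (hclm _) _ ((hmem _ _).2 hz)
      · have cnt : ∀ z : Additive G, (Finset.univ.filter (fun x : Additive G => (cl x.toMul, cl (z - x).toMul) = (X, Y))) = ∅ := by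
          intro z
          rw [Finset.filter_eq_empty_iff]
          intro x _ h
          have h := Prod.mk.inj h
          exact hXY ⟨h.1 ▸ hclS _, h.2 ▸ hclS _⟩
        rw [cnt, cnt]
    · intro x y
      constructor
      · intro h
        exact ⟨cl x, hclS x, hclm x, (hmem x y).2 h⟩
      · rintro ⟨X, hX, hx, hy⟩
        exact (hcl' hX hx).symm.trans (hcl' hX hy)
  intro T hT hTX C hC
  obtain ⟨A, hA⟩ := hbuild S hS
  obtain ⟨B, hB⟩ := hbuild T hT
  obtain ⟨x, hxX, hx⟩ := hgen
  have hoddA : Odd (Nat.card (Additive G)) := by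
    rw [show Nat.card (Additive G) = Nat.card G from rfl, Nat.card_eq_fintype_card]; exact hodd
  have hxg : SRP.IsGen (Additive.ofMul x) := by
    show addOrderOf (Additive.ofMul x) = Nat.card (Additive G)
    rw [addOrderOf_ofMul_eq_orderOf]
    show orderOf x = Nat.card G
    exact orderOf_eq_card_of_zpowers_eq_top hx
  have hcls : ∀ {Y : Set G} {y : G}, Y ∈ S → y ∈ Y → ∀ z : G, Additive.ofMul z ∈ A.cls (Additive.ofMul y) ↔ z ∈ Y := by
    intro Y y hY hy z
    rw [SRP.SR.mem_cls, hA]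
    constructor
    · rintro ⟨Z, hZ, h1, h2⟩
      rwa [huniq hS hY hZ hy h1]
    · intro h
      exact ⟨Y, hY, hy, h⟩
  have hrad : SRP.rad (A.cls (Additive.ofMul x)) = ⊥ := by
    apply SRP.SR.rad_bot hoddA _ hxg
    intro f0 hf0
    obtain ⟨f, hf⟩ : ∃ f : Equiv.Perm G, ∀ z : G, Additive.ofMul (f z) = f0 (Additive.ofMul z) := ⟨f0, fun _ => rfl⟩
    have haut : IsSRingAut S f := by
      intro Y hY a b
      have h0 : A.r (Additive.ofMul (b * a⁻¹)) (Additive.ofMul (f b * (f a)⁻¹)) := by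
        rw [ofMul_mul, ofMul_mul, ofMul_inv, ofMul_inv, hf, hf, ← sub_eq_add_neg, ← sub_eq_add_neg]
        exact hf0 _ _
      obtain ⟨Z, hZ, h1, h2⟩ := (hA _ _).1 h0
      constructor
      · intro h; rwa [huniq hS hY hZ h h1]
      · intro h; rwa [huniq hS hY hZ h h2]
    intro g
    obtain ⟨g', hg'⟩ := hnorm f haut g.toMul
    refine ⟨Additive.ofMul g', fun z => ?_⟩
    have h1 := congrArg Additive.ofMul (hg' z.toMul)
    rw [ofMul_mul, hf, hf, ofMul_mul] at h1
    exact h1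
  have hTsat : B.Sat (A.cls (Additive.ofMul x)) := by
    intro a b hab ha
    obtain ⟨U, hU, hXU⟩ := hTX
    have ha' : a.toMul ∈ X := (hcls hX hxX _).1 ha
    refine (hcls hX hxX b.toMul).2 ?_
    rw [hXU] at ha' ⊢
    obtain ⟨Y, hY, haY⟩ := ha'
    obtain ⟨Z, hZ, h1, h2⟩ := (hB a.toMul b.toMul).1 hab
    refine ⟨Y, hY, ?_⟩
    rwa [huniq hT (hU hY) hZ haY h1]
  refine ⟨{D | D ∈ T ∧ D ⊆ C}, fun D hD => hD.1, ?_⟩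
  apply Set.Subset.antisymm
  · intro c hc
    obtain ⟨D, hD, _⟩ := hT.1.2 c
    refine ⟨D, ⟨hD.1, ?_⟩, hD.2⟩
    intro d hd
    have h1 : B.r (Additive.ofMul c) (Additive.ofMul d) := (hB c d).2 ⟨D, hD.1, hD.2, hd⟩
    have h2 := SRP.SR.final hoddA hxg hrad hTsat (Additive.ofMul c) _ _ h1 (A.self_mem_cls _)
    exact (hcls hC hc d).1 h2
  · rintro c ⟨D, hD, hc⟩
    exact hD.2 hc

/-- a normal S-ring over a finite cyclic group of odd order is
generated by any of its highest basic sets: it is the smallest S-ring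
containing such a basic set. -/
theorem normal_sring_generated_by_highest {G : Type*} [Group G]
    [Fintype G] [IsCyclic G] (hodd : Odd (Fintype.card G))
    (S : Set (Set G)) (hS : IsSRing S) (hnorm : IsNormalSRing S)
    (X : Set G) (hX : X ∈ S) (hgen : ∃ x ∈ X, Subgroup.zpowers x = ⊤) :
    ∀ T : Set (Set G), IsSRing T → IsSSet T X → ∀ C ∈ S, IsSSet T C := by
  let _ : CommGroup G := IsCyclic.commGroup
  exact SRP.aux hodd S hS hnorm X hX hgen
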